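/- Let Ω ⊆ ℂ be a normalized circle domain whose frontier ∂Ω in ℂ is a countable union of sets of finite one-dimensional Hausdorff measure (He–Schramm rigidity theorem). Then Ω is conformally rigid: every conformal map f from Ω onto a normalized circle domain is the restriction of a Möbius transformation. -/

import Mathlib

open Set Metric Complex Filter MeasureTheory Topology ENNReal NNReal

noncomputable section

/-- A conformal map from `U` onto `V`: an injective holomorphic function on `U` with image `V`. -/
def ConformalMapOnto (f : ℂ → ℂ) (U V : Set ℂ) : Prop :=
  DifferentiableOn ℂ f U ∧ Set.InjOn f U ∧ f '' U = V

/-- `f` agrees on `U` with a Möbius transformation. -/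
def IsMobiusOn (f : ℂ → ℂ) (U : Set ℂ) : Prop :=
  ∃ a b c d : ℂ, a * d - b * c ≠ 0 ∧ ∀ z ∈ U, c * z + d ≠ 0 ∧ f z = (a * z + b) / (c * z + d)

/-- The copy of a planar set in the Riemann sphere `ℂ̂ = OnePoint ℂ`. -/
def sph (S : Set ℂ) : Set (OnePoint ℂ) := (fun z : ℂ => (z : OnePoint ℂ)) '' S

/-- A normalized circle domain: a domain in `ℂ` such that every connected component of its
frontier in the Riemann sphere is a single point or a Euclidean circle. -/
def IsNormalizedCircleDomain (D : Set ℂ) : Prop :=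
  IsOpen D ∧ IsConnected D ∧
    ∀ x ∈ frontier (sph D),
      connectedComponentIn (frontier (sph D)) x = {x} ∨
        ∃ (c : ℂ) (r : ℝ), 0 < r ∧
          connectedComponentIn (frontier (sph D)) x = sph (Metric.sphere c r)

/-- A function on a connected planar domain `Eᶜ` taking only the values `0` and `1` close to `E`
extends to a continuous function on the plane that is locally constant near `E`. -/
theorem exists_locally_constant_extension {E : Set ℂ} (hE : IsClosed E)
    (hU : IsPreconnected Eᶜ) (hne : Eᶜ.Nonempty) (φ : ℂ → ℝ) (hφ : ContinuousOn φ Eᶜ)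
    (h01 : ∀ p ∈ E, ∀ᶠ z in 𝓝[Eᶜ] p, φ z = 0 ∨ φ z = 1) :
    ∃ Φ : ℂ → ℝ, Continuous Φ ∧ (∀ z ∈ Eᶜ, Φ z = φ z) ∧ ∀ p ∈ E, ∀ᶠ z in 𝓝 p, Φ z = Φ p := by
  classical
  set u : ℂ → AddCircle (1 : ℝ) := fun z => if z ∈ E then 0 else (φ z : AddCircle (1 : ℝ)) with hu
  have huE : ∀ p ∈ E, ∀ᶠ z in 𝓝 p, u z = 0 := by
    intro p hp
    have := h01 p hp
    rw [eventually_nhdsWithin_iff] at this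
    filter_upwards [this] with z hz
    by_cases hzE : z ∈ E
    · simp [hu, hzE]
    · simp only [hu, hzE, if_false]
      rcases hz hzE with h | h <;> rw [h]
      · exact AddCircle.coe_zero (p := (1 : ℝ))
      · exact AddCircle.coe_period 1
  have hucont : Continuous u := by
    rw [continuous_iff_continuousAt]
    intro z
    by_cases hz : z ∈ E
    · exact (continuousAt_const (y := (0 : AddCircle (1 : ℝ)))).congr
        ((huE z hz).mono fun x hx => hx.symm)
    · have h1 : ContinuousAt φ z := hφ.continuousAt (hE.isOpen_compl.mem_nhds hz)
      have h2 : ContinuousAt (fun z => (φ z : AddCircle (1 : ℝ))) z :=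
        (AddCircle.continuous_mk' (1 : ℝ)).continuousAt.comp h1
      refine h2.congr ?_
      filter_upwards [hE.isOpen_compl.mem_nhds hz] with x hx
      have hx' : x ∉ E := hx
      simp [hu, hx']
  obtain ⟨z0, hz0⟩ := hne
  have hcov := AddCircle.isCoveringMap_coe (1 : ℝ)
  obtain ⟨Φ, ⟨hΦ0, hΦ⟩, -⟩ := hcov.existsUnique_continuousMap_lifts ⟨u, hucont⟩ z0 (φ z0) (by
    have hz0' : z0 ∉ E := hz0
    simp only [hu, ContinuousMap.coe_mk, hz0', if_false])
  have hΦu : ∀ z, (Φ z : AddCircle (1 : ℝ)) = u z := fun z => congrFun hΦ z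
  refine ⟨Φ, Φ.continuous, ?_, ?_⟩
  · have hint : ∀ z ∈ Eᶜ, ∃ n : ℤ, Φ z - φ z = n := by
      intro z hz
      have h1 := hΦu z
      have hz' : z ∉ E := hz
      simp only [hu, hz', if_false] at h1
      have h2 : ((Φ z - φ z : ℝ) : AddCircle (1 : ℝ)) = 0 := by
        rw [AddCircle.coe_sub, h1, sub_self]
      obtain ⟨n, hn⟩ := (AddCircle.coe_eq_zero_iff (1 : ℝ)).1 h2
      exact ⟨n, by simpa using hn.symm⟩
    have hc : ContinuousOn (fun z => Φ z - φ z) Eᶜ := Φ.continuous.continuousOn.sub hφ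
    have himg : IsPreconnected ((fun z => Φ z - φ z) '' Eᶜ) := hU.image _ hc
    have hsub : ((fun z => Φ z - φ z) '' Eᶜ).Subsingleton := by
      have : ((fun z => Φ z - φ z) '' Eᶜ) ⊆ range ((↑) : ℤ → ℝ) := by
        rintro _ ⟨z, hz, rfl⟩
        obtain ⟨n, hn⟩ := hint z hz
        exact ⟨n, hn.symm⟩
      exact (Set.Countable.isTotallyDisconnected ((countable_range _).mono this)) _ Subset.rfl himg
    intro z hz
    have := hsub (mem_image_of_mem _ hz) (mem_image_of_mem _ hz0)
    simp only [hΦ0, sub_self] at this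
    linarith
  · intro p hp
    have h1 : ∀ᶠ z in 𝓝 p, |Φ z - Φ p| < 1 := by
      have := Metric.continuousAt_iff'.1 (Φ.continuous.continuousAt (x := p)) 1 one_pos
      simpa [Real.dist_eq] using this
    have hint : ∀ z, u z = 0 → ∃ n : ℤ, Φ z = n := by
      intro z hz
      obtain ⟨n, hn⟩ := (AddCircle.coe_eq_zero_iff (1 : ℝ)).1 ((hΦu z).trans hz)
      exact ⟨n, by simpa using hn.symm⟩
    obtain ⟨m, hm⟩ := hint p (huE p hp).self_of_nhds
    filter_upwards [h1, huE p hp] with z hz1 hz2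
    obtain ⟨n, hn⟩ := hint z hz2
    rw [hn, hm] at hz1 ⊢
    have : |n - m| < 1 := by exact_mod_cast hz1
    have : n - m = 0 := Int.abs_lt_one_iff.1 this
    have : n = m := by omega
    rw [this]

theorem eq_of_eventually_eq_of_isPreconnected {X : Type*} [TopologicalSpace X] {Φ : X → ℝ}
    {K : Set X}
    (hK : IsPreconnected K) (h : ∀ p ∈ K, ∀ᶠ z in 𝓝 p, Φ z = Φ p) {p q : X} (hp : p ∈ K)
    (hq : q ∈ K) : Φ p = Φ q := by
  have : PreconnectedSpace K := isPreconnected_iff_preconnectedSpace.1 hK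
  have hl : IsLocallyConstant (fun x : K => Φ x) := by
    rw [IsLocallyConstant.iff_eventually_eq]
    intro x
    exact continuous_subtype_val.continuousAt.eventually (h x x.2)
  exact hl.apply_eq_of_isPreconnected isPreconnected_univ (x := ⟨p, hp⟩) (y := ⟨q, hq⟩)
    (mem_univ _) (mem_univ _)

theorem exists_isClosed_between_connectedComponentIn {E : Set ℂ} (hE : IsCompact E) {x : ℂ}
    (hx : x ∈ E) {V : Set ℂ} (hV : IsOpen V) (hKV : connectedComponentIn E x ⊆ V) :
    ∃ A ⊆ E, IsCompact A ∧ IsCompact (E \ A) ∧ connectedComponentIn E x ⊆ A ∧ A ⊆ V := by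
  have : CompactSpace E := isCompact_iff_compactSpace.1 hE
  rw [connectedComponentIn_eq_image hx] at *
  have hd : Directed (· ⊇ ·)
      (fun s : { s : Set E // IsClopen s ∧ (⟨x, hx⟩ : E) ∈ s } => (s : Set E)) := by
    intro s t
    exact ⟨⟨s ∩ t, s.2.1.inter t.2.1, s.2.2, t.2.2⟩, inter_subset_left, inter_subset_right⟩
  have : Nonempty { s : Set E // IsClopen s ∧ (⟨x, hx⟩ : E) ∈ s } :=
    ⟨⟨univ, isClopen_univ, mem_univ _⟩⟩
  obtain ⟨⟨s, hs, hxs⟩, hsV⟩ := exists_subset_nhds_of_compactSpace hd (fun s => s.2.1.1)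
    (U := ((↑) : E → ℂ) ⁻¹' V) (by
      intro y hy
      rw [← connectedComponent_eq_iInter_isClopen] at hy
      exact (hV.preimage continuous_subtype_val).mem_nhds (hKV (mem_image_of_mem _ hy)))
  refine ⟨(↑) '' s, by simp, (hs.1.isCompact).image continuous_subtype_val, ?_, ?_, ?_⟩
  · have : E \ ((↑) '' s) = ((↑) : E → ℂ) '' sᶜ := by
      ext y
      simp only [Set.mem_sdiff, mem_image, mem_compl_iff, Subtype.exists, exists_and_right,
        exists_eq_right]
      constructor
      · rintro ⟨h1, h2⟩
        exact ⟨h1, fun h => h2 ⟨h1, h⟩⟩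
      · rintro ⟨h1, h2⟩
        exact ⟨h1, fun ⟨h3, h4⟩ => h2 h4⟩
    rw [this]
    exact (hs.compl.1.isCompact).image continuous_subtype_val
  · exact image_mono (hs.connectedComponent_subset hxs)
  · rintro _ ⟨y, hy, rfl⟩
    exact hsV hy

theorem exists_cutoff_of_disjoint_isCompact {A B V : Set ℂ} (hA : IsCompact A) (hB : IsCompact B)
    (hAB : Disjoint A B) (hV : IsOpen V) (hAV : A ⊆ V) :
    ∃ (U₀ U₁ : Set ℂ) (φ : ℂ → ℝ), IsOpen U₀ ∧ IsOpen U₁ ∧ A ⊆ U₀ ∧ B ⊆ U₁ ∧ U₀ ⊆ V ∧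
      Continuous φ ∧ (∀ z ∈ U₀, φ z = 0) ∧ ∀ z ∈ U₁, φ z = 1 := by
  obtain ⟨δ, hδ, hdisj⟩ := hAB.exists_cthickenings hA hB.isClosed
  obtain ⟨η, hη, hsub⟩ := hA.exists_cthickening_subset_open hV hAV
  obtain ⟨φ, h0, h1, -⟩ := exists_continuous_zero_one_of_isClosed
    (isClosed_cthickening (δ := δ) (E := A)) (isClosed_cthickening (δ := δ) (E := B)) hdisj
  refine ⟨thickening (min δ η) A, thickening δ B, φ, isOpen_thickening, isOpen_thickening,
    self_subset_thickening (lt_min hδ hη) _, self_subset_thickening hδ _, ?_, φ.continuous, ?_, ?_⟩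
  · exact (thickening_subset_cthickening _ _).trans
      ((cthickening_mono (min_le_right _ _) _).trans hsub)
  · intro z hz
    exact h0 (cthickening_mono (min_le_left _ _) _ (thickening_subset_cthickening _ _ hz))
  · intro z hz
    exact h1 (thickening_subset_cthickening _ _ hz)

theorem IsPreconnected.inter_frontier_nonempty' {X : Type*} [TopologicalSpace X] {T s : Set X}
    (hT : IsPreconnected T) (h1 : (T ∩ s).Nonempty) (h2 : (T \ s).Nonempty) :
    (T ∩ frontier s).Nonempty := by
  by_contra h
  rw [not_nonempty_iff_eq_empty] at h
  have hcov : T ⊆ interior s ∪ (closure s)ᶜ := by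
    intro x hx
    by_cases hxi : x ∈ interior s
    · exact Or.inl hxi
    · by_cases hxc : x ∈ closure s
      · have : x ∈ T ∩ frontier s := ⟨hx, hxc, hxi⟩
        rw [h] at this
        exact this.elim
      · exact Or.inr hxc
  obtain ⟨x, hxT, hxs⟩ := h1
  obtain ⟨y, hyT, hys⟩ := h2
  have hx : x ∈ interior s := (hcov hxT).resolve_right fun h => h (subset_closure hxs)
  have hy : y ∈ (closure s)ᶜ := (hcov hyT).resolve_left fun h => hys (interior_subset h)
  obtain ⟨z, -, hz1, hz2⟩ := hT _ _ isOpen_interior isClosed_closure.isOpen_compl hcov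
    ⟨x, hxT, hx⟩ ⟨y, hyT, hy⟩
  exact hz2 (interior_subset_closure hz1)

theorem isPreconnected_norm_sub_gt (c : ℂ) {r : ℝ} (hr : 0 ≤ r) :
    IsPreconnected {z : ℂ | r < ‖z - c‖} := by
  have h : {z : ℂ | r < ‖z - c‖} =
      (fun p : ℝ × ℝ => c + p.1 * Complex.exp (p.2 * I)) '' (Ioi r ×ˢ univ) := by
    ext z
    simp only [mem_ofPred_eq, mem_image, mem_prod, mem_Ioi, mem_univ, and_true, Prod.exists]
    constructor
    · intro hz
      exact ⟨‖z - c‖, (z - c).arg, hz, by rw [Complex.norm_mul_exp_arg_mul_I]; ring⟩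
    · rintro ⟨s, θ, hs, rfl⟩
      simp [Complex.norm_exp_ofReal_mul_I, abs_of_pos (hr.trans_lt hs), hs]
  rw [h]
  refine (((convex_Ioi r).prod convex_univ).isPreconnected).image _ (Continuous.continuousOn ?_)
  fun_prop

theorem isPreconnected_compl_closedBall (c : ℂ) {r : ℝ} (hr : 0 ≤ r) :
    IsPreconnected (closedBall c r)ᶜ := by
  convert isPreconnected_norm_sub_gt c hr using 1
  ext z
  simp [dist_eq_norm]

/-- Every connected component of `E` is a closed disk, possibly degenerate. -/
def HasBallComponents (E : Set ℂ) : Prop :=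
  ∀ x ∈ E, ∃ (c : ℂ) (r : ℝ), 0 ≤ r ∧ connectedComponentIn E x = closedBall c r

theorem isClosed_connectedComponentIn_of_isClosed {E : Set ℂ} (hE : IsClosed E) {x : ℂ}
    (hx : x ∈ E) : IsClosed (connectedComponentIn E x) := by
  refine isClosed_of_closure_subset ?_
  exact isPreconnected_connectedComponentIn.closure.subset_connectedComponentIn
    (subset_closure (mem_connectedComponentIn hx))
    (closure_minimal (connectedComponentIn_subset E x) hE)

theorem connectedComponentIn_inter_frontier_nonempty {E : Set ℂ} (hE : IsCompact E) {x : ℂ}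
    (hx : x ∈ E) : (connectedComponentIn E x ∩ frontier E).Nonempty := by
  set K := connectedComponentIn E x
  have hKne : (univ \ K).Nonempty := by
    by_contra h
    rw [not_nonempty_iff_eq_empty, sdiff_eq_empty] at h
    exact noncompact_univ ℂ (by
      rwa [univ_subset_iff.1 (h.trans (connectedComponentIn_subset E x))] at hE)
  obtain ⟨q, -, hq⟩ := isPreconnected_univ.inter_frontier_nonempty' (s := K)
    ⟨x, mem_univ x, mem_connectedComponentIn hx⟩ hKne
  have hcl : IsClosed K := isClosed_connectedComponentIn_of_isClosed hE.isClosed hx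
  have hqK : q ∈ K := hcl.frontier_subset hq
  refine ⟨q, hqK, subset_closure (connectedComponentIn_subset E x hqK), fun hqi => hq.2 ?_⟩
  obtain ⟨ε, hε, hb⟩ := Metric.mem_nhds_iff.1 (mem_interior_iff_mem_nhds.1 hqi)
  refine mem_interior_iff_mem_nhds.2 (Metric.mem_nhds_iff.2 ⟨ε, hε, ?_⟩)
  have := (convex_ball q ε).isPreconnected.subset_connectedComponentIn (mem_ball_self hε) hb
  rwa [← connectedComponentIn_eq hqK] at this

/-- If the complement of the compact set `E` is connected and the components of its frontier are
points and circles, then the components of `E` are points and closed disks. -/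
theorem hasBallComponents_of_frontier {E : Set ℂ} (hE : IsCompact E) (hU : IsPreconnected Eᶜ)
    (hfr : ∀ x ∈ frontier E, ∃ (c : ℂ) (r : ℝ), 0 ≤ r ∧
      connectedComponentIn (frontier E) x = sphere c r) : HasBallComponents E := by
  intro x hx
  obtain ⟨p, hpK, hpf⟩ := connectedComponentIn_inter_frontier_nonempty hE hx
  obtain ⟨c, r, hr, hS⟩ := hfr p hpf
  have hpS : p ∈ sphere c r := hS ▸ mem_connectedComponentIn hpf
  have hfE : frontier E ⊆ E := hE.isClosed.frontier_subset
  have hSE : sphere c r ⊆ frontier E := hS ▸ connectedComponentIn_subset _ _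
  have hne : Eᶜ.Nonempty := by
    by_contra h
    rw [not_nonempty_iff_eq_empty, compl_empty_iff] at h
    exact noncompact_univ ℂ (h ▸ hE)
  have hfc : IsCompact (frontier E) := hE.of_isClosed_subset isClosed_frontier hfE
  refine ⟨c, r, hr, Subset.antisymm ?_ ?_⟩
  · have hKS : connectedComponentIn E x ∩ frontier E ⊆ sphere c r := by
      rintro q ⟨hqK, hqf⟩
      by_contra hqS
      obtain ⟨A, hAE, hA, hA', hSA, hAq⟩ := exists_isClosed_between_connectedComponentIn hfc hpf
        (V := {q}ᶜ) isOpen_compl_singleton (by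
          rw [hS]; intro z hz hzq; rw [mem_singleton_iff] at hzq; exact hqS (hzq ▸ hz))
      obtain ⟨U₀, U₁, φ, hU₀, hU₁, hAU, hBU, -, hφ, h0, h1⟩ :=
        exists_cutoff_of_disjoint_isCompact hA hA' disjoint_sdiff_right isOpen_univ (subset_univ _)
      obtain ⟨Φ, hΦ, hΦφ, hloc⟩ := exists_locally_constant_extension hE.isClosed hU hne φ
        hφ.continuousOn (by
          intro z hz
          by_cases hzf : z ∈ frontier E
          · by_cases hzA : z ∈ A
            · filter_upwards [nhdsWithin_le_nhds (hU₀.mem_nhds (hAU hzA))] with w hw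
              exact Or.inl (h0 w hw)
            · filter_upwards [nhdsWithin_le_nhds (hU₁.mem_nhds (hBU ⟨hzf, hzA⟩))] with w hw
              exact Or.inr (h1 w hw)
          · have hzi : z ∈ interior E := by
              by_contra h
              exact hzf ⟨subset_closure hz, h⟩
            rw [eventually_nhdsWithin_iff]
            filter_upwards [mem_interior_iff_mem_nhds.1 hzi] with w hw hw'
            exact (hw' hw).elim)
      have hcl : ∀ z ∈ frontier E, Φ z = φ z := by
        intro z hz
        have hz' : z ∈ closure Eᶜ := by
          rw [← frontier_compl] at hz; exact hz.1
        exact (isClosed_eq hΦ hφ).closure_subset_iff.2 (fun w hw => hΦφ w hw) hz'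
      have := eq_of_eventually_eq_of_isPreconnected isPreconnected_connectedComponentIn
        (fun w hw => hloc w (connectedComponentIn_subset E x hw)) hpK hqK
      rw [hcl p hpf, hcl q hqf, h0 p (hAU (hSA (mem_connectedComponentIn hpf))),
        h1 q (hBU ⟨hqf, fun h => hAq h rfl⟩)] at this
      norm_num at this
    intro y hy
    by_contra hyB
    obtain ⟨R, hR⟩ := hE.isBounded.subset_closedBall c
    have hnb : ¬ (closedBall c r)ᶜ ⊆ connectedComponentIn E x := by
      intro h
      have : (univ : Set ℂ) ⊆ closedBall c (max r R) := by
        intro w _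
        by_cases hw : w ∈ closedBall c r
        · exact closedBall_subset_closedBall (le_max_left _ _) hw
        · exact closedBall_subset_closedBall (le_max_right _ _)
            (hR (connectedComponentIn_subset E x (h hw)))
      exact noncompact_univ ℂ ((isCompact_closedBall c _).of_isClosed_subset isClosed_univ this)
    obtain ⟨q, hqB, hqf⟩ := (isPreconnected_compl_closedBall c hr).inter_frontier_nonempty'
      (s := connectedComponentIn E x) ⟨y, hyB, hy⟩ (by
        obtain ⟨w, hw, hw'⟩ := not_subset.1 hnb
        exact ⟨w, hw, hw'⟩)
    have hcl : IsClosed (connectedComponentIn E x) :=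
      isClosed_connectedComponentIn_of_isClosed hE.isClosed hx
    have hqK := hcl.frontier_subset hqf
    by_cases hqi : q ∈ interior E
    · refine hqf.2 ?_
      obtain ⟨ε, hε, hb⟩ := Metric.mem_nhds_iff.1 (mem_interior_iff_mem_nhds.1 hqi)
      refine mem_interior_iff_mem_nhds.2 (Metric.mem_nhds_iff.2 ⟨ε, hε, ?_⟩)
      have := (convex_ball q ε).isPreconnected.subset_connectedComponentIn (mem_ball_self hε) hb
      rwa [← connectedComponentIn_eq hqK] at this
    · exact hqB (sphere_subset_closedBall
        (hKS ⟨hqK, subset_closure (connectedComponentIn_subset E x hqK), hqi⟩))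
  · have hBE : closedBall c r ⊆ E := by
      intro y hy
      rcases hr.eq_or_lt with h0 | hpos
      · refine hfE (hSE ?_)
        rw [← h0] at hy ⊢
        simpa using hy
      by_contra hyE
      obtain ⟨R, hR⟩ := hE.isBounded.subset_closedBall c
      obtain ⟨w, hwR⟩ : ∃ w, w ∉ closedBall c (max r R) := by
        by_contra! h
        exact noncompact_univ ℂ ((isCompact_closedBall c (max r R)).of_isClosed_subset
          isClosed_univ fun w _ => h w)
      obtain ⟨q, hq1, hq2⟩ := hU.inter_frontier_nonempty' (s := closedBall c r) ⟨y, hyE, hy⟩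
        ⟨w, fun h => hwR (closedBall_subset_closedBall (le_max_right _ _) (hR h)),
          fun h => hwR (closedBall_subset_closedBall (le_max_left _ _) h)⟩
      rw [frontier_closedBall _ hpos.ne'] at hq2
      exact hq1 (hfE (hSE hq2))
    rw [connectedComponentIn_eq hpK]
    exact (convex_closedBall c r).isPreconnected.subset_connectedComponentIn
      (sphere_subset_closedBall hpS) hBE

/-- A homeomorphism between the complements of `E` and `E'`, together with its inverse, which
stays bounded near `E`. -/
structure EndHomeo (E E' : Set ℂ) (g g' : ℂ → ℂ) : Prop where
  continuousOn : ContinuousOn g Eᶜ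
  continuousOn_symm : ContinuousOn g' E'ᶜ
  mapsTo : MapsTo g Eᶜ E'ᶜ
  mapsTo_symm : MapsTo g' E'ᶜ Eᶜ
  leftInv : ∀ z ∈ Eᶜ, g' (g z) = z
  rightInv : ∀ w ∈ E'ᶜ, g (g' w) = w
  bdd : ∀ p ∈ E, ∃ M : ℝ, ∀ᶠ z in 𝓝[Eᶜ] p, ‖g z‖ ≤ M
  bdd_symm : ∀ p ∈ E', ∃ M : ℝ, ∀ᶠ z in 𝓝[E'ᶜ] p, ‖g' z‖ ≤ M

namespace EndHomeo

variable {E E' : Set ℂ} {g g' : ℂ → ℂ}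

theorem symm (h : EndHomeo E E' g g') : EndHomeo E' E g' g :=
  ⟨h.2, h.1, h.4, h.3, h.6, h.5, h.8, h.7⟩

theorem eventually_mem (h : EndHomeo E E' g g') {N : Set ℂ} (hN : IsOpen N) (hEN : E' ⊆ N) {p : ℂ}
    (hp : p ∈ E) : ∀ᶠ z in 𝓝[Eᶜ] p, g z ∈ N := by
  obtain ⟨M, hM⟩ := h.bdd p hp
  have hK : IsCompact (closedBall (0 : ℂ) M \ N) := (isCompact_closedBall 0 M).diff hN
  have hKE : closedBall (0 : ℂ) M \ N ⊆ E'ᶜ := fun z hz hzE => hz.2 (hEN hzE)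
  have hgK : IsCompact (image g' (closedBall (0 : ℂ) M \ N)) :=
    hK.image_of_continuousOn (h.continuousOn_symm.mono hKE)
  have hpK : p ∈ (image g' (closedBall (0 : ℂ) M \ N))ᶜ := by
    rintro ⟨w, hw, rfl⟩
    exact h.mapsTo_symm (hKE hw) hp
  have h1 : ∀ᶠ z in 𝓝[Eᶜ] p, z ∈ (image g' (closedBall (0 : ℂ) M \ N))ᶜ :=
    mem_nhdsWithin_of_mem_nhds (hgK.isClosed.isOpen_compl.mem_nhds hpK)
  filter_upwards [hM, h1, self_mem_nhdsWithin] with z hzM hz1 hzE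
  by_contra hzN
  exact hz1 ⟨g z, ⟨by simpa using hzM, hzN⟩, h.leftInv z hzE⟩

theorem exists_extension (h : EndHomeo E E' g g') (hE : IsClosed E) (hU : IsPreconnected Eᶜ)
    (hne : Eᶜ.Nonempty) {U₀ U₁ : Set ℂ} {φ : ℂ → ℝ} (h0 : IsOpen U₀) (h1 : IsOpen U₁)
    (hsub : E' ⊆ U₀ ∪ U₁) (hφ : Continuous φ) (hφ0 : ∀ z ∈ U₀, φ z = 0)
    (hφ1 : ∀ z ∈ U₁, φ z = 1) :
    ∃ Φ : ℂ → ℝ, Continuous Φ ∧ (∀ z ∈ Eᶜ, Φ z = φ (g z)) ∧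
      ∀ p ∈ E, ∀ᶠ z in 𝓝 p, Φ z = Φ p := by
  refine exists_locally_constant_extension hE hU hne (fun z => φ (g z))
    (hφ.comp_continuousOn h.continuousOn) fun p hp => ?_
  filter_upwards [h.eventually_mem (h0.union h1) hsub hp] with z hz
  rcases hz with hz | hz
  · exact Or.inl (hφ0 _ hz)
  · exact Or.inr (hφ1 _ hz)

end EndHomeo

/-- A limit along a cluster point. -/
theorem eq_of_mapClusterPt_of_tendsto {X : Type*} {l : Filter X} {g : X → ℂ} {φ : ℂ → ℝ} {t : ℂ}
    {c : ℝ} (hg : MapClusterPt t l g) (hφ : ContinuousAt φ t)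
    (hc : Tendsto (fun x => φ (g x)) l (𝓝 c)) : φ t = c := by
  have h1 : MapClusterPt (φ t) l (φ ∘ g) := hg.continuousAt_comp hφ
  by_contra hne
  obtain ⟨u, v, hu, hv, huv⟩ := t2_separation_nhds hne
  have := (h1.frequently hu).and_eventually (hc hv)
  obtain ⟨x, hx, hx'⟩ := this.exists
  exact huv.le_bot ⟨hx, hx'⟩

theorem IsPreconnected.subset_of_isClosed_diff {X : Type*} [TopologicalSpace X] {E A T : Set X}
    (hT : IsPreconnected T) (hTE : T ⊆ E) (hA : IsClosed A) (hB : IsClosed (E \ A))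
    (hTA : (T ∩ A).Nonempty) : T ⊆ A := by
  rcases isPreconnected_iff_subset_of_disjoint_closed.1 hT A (E \ A) hA hB
    (fun x hx => by by_cases h : x ∈ A <;> simp [h, hTE hx]) (by ext; simp) with h | h
  · exact h
  · obtain ⟨x, hx, hxA⟩ := hTA
    exact absurd hxA (h hx).2

namespace EndHomeo

variable {E E' : Set ℂ} {g g' : ℂ → ℂ}

/-- The correspondence between the components of `E` and `E'`. -/
theorem exists_component_map (h : EndHomeo E E' g g') (hE : IsCompact E) (hE' : IsCompact E')
    (hU : IsPreconnected Eᶜ) (hU' : IsPreconnected E'ᶜ) :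
    ∃ τ : ℂ → ℂ, (∀ x ∈ E, τ x ∈ E') ∧
      (∀ x ∈ E, ∀ y ∈ connectedComponentIn E x, τ y = τ x) ∧
      (∀ x ∈ E, ∀ V : Set ℂ, IsOpen V → connectedComponentIn E' (τ x) ⊆ V → ∀ᶠ z in 𝓝 x,
        (z ∉ E → g z ∈ V) ∧ (z ∈ E → connectedComponentIn E' (τ z) ⊆ V)) ∧
      ∀ x ∈ E, ∀ y ∈ E, connectedComponentIn E' (τ x) = connectedComponentIn E' (τ y) →
        connectedComponentIn E x = connectedComponentIn E y := by
  classical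
  have hne : ∀ {K : Set ℂ}, IsCompact K → Kᶜ.Nonempty := fun {K} hK => by
    rw [nonempty_compl]; rintro rfl; exact noncompact_univ ℂ hK
  -- a boundary point of each component, depending on the component only
  have hP : ∀ K : Set ℂ, ∃ p : ℂ, (K ∩ frontier E).Nonempty → p ∈ K ∩ frontier E := fun K => by
    by_cases hK : (K ∩ frontier E).Nonempty
    · exact ⟨_, fun _ => hK.some_mem⟩
    · exact ⟨0, fun h => absurd h hK⟩
  choose P hP using hP
  have hPx : ∀ x ∈ E, P (connectedComponentIn E x) ∈ connectedComponentIn E x ∩ frontier E :=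
    fun x hx => hP _ (connectedComponentIn_inter_frontier_nonempty hE hx)
  have hT : ∀ p : ℂ, ∃ t : ℂ, p ∈ frontier E → t ∈ E' ∧ MapClusterPt t (𝓝[Eᶜ] p) g := fun p => by
    by_cases hp : p ∈ frontier E
    · have hpE : p ∈ E := hE.isClosed.frontier_subset hp
      have hcl : p ∈ closure Eᶜ := by rw [closure_compl]; exact hp.2
      have : (𝓝[Eᶜ] p).NeBot := mem_closure_iff_nhdsWithin_neBot.1 hcl
      obtain ⟨M, hM⟩ := h.bdd p hpE
      obtain ⟨t, -, ht⟩ := (isCompact_closedBall (0 : ℂ) M).exists_mapClusterPt (f := 𝓝[Eᶜ] p)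
        (u := g) (by
          rw [Filter.le_principal_iff, Filter.mem_map]
          filter_upwards [hM] with z hz
          simpa using hz)
      refine ⟨t, fun _ => ⟨?_, ht⟩⟩
      by_contra htE
      obtain ⟨u, v, hu, hv, htu, hEv, huv⟩ :=
        SeparatedNhds.of_isCompact_isCompact (isCompact_singleton (x := t)) hE'
          (disjoint_singleton_left.2 htE)
      obtain ⟨z, hz, hz'⟩ := ((ht.frequently (hu.mem_nhds (htu rfl))).and_eventually
        (h.eventually_mem hv hEv hpE)).exists
      exact huv.le_bot ⟨hz, hz'⟩
    · exact ⟨0, fun h => absurd h hp⟩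
  choose T hT using hT
  set τ : ℂ → ℂ := fun x => T (P (connectedComponentIn E x)) with hτ
  have hτE : ∀ x ∈ E, τ x ∈ E' := fun x hx => (hT _ (hPx x hx).2).1
  have hcl : ∀ x ∈ E, MapClusterPt (τ x) (𝓝[Eᶜ] (P (connectedComponentIn E x))) g :=
    fun x hx => (hT _ (hPx x hx).2).2
  refine ⟨τ, hτE, fun x hx y hy => ?_, fun x hx V hV hxV => ?_, fun x hx y hy hxy => ?_⟩
  · simp only [hτ]; rw [connectedComponentIn_eq hy]
  · obtain ⟨A, hAE, hA, hB, hxA, hAV⟩ :=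
      exists_isClosed_between_connectedComponentIn hE' (hτE x hx) hV hxV
    obtain ⟨U₀, U₁, φ, h0, h1, hA0, hB1, h0V, hφ, hφ0, hφ1⟩ :=
      exists_cutoff_of_disjoint_isCompact hA hB disjoint_sdiff_self_right hV hAV
    have hsub : E' ⊆ U₀ ∪ U₁ := fun z hz => by
      by_cases hzA : z ∈ A
      · exact Or.inl (hA0 hzA)
      · exact Or.inr (hB1 ⟨hz, hzA⟩)
    obtain ⟨Φ, hΦ, hΦg, hΦE⟩ := h.exists_extension hE.isClosed hU (hne hE) h0 h1 hsub hφ hφ0 hφ1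
    have key : ∀ y ∈ E, Φ y = φ (τ y) := fun y hy => by
      have hp := hPx y hy
      have e1 : Φ y = Φ (P (connectedComponentIn E y)) :=
        eq_of_eventually_eq_of_isPreconnected (isPreconnected_connectedComponentIn (x := y))
          (fun p hp => hΦE p (connectedComponentIn_subset _ _ hp)) (mem_connectedComponentIn hy)
          hp.1
      rw [e1]
      symm
      refine eq_of_mapClusterPt_of_tendsto (hcl y hy) hφ.continuousAt ?_
      refine ((hΦ.tendsto _).mono_left nhdsWithin_le_nhds).congr' ?_
      filter_upwards [self_mem_nhdsWithin] with z hz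
      exact hΦg z hz
    have hΦx : Φ x = 0 := by
      rw [key x hx]
      exact hφ0 _ (hA0 (hxA (mem_connectedComponentIn (hτE x hx))))
    have hev := eventually_nhdsWithin_iff.1 (h.eventually_mem (h0.union h1) hsub hx)
    filter_upwards [hΦE x hx, hev] with z hz hz2
    refine ⟨fun hzE => ?_, fun hzE => ?_⟩
    · rcases hz2 hzE with h2 | h2
      · exact h0V h2
      · have h3 := hΦg z hzE
        rw [hz, hΦx, hφ1 _ h2] at h3
        norm_num at h3
    · have hzA : τ z ∈ A := by
        by_contra hzA
        have := key z hzE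
        rw [hz, hΦx, hφ1 _ (hB1 ⟨hτE z hzE, hzA⟩)] at this
        norm_num at this
      exact (isPreconnected_connectedComponentIn.subset_of_isClosed_diff
        (connectedComponentIn_subset _ _) hA.isClosed hB.isClosed
        ⟨_, mem_connectedComponentIn (hτE z hzE), hzA⟩).trans hAV
  · by_contra hne'
    have hdisj : connectedComponentIn E x ⊆ (connectedComponentIn E y)ᶜ := fun z hz hz' =>
      hne' ((connectedComponentIn_eq hz).trans (connectedComponentIn_eq hz').symm)
    have hV : IsOpen (connectedComponentIn E y)ᶜ :=
      (isClosed_connectedComponentIn_of_isClosed hE.isClosed hy).isOpen_compl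
    obtain ⟨A, hAE, hA, hB, hxA, hAV⟩ :=
      exists_isClosed_between_connectedComponentIn hE hx hV hdisj
    obtain ⟨U₀, U₁, φ, h0, h1, hA0, hB1, h0V, hφ, hφ0, hφ1⟩ :=
      exists_cutoff_of_disjoint_isCompact hA hB disjoint_sdiff_self_right hV hAV
    have hsub : E ⊆ U₀ ∪ U₁ := fun z hz => by
      by_cases hzA : z ∈ A
      · exact Or.inl (hA0 hzA)
      · exact Or.inr (hB1 ⟨hz, hzA⟩)
    obtain ⟨Φ, hΦ, hΦg, hΦE⟩ :=
      h.symm.exists_extension hE'.isClosed hU' (hne hE') h0 h1 hsub hφ hφ0 hφ1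
    have key : ∀ y ∈ E, Φ (τ y) = φ (P (connectedComponentIn E y)) := fun y hy => by
      refine eq_of_mapClusterPt_of_tendsto (hcl y hy) hΦ.continuousAt ?_
      refine ((hφ.tendsto _).mono_left nhdsWithin_le_nhds).congr' ?_
      filter_upwards [self_mem_nhdsWithin] with z hz
      rw [hΦg _ (h.mapsTo hz), h.leftInv z hz]
    have e1 : Φ (τ x) = Φ (τ y) :=
      eq_of_eventually_eq_of_isPreconnected (isPreconnected_connectedComponentIn (x := τ x))
        (fun p hp => hΦE p (connectedComponentIn_subset _ _ hp))
        (mem_connectedComponentIn (hτE x hx)) (hxy ▸ mem_connectedComponentIn (hτE y hy))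
    rw [key x hx, key y hy, hφ0 _ (hA0 (hxA (hPx x hx).1)),
      hφ1 _ (hB1 ⟨connectedComponentIn_subset _ _ (hPx y hy).1,
        fun hh => hAV hh (hPx y hy).1⟩)] at e1
    norm_num at e1

/-- The extension of a homeomorphism `g` to `E` by the centres of the corresponding disks. -/
theorem exists_center_extension (h : EndHomeo E E' g g') (hE : IsCompact E) (hE' : IsCompact E')
    (hU : IsPreconnected Eᶜ) (hU' : IsPreconnected E'ᶜ) (hB' : HasBallComponents E') :
    ∃ (F : ℂ → ℂ) (s : ℂ → ℝ), (∀ z ∈ Eᶜ, F z = g z) ∧ (∀ z ∈ E, 0 ≤ s z) ∧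
      (∀ p ∈ E, ∀ ε > 0, ∀ᶠ z in 𝓝 p, ‖F z - F p‖ ≤ s p + ε) ∧
      (∀ x ∈ E, ∀ y ∈ connectedComponentIn E x, F y = F x ∧ s y = s x) ∧
      (∀ x ∈ E, closedBall (F x) (s x) ⊆ E') ∧
      ∀ x ∈ E, ∀ y ∈ E, connectedComponentIn E x ≠ connectedComponentIn E y →
        Disjoint (closedBall (F x) (s x)) (closedBall (F y) (s y)) := by
  classical
  obtain ⟨τ, h1, h2, h3, h4⟩ := h.exists_component_map hE hE' hU hU'
  have hc : ∀ t : ℂ, ∃ q : ℂ × ℝ, t ∈ E' → 0 ≤ q.2 ∧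
      connectedComponentIn E' t = closedBall q.1 q.2 := fun t => by
    by_cases ht : t ∈ E'
    · obtain ⟨c, r, hr, hh⟩ := hB' t ht
      exact ⟨(c, r), fun _ => ⟨hr, hh⟩⟩
    · exact ⟨0, fun h => absurd h ht⟩
  choose q hq using hc
  refine ⟨fun z => if z ∈ E then (q (τ z)).1 else g z, fun z => (q (τ z)).2, ?_, ?_, ?_, ?_, ?_, ?_⟩
  · intro z hz; simp only [if_neg (show z ∉ E from hz)]
  · intro z hz; exact (hq _ (h1 z hz)).1
  · intro p hp ε hε
    have hsub : connectedComponentIn E' (τ p) ⊆ ball (q (τ p)).1 ((q (τ p)).2 + ε) := by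
      rw [(hq _ (h1 p hp)).2]; exact closedBall_subset_ball (by linarith)
    filter_upwards [h3 p hp _ isOpen_ball hsub] with z hz
    simp only [if_pos hp]
    by_cases hzE : z ∈ E
    · simp only [if_pos hzE]
      have := hz.2 hzE
      rw [(hq _ (h1 z hzE)).2] at this
      have := this (mem_closedBall_self (hq _ (h1 z hzE)).1)
      rw [mem_ball, dist_eq_norm] at this
      exact this.le
    · simp only [if_neg hzE]
      have := hz.1 hzE
      rw [mem_ball, dist_eq_norm] at this
      exact this.le
  · intro x hx y hy
    have hyE := connectedComponentIn_subset _ _ hy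
    simp only [if_pos hx, if_pos hyE, h2 x hx y hy, and_self]
  · intro x hx
    simp only [if_pos hx]
    rw [← (hq _ (h1 x hx)).2]; exact connectedComponentIn_subset _ _
  · intro x hx y hy hxy
    simp only [if_pos hx, if_pos hy]
    rw [← (hq _ (h1 x hx)).2, ← (hq _ (h1 y hy)).2, disjoint_left]
    intro t ht ht'
    exact hxy (h4 x hx y hy ((connectedComponentIn_eq ht).trans (connectedComponentIn_eq ht').symm))

end EndHomeo

theorem exists_cover_of_hausdorffMeasure_lt_top {S : Set ℂ} (hS : μH[1] S < ⊤) {r : ℝ≥0∞}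
    (hr : 0 < r) : ∃ t : ℕ → Set ℂ, S ⊆ ⋃ n, t n ∧ (∀ n, ediam (t n) ≤ r) ∧
      ∑' n, (⨆ _ : (t n).Nonempty, ediam (t n)) ≤ μH[1] S + 1 := by
  have h1 : (⨅ (t : ℕ → Set ℂ) (_ : S ⊆ ⋃ n, t n) (_ : ∀ n, ediam (t n) ≤ r),
      ∑' n, ⨆ _ : (t n).Nonempty, ediam (t n) ^ (1 : ℝ)) < μH[1] S + 1 := by
    refine lt_of_le_of_lt ?_ (ENNReal.lt_add_right hS.ne one_ne_zero)
    rw [Measure.hausdorffMeasure_apply]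
    exact le_iSup₂ (f := fun (r : ℝ≥0∞) (_ : 0 < r) =>
      ⨅ (t : ℕ → Set ℂ) (_ : S ⊆ ⋃ n, t n) (_ : ∀ n, ediam (t n) ≤ r),
      ∑' n, ⨆ _ : (t n).Nonempty, ediam (t n) ^ (1 : ℝ)) r hr
  simp only [iInf_lt_iff, ENNReal.rpow_one] at h1
  obtain ⟨t, ht, ht', h⟩ := h1
  exact ⟨t, ht, ht', h.le⟩

/-- Almost every fibre of a `1`-Lipschitz function on a set of finite length is finite. -/
theorem ae_finite_fiber {S : Set ℂ} (hS : μH[1] S < ⊤) {π : ℂ → ℝ} (hπ : LipschitzWith 1 π) :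
    ∀ᵐ y : ℝ, (S ∩ π ⁻¹' {y}).Finite := by
  have hpos : ∀ n : ℕ, (0 : ℝ≥0∞) < ((n : ℝ≥0∞) + 1)⁻¹ := fun n =>
    ENNReal.inv_pos.2 (by finiteness)
  choose t hcov hdiam hsum using fun n : ℕ => exists_cover_of_hausdorffMeasure_lt_top hS (hpos n)
  set J : ℕ → ℕ → Set ℝ := fun n i => toMeasurable volume (π '' t n i) with hJ
  have hJm : ∀ n i, MeasurableSet (J n i) := fun n i => measurableSet_toMeasurable _ _
  set N : ℕ → ℝ → ℝ≥0∞ := fun n y => ∑' i, (J n i).indicator 1 y with hN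
  have hNm : ∀ n, Measurable (N n) := fun n =>
    Measurable.tsum fun i => measurable_one.indicator (hJm n i)
  have hint : ∀ n, ∫⁻ y, N n y ≤ μH[1] S + 1 := fun n => by
    simp only [hN]
    rw [lintegral_tsum fun i => (measurable_one.indicator (hJm n i)).aemeasurable]
    refine le_trans (ENNReal.tsum_le_tsum fun i => ?_) (hsum n)
    rw [lintegral_indicator_one (hJm n i), measure_toMeasurable]
    rcases (t n i).eq_empty_or_nonempty with h | h
    · simp [h]
    · refine (Real.volume_le_diam _).trans ?_
      simpa [h] using hπ.ediam_image_le (t n i)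
  have hfat : ∫⁻ y, liminf (fun n => N n y) atTop ≠ ⊤ := by
    refine ((lintegral_liminf_le hNm).trans (?_ : _ ≤ μH[1] S + 1)).trans_lt
      (by finiteness) |>.ne
    refine liminf_le_of_le ?_ fun b hb => ?_
    · isBoundedDefault
    · obtain ⟨n, hn⟩ := hb.exists
      exact hn.trans (hint n)
  filter_upwards [ae_lt_top (Measurable.liminf hNm) hfat] with y hy
  by_contra hinf
  obtain ⟨K, hK⟩ := ENNReal.exists_nat_gt hy.ne
  refine absurd hK (not_lt.2 ?_)
  obtain ⟨P, hPS, hPK⟩ := Set.Infinite.exists_subset_card_eq hinf K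
  obtain ⟨C, hC, hCP⟩ := einfsep_pos.1 (Set.Finite.einfsep_pos P.finite_toSet)
  refine le_liminf_of_le isCobounded_ge_of_top ?_
  have hlim : Tendsto (fun n : ℕ => ((n : ℝ≥0∞) + 1)⁻¹) atTop (𝓝 0) := by
    have := (tendsto_add_atTop_iff_nat 1).2 ENNReal.tendsto_inv_nat_nhds_zero
    simpa using this
  filter_upwards [hlim.eventually (gt_mem_nhds hC)] with n hn
  have hex : ∀ p : ℂ, ∃ i, p ∈ P → p ∈ t n i := fun p => by
    by_cases hp : p ∈ P
    · obtain ⟨i, hi⟩ := mem_iUnion.1 (hcov n (hPS hp).1)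
      exact ⟨i, fun _ => hi⟩
    · exact ⟨0, fun h => absurd h hp⟩
  choose i hi using hex
  have hinj : Set.InjOn i P := by
    intro p hp q hq hpq
    by_contra hne
    have h1 := hCP p hp q hq hne
    have h2 : edist p q ≤ ediam (t n (i p)) :=
      edist_le_ediam_of_mem (hi p hp) (hpq ▸ hi q hq)
    exact absurd (h1.trans (h2.trans (hdiam n _))) (not_le.2 hn)
  have hone : ∀ p ∈ P, (J n (i p)).indicator (1 : ℝ → ℝ≥0∞) y = 1 := fun p hp => by
    have : y ∈ J n (i p) := subset_toMeasurable _ _ ⟨p, hi p hp, (hPS hp).2⟩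
    simp [this]
  calc (K : ℝ≥0∞) = ∑ p ∈ P, (J n (i p)).indicator (1 : ℝ → ℝ≥0∞) y := by
        rw [Finset.sum_congr rfl hone]; simp [hPK]
    _ = ∑ j ∈ P.image i, (J n j).indicator (1 : ℝ → ℝ≥0∞) y := by
        rw [Finset.sum_image hinj]
    _ ≤ N n y := ENNReal.sum_le_tsum _

/-- Almost every fibre of a `1`-Lipschitz function on a set of `σ`-finite length is countable. -/
theorem ae_countable_fiber {S : Set ℂ} {A : ℕ → Set ℂ} (hSA : S ⊆ ⋃ n, A n)
    (hA : ∀ n, μH[1] (A n) < ⊤) {π : ℂ → ℝ} (hπ : LipschitzWith 1 π) :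
    ∀ᵐ y : ℝ, (S ∩ π ⁻¹' {y}).Countable := by
  filter_upwards [ae_all_iff.2 fun n => ae_finite_fiber (hA n) hπ] with y hy
  refine (countable_iUnion fun n => (hy n).countable).mono ?_
  rintro z ⟨hz, hzy⟩
  obtain ⟨n, hn⟩ := mem_iUnion.1 (hSA hz)
  exact mem_iUnion.2 ⟨n, hn, hzy⟩

theorem norm_sub_le_of_forall_eventually_le_measure {H : ℝ → ℂ} {a b ε : ℝ} (hab : a ≤ b)
    (μ : Measure ℝ) [IsFiniteMeasure μ]
    (h : ∀ t ∈ Icc a b, ∀ᶠ s in 𝓝 t, ‖H s - H t‖ ≤ μ.real {t} + ε * |s - t|) :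
    ‖H b - H a‖ ≤ 2 * μ.real univ + ε * (b - a) := by
  set c : ℝ → ℝ → ℝ := fun s t => μ.real (Ico s t) + μ.real (Ioc s t) + ε * (t - s) with hc
  have hadd : ∀ r s t, r ≤ s → s ≤ t → c r s + c s t = c r t := fun r s t h1 h2 => by
    simp only [hc]
    rw [← Ico_union_Ico_eq_Ico h1 h2, ← Ioc_union_Ioc_eq_Ioc h1 h2,
      measureReal_union (Ico_disjoint_Ico_same) measurableSet_Ico,
      measureReal_union (Ioc_disjoint_Ioc_of_le le_rfl) measurableSet_Ioc]
    ring
  have hR : ∀ t ∈ Icc a b, ∀ᶠ s in 𝓝 t, t < s → ‖H s - H t‖ ≤ c t s := fun t ht => by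
    filter_upwards [h t ht] with s hs hts
    refine hs.trans ?_
    rw [abs_of_pos (sub_pos.2 hts)]
    have : μ.real {t} ≤ μ.real (Ico t s) := measureReal_mono (by simpa using hts)
    have h2 : 0 ≤ μ.real (Ioc t s) := measureReal_nonneg
    simp only [hc]; linarith
  have hL : ∀ t ∈ Icc a b, ∀ᶠ s in 𝓝 t, s < t → ‖H t - H s‖ ≤ c s t := fun t ht => by
    filter_upwards [h t ht] with s hs hts
    rw [norm_sub_rev]
    refine hs.trans ?_
    rw [abs_of_neg (sub_neg.2 hts)]
    have : μ.real {t} ≤ μ.real (Ioc s t) := measureReal_mono (by simpa using hts)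
    have h2 : 0 ≤ μ.real (Ico s t) := measureReal_nonneg
    simp only [hc]; linarith
  set T : Set ℝ := {t | t ∈ Icc a b ∧ ‖H t - H a‖ ≤ c a t} with hT
  have haT : a ∈ T := ⟨left_mem_Icc.2 hab, by simp [hc]⟩
  have hbdd : BddAbove T := ⟨b, fun t ht => ht.1.2⟩
  have hstep : ∀ s ∈ T, ∀ t ∈ Icc a b, s ≤ t → ‖H t - H s‖ ≤ c s t → t ∈ T :=
    fun s hs t ht hst hle => ⟨ht, by
      rw [← hadd a s t hs.1.1 hst]
      calc ‖H t - H a‖ = ‖(H s - H a) + (H t - H s)‖ := by congr 1; ring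
        _ ≤ _ := (norm_add_le _ _).trans (add_le_add hs.2 hle)⟩
  have hτ : sSup T ∈ Icc a b := ⟨le_csSup hbdd haT, csSup_le ⟨a, haT⟩ fun t ht => ht.1.2⟩
  have hτT : sSup T ∈ T := by
    obtain ⟨δ, hδ, hδs⟩ := Metric.eventually_nhds_iff.1 (hL _ hτ)
    obtain ⟨s, hsT, hs⟩ := exists_lt_of_lt_csSup ⟨a, haT⟩ (sub_lt_self (sSup T) hδ)
    rcases (le_csSup hbdd hsT).eq_or_lt with h1 | h1
    · rwa [← h1]
    · refine hstep s hsT _ hτ h1.le (hδs ?_ h1)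
      rw [Real.dist_eq, abs_of_neg (by linarith)]; linarith
  have hτb : sSup T = b := by
    by_contra hne
    have hlt : sSup T < b := lt_of_le_of_ne hτ.2 hne
    have h1 : ∀ᶠ s in 𝓝[>] (sSup T), s < b := mem_nhdsWithin_of_mem_nhds (gt_mem_nhds hlt)
    obtain ⟨s, ⟨hs1, hs2⟩, hs3⟩ := ((((hR _ hτ).filter_mono nhdsWithin_le_nhds).and h1).and
      (self_mem_nhdsWithin (s := Ioi (sSup T)))).exists
    have := le_csSup hbdd (hstep _ hτT s ⟨hτ.1.trans hs3.le, hs2.le⟩ hs3.le (hs1 hs3))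
    exact absurd hs3 (not_lt.2 this)
  rw [hτb] at hτT
  refine hτT.2.trans ?_
  have h1 : μ.real (Ico a b) ≤ μ.real univ := measureReal_mono (subset_univ _)
  have h2 : μ.real (Ioc a b) ≤ μ.real univ := measureReal_mono (subset_univ _)
  simp only [hc]; linarith

/-- A function whose derivative vanishes off a countable set, and which has controlled
oscillation at the points of that set, has controlled increment. -/
theorem enorm_sub_le_of_hasDerivAt_zero {H : ℝ → ℂ} {a b : ℝ} (hab : a ≤ b) {S : Set ℝ}
    (hS : S.Countable) (w : ℝ → ℝ≥0) (hd : ∀ t ∈ Icc a b, t ∉ S → HasDerivAt H 0 t)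
    (hw : ∀ t ∈ S, ∀ ε > 0, ∀ᶠ s in 𝓝 t, ‖H s - H t‖ ≤ w t + ε) :
    ‖H b - H a‖ₑ ≤ 2 * ∑' t : S, (w t : ℝ≥0∞) := by
  have : Countable S := hS.to_subtype
  by_cases htop : ∑' t : S, (w t : ℝ≥0∞) = ⊤
  · simp [htop]
  refine ENNReal.le_of_forall_pos_le_add fun ε hε _ => ?_
  obtain ⟨e, he, hesum⟩ := ENNReal.exists_pos_sum_of_countable (ε := ((ε / 4 : ℝ≥0) : ℝ≥0∞))
    (by simpa using hε.ne') S
  set μ : Measure ℝ := Measure.sum fun t : S => ((w t + e t : ℝ≥0) : ℝ≥0∞) • Measure.dirac (t : ℝ)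
    with hμ
  have huniv : μ univ = ∑' t : S, (w t : ℝ≥0∞) + ∑' t : S, (e t : ℝ≥0∞) := by
    rw [hμ, Measure.sum_apply _ MeasurableSet.univ, ← ENNReal.tsum_add]
    simp
  have hfin : IsFiniteMeasure μ := ⟨by
    rw [huniv]; exact ENNReal.add_lt_top.2 ⟨lt_top_iff_ne_top.2 htop, hesum.trans (by finiteness)⟩⟩
  have hpt : ∀ t : S, ((w t + e t : ℝ≥0) : ℝ) ≤ μ.real {(t : ℝ)} := fun t => by
    have h1 : ((w t + e t : ℝ≥0) : ℝ≥0∞) ≤ μ {(t : ℝ)} := by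
      rw [hμ, Measure.sum_apply _ (measurableSet_singleton _)]
      refine le_trans ?_ (ENNReal.le_tsum t)
      simp
    have := ENNReal.toReal_mono (measure_ne_top μ _) h1
    rwa [ENNReal.coe_toReal] at this
  set η : ℝ := ε / 2 / (b - a + 1) with hη
  have hη0 : 0 < η := by
    have : 0 < b - a + 1 := by linarith
    have : (0 : ℝ) < ε := hε
    positivity
  have key := norm_sub_le_of_forall_eventually_le_measure (H := H) (ε := η) hab μ (by
    intro t ht
    by_cases htS : t ∈ S
    · filter_upwards [hw t htS (e ⟨t, htS⟩) (by exact_mod_cast he _)] with s hs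
      have := hpt ⟨t, htS⟩
      push_cast at this
      have : 0 ≤ η * |s - t| := by positivity
      linarith
    · have h1 := (hasDerivAt_iff_isLittleO.1 (hd t ht htS)).def hη0
      filter_upwards [h1] with s hs
      have : 0 ≤ μ.real {t} := measureReal_nonneg
      simp only [smul_zero, sub_zero, Real.norm_eq_abs] at hs
      linarith)
  have h2 : η * (b - a) ≤ ε / 2 := by
    rw [hη, div_mul_eq_mul_div, div_le_iff₀ (by linarith)]
    have : (0 : ℝ) < ε := hε
    nlinarith
  have h3 : μ.real univ = (∑' t : S, (w t : ℝ≥0∞)).toReal + (∑' t : S, (e t : ℝ≥0∞)).toReal := by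
    rw [Measure.real, huniv, ENNReal.toReal_add htop (hesum.trans (by finiteness)).ne]
  have h4 : (∑' t : S, (e t : ℝ≥0∞)).toReal ≤ ε / 4 := by
    have := ENNReal.toReal_mono (by finiteness) hesum.le
    simpa using this
  have h5 : ‖H b - H a‖ ≤ 2 * (∑' t : S, (w t : ℝ≥0∞)).toReal + ε := by
    rw [h3] at key; linarith
  rw [← ofReal_norm]
  refine (ENNReal.ofReal_le_ofReal h5).trans ?_
  rw [ENNReal.ofReal_add (by positivity) (NNReal.coe_nonneg ε), ENNReal.ofReal_mul (by norm_num),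
    ENNReal.ofReal_toReal htop]
  simp

/-- Oscillation of a product at a jump point. -/
theorem eventually_norm_mul_sub_le {F : ℝ → ℂ} {ψ : ℝ → ℝ} {I : ℝ → ℂ} {t : ℝ} {ρ : ℝ≥0}
    (hF : ∀ ε > 0, ∀ᶠ s in 𝓝 t, ‖F s - F t‖ ≤ ρ + ε) (hψ : ContinuousAt ψ t)
    (hI : ContinuousAt I t) {ε : ℝ} (hε : 0 < ε) :
    ∀ᶠ s in 𝓝 t, ‖(F s * ψ s - I s) - (F t * ψ t - I t)‖ ≤ ‖ψ t‖₊ * ρ + ε := by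
  obtain ⟨δ, hδε, hδ⟩ : ∃ δ : ℝ, (ρ + δ) * (‖ψ t‖ + δ) + ‖F t‖ * δ + δ < ‖ψ t‖ * ρ + ε ∧ 0 < δ := by
    have hcont : Continuous fun δ : ℝ => (ρ + δ) * (‖ψ t‖ + δ) + ‖F t‖ * δ + δ := by fun_prop
    have h0 : ((ρ : ℝ) + 0) * (‖ψ t‖ + 0) + ‖F t‖ * 0 + 0 < ‖ψ t‖ * ρ + ε := by
      nlinarith [norm_nonneg (ψ t)]
    have := (hcont.tendsto 0).eventually (gt_mem_nhds h0)
    exact ((this.filter_mono nhdsWithin_le_nhds).and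
      (self_mem_nhdsWithin (s := Ioi (0 : ℝ)))).exists
  have h1 := Metric.tendsto_nhds.1 hψ δ hδ
  have h2 := Metric.tendsto_nhds.1 hI δ hδ
  filter_upwards [hF δ hδ, h1, h2] with s hs1 hs2 hs3
  rw [dist_eq_norm] at hs2 hs3
  have hψs : ‖ψ s‖ ≤ ‖ψ t‖ + δ := by
    have := norm_add_le (ψ t) (ψ s - ψ t)
    rw [add_sub_cancel] at this
    linarith
  have e : (F s * ψ s - I s) - (F t * ψ t - I t) =
      (F s - F t) * (ψ s : ℂ) + F t * ((ψ s - ψ t : ℝ) : ℂ) - (I s - I t) := by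
    push_cast; ring
  rw [e]
  refine (norm_sub_le _ _).trans ?_
  have h3 := norm_add_le ((F s - F t) * (ψ s : ℂ)) (F t * ((ψ s - ψ t : ℝ) : ℂ))
  rw [norm_mul, norm_mul, norm_real, norm_real] at h3
  have h4 : ‖F s - F t‖ * ‖ψ s‖ ≤ (ρ + δ) * (‖ψ t‖ + δ) := by gcongr
  have h5 : ‖F t‖ * ‖ψ s - ψ t‖ ≤ ‖F t‖ * δ := by gcongr
  rw [coe_nnnorm]
  linarith

/-- Integration by parts on a line for a function with countably many jumps. -/
theorem enorm_integral_line_le {F D : ℝ → ℂ} {ψ ψ' : ℝ → ℝ} {S : Set ℝ} (hS : S.Countable)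
    {ρ : ℝ → ℝ≥0} {A : ℝ} (hA : 0 ≤ A) (hψ : ∀ t, HasDerivAt ψ (ψ' t) t) (hψ' : Continuous ψ')
    (hA0 : ∀ t, A ≤ |t| → ψ t = 0 ∧ ψ' t = 0)
    (hint : Integrable fun t => D t * ψ t + F t * ψ' t)
    (hDc : ∀ t ∉ S, ContinuousAt D t) (hFD : ∀ t ∉ S, HasDerivAt F (D t) t)
    (hjump : ∀ t ∈ S, ∀ ε > 0, ∀ᶠ s in 𝓝 t, ‖F s - F t‖ ≤ ρ t + ε) :
    ‖∫ t, D t * ψ t + F t * ψ' t‖ₑ ≤ 2 * ∑' t : S, ((‖ψ t‖₊ * ρ t : ℝ≥0) : ℝ≥0∞) := by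
  set G : ℝ → ℂ := fun t => D t * ψ t + F t * ψ' t with hG
  have hψc : Continuous ψ := continuous_iff_continuousAt.2 fun t => (hψ t).continuousAt
  have hIc : Continuous fun t => ∫ u in (-A)..t, G u :=
    intervalIntegral.continuous_primitive (fun a b => hint.intervalIntegrable) _
  have key := enorm_sub_le_of_hasDerivAt_zero (H := fun t => F t * ψ t - ∫ u in (-A)..t, G u)
    (a := -A) (b := A) (by linarith) hS (fun t => ‖ψ t‖₊ * ρ t) (fun t _ ht => by
      have h1 : HasDerivAt (fun t => F t * (ψ t : ℂ)) (D t * ψ t + F t * ψ' t) t :=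
        (hFD t ht).mul (hψ t).ofReal_comp
      have h2 : HasDerivAt (fun t => ∫ u in (-A)..t, G u) (G t) t := by
        refine intervalIntegral.integral_hasDerivAt_right hint.intervalIntegrable
          hint.aestronglyMeasurable.stronglyMeasurableAtFilter ?_
        exact ((hDc t ht).mul (by fun_prop)).add ((hFD t ht).continuousAt.mul (by fun_prop))
      have h3 := h1.sub h2
      rw [show D t * ψ t + F t * ψ' t - G t = 0 from sub_self _] at h3
      exact h3)
    (fun t ht ε hε => by
      simpa only [NNReal.coe_mul] using
        eventually_norm_mul_sub_le (hjump t ht) hψc.continuousAt hIc.continuousAt hε)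
  have hAA := hA0 A (le_abs_self A)
  have hAA' := hA0 (-A) (by rw [abs_neg]; exact le_abs_self A)
  have hsupp : Function.support G ⊆ Ioc (-A) A := fun t ht => by
    by_contra hcon
    apply ht
    have : A ≤ |t| := by
      rw [Set.mem_Ioc, not_and_or, not_lt, not_le] at hcon
      rcases hcon with h | h
      · exact (by linarith : A ≤ -t).trans (neg_le_abs t)
      · exact h.le.trans (le_abs_self t)
    simp [hG, hA0 t this]
  simp only [hAA.1, hAA'.1, intervalIntegral.integral_same] at key
  rw [intervalIntegral.integral_eq_integral_of_support_subset hsupp] at key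
  simpa using key

theorem tsum_subtype_ite_le {X : Type*} [DecidableEq X] (S : Set X) (q : X) (k : ℝ≥0∞) :
    ∑' t : S, (if (t : X) = q then k else 0) ≤ k :=
  (ENNReal.tsum_comp_le_tsum_of_injective Subtype.val_injective
    (fun t : X => if t = q then k else 0)).trans (by rw [tsum_ite_eq])

theorem eq_sqrt_of_mem_sphere {c : ℂ} {R x y : ℝ} (h : (⟨x, y⟩ : ℂ) ∈ sphere c R) :
    (x = c.re + √(R ^ 2 - (y - c.im) ^ 2) ∨ x = c.re - √(R ^ 2 - (y - c.im) ^ 2)) ∧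
      y ∈ Icc (c.im - R) (c.im + R) := by
  rw [mem_sphere, dist_eq_norm] at h
  have h1 : (x - c.re) ^ 2 + (y - c.im) ^ 2 = R ^ 2 := by
    have := Complex.sq_norm (⟨x, y⟩ - c)
    rw [h, normSq_apply] at this
    simp only [sub_re, sub_im] at this
    nlinarith
  have h2 : R ^ 2 - (y - c.im) ^ 2 = (x - c.re) ^ 2 := by linarith
  refine ⟨?_, ?_⟩
  · rw [h2, Real.sqrt_sq_eq_abs]
    rcases abs_choice (x - c.re) with h3 | h3 <;> rw [h3]
    · left; ring
    · right; ring
  · have := abs_im_le_norm (⟨x, y⟩ - c)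
    rw [h, sub_im, abs_le] at this
    constructor <;> [linarith [this.1]; linarith [this.2]]

/-- The jumps of the weights along a horizontal line. -/
theorem tsum_line_le {ι : Type*} {c : ι → ℂ} {R : ι → ℝ} {r M : ι → ℝ≥0} {S : Set ℂ} {ψ : ℂ → ℝ}
    {ρ : ℂ → ℝ≥0} {y : ℝ}
    (hρ : ∀ x : ℝ, (⟨x, y⟩ : ℂ) ∈ S → ρ ⟨x, y⟩ = 0 ∨
      ∃ i, (⟨x, y⟩ : ℂ) ∈ sphere (c i) (R i) ∧ ρ ⟨x, y⟩ = r i)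
    (hM : ∀ i, ∀ z ∈ sphere (c i) (R i), ‖ψ z‖₊ ≤ M i) :
    ∑' t : {x : ℝ | (⟨x, y⟩ : ℂ) ∈ S}, ((‖ψ ⟨t, y⟩‖₊ * ρ ⟨t, y⟩ : ℝ≥0) : ℝ≥0∞) ≤
      ∑' i, 2 * (Icc ((c i).im - R i) ((c i).im + R i)).indicator
        (fun _ => ((M i * r i : ℝ≥0) : ℝ≥0∞)) y := by
  classical
  set q : ι → Bool → ℝ := fun i b =>
    cond b ((c i).re + √(R i ^ 2 - (y - (c i).im) ^ 2)) ((c i).re - √(R i ^ 2 - (y - (c i).im) ^ 2))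
    with hq
  set k : ι → ℝ≥0∞ := fun i => (Icc ((c i).im - R i) ((c i).im + R i)).indicator
        (fun _ => ((M i * r i : ℝ≥0) : ℝ≥0∞)) y with hk
  calc _ ≤ ∑' t : {x : ℝ | (⟨x, y⟩ : ℂ) ∈ S}, ∑' p : ι × Bool,
        (if (t : ℝ) = q p.1 p.2 then k p.1 else 0) := by
        refine ENNReal.tsum_le_tsum fun t => ?_
        rcases hρ t t.2 with h | ⟨i, hi, h⟩
        · simp [h]
        · obtain ⟨h1, h2⟩ := eq_sqrt_of_mem_sphere hi
          have hb : ∃ b, (t : ℝ) = q i b := by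
            rcases h1 with h1 | h1
            · exact ⟨true, h1⟩
            · exact ⟨false, h1⟩
          obtain ⟨b, hb⟩ := hb
          refine le_trans ?_ (ENNReal.le_tsum (i, b))
          simp only [if_pos hb, hk, indicator_of_mem h2, h]
          exact_mod_cast mul_le_mul_left (hM i _ hi) (r i)
    _ = ∑' p : ι × Bool, ∑' t : {x : ℝ | (⟨x, y⟩ : ℂ) ∈ S},
        (if (t : ℝ) = q p.1 p.2 then k p.1 else 0) := ENNReal.tsum_comm
    _ ≤ ∑' p : ι × Bool, k p.1 := ENNReal.tsum_le_tsum fun p => tsum_subtype_ite_le _ _ _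
    _ = ∑' i, 2 * k i := by
        rw [ENNReal.tsum_prod']
        simp [two_mul]

/-- Weak form of the horizontal derivative for a function with jumps along circles. -/
theorem enorm_integral_horizontal_le {ι : Type*} [Countable ι] {c : ι → ℂ} {R r M : ι → ℝ≥0}
    {S N : Set ℂ} {F D : ℂ → ℂ} {ψ : ℂ → ℝ} {ρ : ℂ → ℝ≥0}
    (hS : ∀ᵐ y : ℝ, {x : ℝ | (⟨x, y⟩ : ℂ) ∈ S}.Countable) (hN : N.Countable)
    (hDc : ∀ z ∉ S, ContinuousAt D z)
    (hFD : ∀ z ∉ S, HasDerivAt (fun t : ℝ => F (z + t)) (D z) 0)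
    (hjump : ∀ p ∈ S, ∀ ε > 0, ∀ᶠ z in 𝓝 p, ‖F z - F p‖ ≤ ρ p + ε)
    (hρ : ∀ p ∈ S, p ∉ N → ρ p = 0 ∨ ∃ i, p ∈ sphere (c i) (R i) ∧ ρ p = r i)
    (hψ : ContDiff ℝ 1 ψ) (hψs : HasCompactSupport ψ)
    (hint : Integrable fun z => D z * ψ z + F z * (fderiv ℝ ψ z 1 : ℝ))
    (hM : ∀ i, ∀ z ∈ sphere (c i) (R i : ℝ), ‖ψ z‖₊ ≤ M i) :
    ‖∫ z, D z * ψ z + F z * (fderiv ℝ ψ z 1 : ℝ)‖ₑ ≤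
      ∑' i, ((8 * (M i * r i * R i) : ℝ≥0) : ℝ≥0∞) := by
  set G : ℂ → ℂ := fun z => D z * ψ z + F z * (fderiv ℝ ψ z 1 : ℝ) with hG
  have hmp := Complex.volume_preserving_equiv_real_prod.symm
  obtain ⟨A, hA⟩ := hψs.isCompact.isBounded.subset_closedBall (0 : ℂ)
  set A' := |A| + 1 with hA'
  have hA0 : ∀ z : ℂ, A' ≤ ‖z‖ → ψ z = 0 ∧ fderiv ℝ ψ z 1 = 0 := fun z hz => by
    have hz' : z ∉ tsupport ψ := fun h => by
      have := hA h
      rw [mem_closedBall_zero_iff] at this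
      have := le_abs_self A
      linarith
    refine ⟨image_eq_zero_of_notMem_tsupport hz', ?_⟩
    have : fderiv ℝ ψ z = 0 := by
      by_contra h
      exact hz' (support_fderiv_subset ℝ h)
    simp [this]
  have hint' : Integrable (fun p : ℝ × ℝ => G ⟨p.1, p.2⟩) (volume.prod volume) :=
    (hmp.integrable_comp_emb (MeasurableEquiv.measurableEmbedding _)).2 hint
  have e1 : ∫ z, G z = ∫ y, ∫ x, G ⟨x, y⟩ := by
    rw [← hmp.integral_comp' G]
    exact integral_prod_symm _ hint'
  rw [e1]
  refine (enorm_integral_le_lintegral_enorm _).trans ?_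
  have hNim : ∀ᵐ y : ℝ, y ∉ Complex.im '' N := (hN.image _).ae_notMem volume
  have hline : ∀ y : ℝ, Continuous fun x : ℝ => (⟨x, y⟩ : ℂ) := fun y => by
    have : (fun x : ℝ => (⟨x, y⟩ : ℂ)) = fun x : ℝ => (x : ℂ) + y * Complex.I := by
      ext x; exact Complex.mk_eq_add_mul_I x y
    rw [this]; fun_prop
  have hlineD : ∀ y x : ℝ, HasDerivAt (fun x : ℝ => (⟨x, y⟩ : ℂ)) 1 x := fun y x => by
    have : (fun x : ℝ => (⟨x, y⟩ : ℂ)) = fun x : ℝ => (x : ℂ) + y * Complex.I := by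
      ext x; exact Complex.mk_eq_add_mul_I x y
    rw [this]
    exact ((hasDerivAt_id x).ofReal_comp).add_const _
  calc ∫⁻ y, ‖∫ x, G ⟨x, y⟩‖ₑ
      ≤ ∫⁻ y, 2 * ∑' i, 2 * (Icc ((c i).im - R i) ((c i).im + R i)).indicator
        (fun _ => ((M i * r i : ℝ≥0) : ℝ≥0∞)) y := by
        refine lintegral_mono_ae ?_
        filter_upwards [hS, hNim, hint'.prod_left_ae] with y hy hyN hyint
        refine (enorm_integral_line_le (F := fun x => F ⟨x, y⟩) (D := fun x => D ⟨x, y⟩)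
          (ψ := fun x => ψ ⟨x, y⟩) (ψ' := fun x => fderiv ℝ ψ ⟨x, y⟩ 1) (A := A') hy
          (ρ := fun x => ρ ⟨x, y⟩) (by positivity) (fun t => ?_) ?_ (fun t ht => ?_) hyint
          (fun t ht => ?_) (fun t ht => ?_) (fun t ht ε hε => ?_)).trans ?_
        · exact ((hψ.differentiable one_ne_zero) _).hasFDerivAt.comp_hasDerivAt t (hlineD y t)
        · exact ((hψ.continuous_fderiv one_ne_zero).clm_apply continuous_const).comp (hline y)
        · exact hA0 _ (ht.trans (by simpa using abs_re_le_norm (⟨t, y⟩ : ℂ)))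
        · exact ContinuousAt.comp (g := D) (hDc _ ht) (hline y).continuousAt
        · have h1 := hFD _ ht
          have h2 : HasDerivAt (fun x => (fun s : ℝ => F (⟨t, y⟩ + s)) (x - t)) (D ⟨t, y⟩) t :=
            HasDerivAt.comp_sub_const t t (by simpa using h1)
          refine h2.congr_of_eventuallyEq (Eventually.of_forall fun x => ?_)
          simp only
          congr 1
          apply Complex.ext <;> simp
        · exact (hline y).continuousAt.eventually (hjump _ ht ε hε)
        · refine mul_le_mul_right
            (tsum_line_le (fun x hx => hρ _ hx fun hxN => hyN ⟨_, hxN, rfl⟩) hM) _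
    _ = ∑' i, ((8 * (M i * r i * R i) : ℝ≥0) : ℝ≥0∞) := by
        rw [lintegral_const_mul' _ _ (by finiteness), lintegral_tsum fun i =>
          ((measurable_const.indicator measurableSet_Icc).const_mul _).aemeasurable,
          ← ENNReal.tsum_mul_left]
        refine tsum_congr fun i => ?_
        rw [lintegral_const_mul' _ _ (by finiteness), lintegral_indicator measurableSet_Icc,
          setLIntegral_const, Real.volume_Icc]
        have : ENNReal.ofReal ((c i).im + R i - ((c i).im - R i)) = ((2 * R i : ℝ≥0) : ℝ≥0∞) := by
          rw [show (c i).im + R i - ((c i).im - R i) = ((2 * R i : ℝ≥0) : ℝ) by push_cast; ring,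
            ENNReal.ofReal_coe_nnreal]
        rw [this]
        push_cast
        ring

/-- The Wirtinger derivative `∂ψ` of a real function. -/
def wirtinger (ψ : ℂ → ℝ) (z : ℂ) : ℂ :=
  ((fderiv ℝ ψ z 1 : ℝ) - Complex.I * (fderiv ℝ ψ z Complex.I : ℝ)) / 2

/-- Multiplication by `I` as a linear isometry equivalence. -/
def mulI : ℂ ≃ₗᵢ[ℝ] ℂ := rotation ⟨Complex.I, by simp [Submonoid.unitSphere]⟩

theorem mulI_apply (z : ℂ) : mulI z = Complex.I * z := rotation_apply _ _

theorem measurePreserving_mulI : MeasurePreserving mulI := mulI.measurePreserving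

theorem continuous_wirtinger {ψ : ℂ → ℝ} (hψ : ContDiff ℝ 1 ψ) : Continuous (wirtinger ψ) := by
  have h := hψ.continuous_fderiv one_ne_zero
  unfold wirtinger
  fun_prop

theorem wirtinger_eq_zero_of_notMem_tsupport {ψ : ℂ → ℝ} {z : ℂ} (hz : z ∉ tsupport ψ) :
    wirtinger ψ z = 0 := by
  have : fderiv ℝ ψ z = 0 := by
    by_contra h
    exact hz (support_fderiv_subset ℝ h)
  simp [wirtinger, this]

theorem hasCompactSupport_wirtinger {ψ : ℂ → ℝ} (hψs : HasCompactSupport ψ) :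
    HasCompactSupport (wirtinger ψ) :=
  HasCompactSupport.intro hψs.isCompact fun _ hz => wirtinger_eq_zero_of_notMem_tsupport hz

/-- Weak form of `∂F = F'` for a function which is holomorphic off `S` and has jumps of size
`r i` along the circles of radius `R i`. -/
theorem enorm_integral_wirtinger_le {ι : Type*} [Countable ι] {c : ι → ℂ} {R r M : ι → ℝ≥0}
    {S N : Set ℂ} {F D : ℂ → ℂ} {ψ : ℂ → ℝ} {ρ : ℂ → ℝ≥0}
    (hSx : ∀ᵐ y : ℝ, {x : ℝ | (⟨x, y⟩ : ℂ) ∈ S}.Countable)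
    (hSy : ∀ᵐ x : ℝ, {y : ℝ | (⟨x, y⟩ : ℂ) ∈ S}.Countable) (hN : N.Countable)
    (hDc : ∀ z ∉ S, ContinuousAt D z) (hFD : ∀ z ∉ S, HasDerivAt F (D z) z)
    (hjump : ∀ p ∈ S, ∀ ε > 0, ∀ᶠ z in 𝓝 p, ‖F z - F p‖ ≤ ρ p + ε)
    (hρ : ∀ p ∈ S, p ∉ N → ρ p = 0 ∨ ∃ i, p ∈ sphere (c i) (R i) ∧ ρ p = r i)
    (hψ : ContDiff ℝ 1 ψ) (hψs : HasCompactSupport ψ)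
    (hD : LocallyIntegrable D) (hF : LocallyIntegrable F)
    (hM : ∀ i, ∀ z ∈ sphere (c i) (R i : ℝ), ‖ψ z‖₊ ≤ M i) :
    ‖∫ z, D z * ψ z + F z * wirtinger ψ z‖ₑ ≤ ∑' i, ((8 * (M i * r i * R i) : ℝ≥0) : ℝ≥0∞) := by
  have hc1 : ∀ v : ℂ, Continuous fun z => ((fderiv ℝ ψ z v : ℝ) : ℂ) := fun v => by
    have h := hψ.continuous_fderiv one_ne_zero
    fun_prop
  have hs1 : ∀ v : ℂ, HasCompactSupport fun z => ((fderiv ℝ ψ z v : ℝ) : ℂ) := fun v =>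
    HasCompactSupport.intro hψs.isCompact fun z hz => by
      have : fderiv ℝ ψ z = 0 := by
        by_contra h
        exact hz (support_fderiv_subset ℝ h)
      simp [this]
  have hiD : Integrable fun z => D z * (ψ z : ℂ) := by
    have := hD.integrable_smul_left_of_hasCompactSupport (g := fun z => (ψ z : ℂ))
      (Complex.continuous_ofReal.comp hψ.continuous) (hψs.comp_left (g := ((↑) : ℝ → ℂ)) rfl)
    simpa only [smul_eq_mul, mul_comm] using this
  have hiF : ∀ v : ℂ, Integrable fun z => F z * ((fderiv ℝ ψ z v : ℝ) : ℂ) := fun v => by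
    have := hF.integrable_smul_left_of_hasCompactSupport (hc1 v) (hs1 v)
    simpa only [smul_eq_mul, mul_comm] using this
  have hX := enorm_integral_horizontal_le hSx hN hDc (fun z hz => by
    have h1 : HasDerivAt (fun t : ℂ => F (z + t)) (D z) ((0 : ℝ) : ℂ) := by
      apply HasDerivAt.comp_const_add
      simpa using hFD z hz
    exact h1.comp_ofReal) hjump hρ hψ hψs (hiD.add (hiF 1)) hM
  have hiY : Integrable fun z => Complex.I * D z * (ψ z : ℂ) +
      F z * ((fderiv ℝ ψ z Complex.I : ℝ) : ℂ) := by
    refine Integrable.add ?_ (hiF _)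
    simpa only [mul_assoc] using hiD.const_mul Complex.I
  have hfd : ∀ z, fderiv ℝ (fun z => ψ (mulI z)) z 1 = fderiv ℝ ψ (mulI z) Complex.I := fun z => by
    have h1 : HasFDerivAt (fun z => ψ (mulI z))
        ((fderiv ℝ ψ (mulI z)).comp (mulI.toContinuousLinearEquiv : ℂ →L[ℝ] ℂ)) z :=
      ((hψ.differentiable one_ne_zero) _).hasFDerivAt.comp z
        mulI.toContinuousLinearEquiv.hasFDerivAt
    rw [h1.fderiv]
    have : mulI 1 = Complex.I := by rw [mulI_apply, mul_one]
    simp [this]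
  have hY := enorm_integral_horizontal_le (S := mulI ⁻¹' S) (N := mulI ⁻¹' N)
    (F := fun z => F (mulI z)) (D := fun z => Complex.I * D (mulI z)) (ψ := fun z => ψ (mulI z))
    (ρ := fun z => ρ (mulI z)) (c := fun i => mulI.symm (c i)) (R := R) (r := r) (M := M)
    (by
      have h1 := (Measure.measurePreserving_neg (volume : Measure ℝ)).quasiMeasurePreserving.ae hSy
      filter_upwards [h1] with y hy
      convert hy using 3 with x
      rw [mem_preimage, mulI_apply]
      congr! 1
      apply Complex.ext <;> simp)
    (hN.preimage mulI.injective)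
    (fun z hz => continuousAt_const.mul
      (ContinuousAt.comp (g := D) (hDc _ hz) mulI.continuous.continuousAt))
    (fun z hz => by
      have h1 : HasDerivAt (fun t : ℂ => F (Complex.I * (z + t)))
          (D (mulI z) * Complex.I) ((0 : ℝ) : ℂ) := by
        have h2 : HasDerivAt (fun t : ℂ => Complex.I * (z + t)) Complex.I ((0 : ℝ) : ℂ) := by
          simpa using ((hasDerivAt_id ((0 : ℝ) : ℂ)).const_add z).const_mul Complex.I
        refine HasDerivAt.comp (h₂ := F) _ ?_ h2
        have := hFD _ hz
        simpa [mulI_apply] using this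
      have h3 := h1.comp_ofReal
      rw [mul_comm] at h3
      simpa only [mulI_apply] using h3)
    (fun p hp ε hε => mulI.continuous.continuousAt.eventually (hjump _ hp ε hε))
    (fun p hp hpN => by
      rcases hρ _ hp hpN with h | ⟨i, hi, h⟩
      · exact Or.inl h
      · refine Or.inr ⟨i, ?_, h⟩
        rw [mem_sphere] at hi ⊢
        rw [← hi, ← mulI.dist_map, LinearIsometryEquiv.apply_symm_apply])
    (hψ.comp mulI.contDiff)
    (hψs.comp_homeomorph mulI.toHomeomorph)
    (by
      simp only [hfd]
      exact (measurePreserving_mulI.integrable_comp_emb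
        mulI.toHomeomorph.measurableEmbedding).2 hiY)
    (fun i z hz => hM i _ (by
      rw [mem_sphere] at hz ⊢
      rw [← hz, ← mulI.dist_map z, LinearIsometryEquiv.apply_symm_apply]))
  simp only [hfd] at hY
  rw [measurePreserving_mulI.integral_comp mulI.toHomeomorph.measurableEmbedding
    (fun z => Complex.I * D z * (ψ z : ℂ) + F z * ((fderiv ℝ ψ z Complex.I : ℝ) : ℂ))] at hY
  set X := ∑' i, ((8 * (M i * r i * R i) : ℝ≥0) : ℝ≥0∞)
  have e : ∫ z, D z * ψ z + F z * wirtinger ψ z =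
      (1 / 2 : ℂ) * (∫ z, D z * (ψ z : ℂ) + F z * ((fderiv ℝ ψ z 1 : ℝ) : ℂ)) -
      (Complex.I / 2) * ∫ z, Complex.I * D z * (ψ z : ℂ) +
        F z * ((fderiv ℝ ψ z Complex.I : ℝ) : ℂ) := by
    have hiX : Integrable fun z => D z * (ψ z : ℂ) + F z * ((fderiv ℝ ψ z 1 : ℝ) : ℂ) :=
      hiD.add (hiF 1)
    rw [← integral_const_mul, ← integral_const_mul, ← integral_sub
      (hiX.const_mul _) (hiY.const_mul _)]
    congr 1
    ext z
    rw [wirtinger]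
    linear_combination (1 / 2 : ℂ) * D z * (ψ z : ℂ) * Complex.I_sq
  rw [e]
  refine (enorm_sub_le).trans ?_
  rw [enorm_mul, enorm_mul]
  have hI : ‖(1 / 2 : ℂ)‖ₑ = 2⁻¹ ∧ ‖Complex.I / 2‖ₑ = 2⁻¹ := by
    constructor <;>
    · rw [← ofReal_norm]
      simp
  rw [hI.1, hI.2]
  calc _ ≤ (2⁻¹ : ℝ≥0∞) * X + 2⁻¹ * X := by gcongr
    _ = X := by rw [← add_mul, ENNReal.inv_two_add_inv_two, one_mul]

/-- A radial cutoff function, equal to `1` on the disk of radius `ρ` about `c` and supported in the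
disk of radius `√(ρ² + δ)`. -/
def bump (c : ℂ) (ρ δ : ℝ) (z : ℂ) : ℝ := Real.smoothTransition ((ρ ^ 2 + δ - ‖z - c‖ ^ 2) / δ)

/-- The radial slope of `bump`. -/
def bumpSlope (c : ℂ) (ρ δ : ℝ) (z : ℂ) : ℝ :=
  deriv Real.smoothTransition ((ρ ^ 2 + δ - ‖z - c‖ ^ 2) / δ) / δ

theorem deriv_smoothTransition_eq_zero {x : ℝ} (hx : x ∉ Icc (0 : ℝ) 1) :
    deriv Real.smoothTransition x = 0 := by
  rw [Set.mem_Icc, not_and_or, not_le, not_le] at hx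
  rcases hx with h | h
  · have : Real.smoothTransition =ᶠ[𝓝 x] fun _ => 0 := by
      filter_upwards [gt_mem_nhds h] with y hy
      exact Real.smoothTransition.zero_of_nonpos hy.le
    rw [this.deriv_eq]; simp
  · have : Real.smoothTransition =ᶠ[𝓝 x] fun _ => 1 := by
      filter_upwards [lt_mem_nhds h] with y hy
      exact Real.smoothTransition.one_of_one_le hy.le
    rw [this.deriv_eq]; simp

section bump

variable {c : ℂ} {ρ δ : ℝ}

theorem bump_nonneg (z : ℂ) : 0 ≤ bump c ρ δ z := Real.smoothTransition.nonneg _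

theorem bump_le_one (z : ℂ) : bump c ρ δ z ≤ 1 := Real.smoothTransition.le_one _

theorem bump_eq_one (hδ : 0 < δ) {z : ℂ} (hz : ‖z - c‖ ≤ ρ) : bump c ρ δ z = 1 := by
  refine Real.smoothTransition.one_of_one_le ?_
  rw [le_div_iff₀ hδ]
  have : ‖z - c‖ ^ 2 ≤ ρ ^ 2 := by gcongr
  linarith

theorem bump_eq_zero (hδ : 0 < δ) {z : ℂ} (hz : ρ ^ 2 + δ ≤ ‖z - c‖ ^ 2) : bump c ρ δ z = 0 :=
  Real.smoothTransition.zero_of_nonpos (div_nonpos_of_nonpos_of_nonneg (by linarith) hδ.le)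

theorem norm_sq_lt_of_bump_ne_zero (hδ : 0 < δ) {z : ℂ} (hz : bump c ρ δ z ≠ 0) :
    ‖z - c‖ ^ 2 < ρ ^ 2 + δ := by
  by_contra h
  exact hz (bump_eq_zero hδ (not_lt.1 h))

theorem contDiff_bump : ContDiff ℝ 1 (bump c ρ δ) := by
  have h1 : ContDiff ℝ 1 Real.smoothTransition := Real.smoothTransition.contDiff (n := 1)
  refine h1.comp ?_
  exact (contDiff_const.sub ((contDiff_id.sub contDiff_const).norm_sq ℝ)).div_const _

theorem tsupport_bump_subset (hδ : 0 < δ) :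
    tsupport (bump c ρ δ) ⊆ closedBall c √(ρ ^ 2 + δ) := by
  refine closure_minimal (fun z hz => ?_) isClosed_closedBall
  rw [mem_closedBall, dist_eq_norm]
  exact Real.le_sqrt_of_sq_le (norm_sq_lt_of_bump_ne_zero hδ hz).le

theorem hasCompactSupport_bump (hδ : 0 < δ) : HasCompactSupport (bump c ρ δ) :=
  HasCompactSupport.of_support_subset_isCompact (isCompact_closedBall c _)
    (subset_closure.trans (tsupport_bump_subset hδ))

theorem bumpSlope_nonneg (hδ : 0 < δ) (z : ℂ) : 0 ≤ bumpSlope c ρ δ z :=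
  div_nonneg Real.smoothTransition.monotone.deriv_nonneg hδ.le

theorem norm_mem_of_bumpSlope_ne_zero (hρ : 0 ≤ ρ) (hδ : 0 < δ) {z : ℂ}
    (hz : bumpSlope c ρ δ z ≠ 0) : ρ ≤ ‖z - c‖ ∧ ‖z - c‖ ^ 2 ≤ ρ ^ 2 + δ := by
  have h1 : (ρ ^ 2 + δ - ‖z - c‖ ^ 2) / δ ∈ Icc (0 : ℝ) 1 := by
    by_contra h
    exact hz (by rw [bumpSlope, deriv_smoothTransition_eq_zero h, zero_div])
  rw [Set.mem_Icc, le_div_iff₀ hδ, div_le_iff₀ hδ] at h1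
  exact ⟨by
    have : ρ ^ 2 ≤ ‖z - c‖ ^ 2 := by linarith
    exact (sq_le_sq₀ hρ (norm_nonneg _)).1 this, by linarith⟩

theorem continuous_bumpSlope : Continuous (bumpSlope c ρ δ) := by
  have h1 : ContDiff ℝ 1 Real.smoothTransition := Real.smoothTransition.contDiff (n := 1)
  have h2 := h1.continuous_deriv le_rfl
  unfold bumpSlope
  fun_prop

theorem hasCompactSupport_bumpSlope (hρ : 0 ≤ ρ) (hδ : 0 < δ) :
    HasCompactSupport (bumpSlope c ρ δ) :=
  HasCompactSupport.of_support_subset_isCompact (isCompact_closedBall c √(ρ ^ 2 + δ)) fun z hz => by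
    rw [mem_closedBall, dist_eq_norm]
    exact Real.le_sqrt_of_sq_le (norm_mem_of_bumpSlope_ne_zero hρ hδ hz).2

theorem wirtinger_bump (z : ℂ) :
    wirtinger (bump c ρ δ) z = -(bumpSlope c ρ δ z * (starRingEnd ℂ) (z - c)) := by
  have h1 : ContDiff ℝ 1 Real.smoothTransition := Real.smoothTransition.contDiff (n := 1)
  have h2 : HasFDerivAt (fun z => (ρ ^ 2 + δ - ‖z - c‖ ^ 2) / δ)
      ((δ⁻¹ : ℝ) • -((2 : ℕ) • (innerSL ℝ) (z - c))) z := by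
    have h3 : HasFDerivAt (fun z => ‖z - c‖ ^ 2) ((2 : ℕ) • (innerSL ℝ) (z - c)) z :=
      HasFDerivAt.comp (g := fun z : ℂ => ‖z‖ ^ 2) (f := fun z => z - c) z
        (hasStrictFDerivAt_norm_sq (z - c)).hasFDerivAt ((hasFDerivAt_id z).sub_const c)
    have h4 := (h3.const_sub (ρ ^ 2 + δ)).const_mul δ⁻¹
    refine h4.congr_of_eventuallyEq (Eventually.of_forall fun w => ?_)
    simp only [div_eq_inv_mul]
  have h5 : HasFDerivAt (bump c ρ δ) (deriv Real.smoothTransition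
      ((ρ ^ 2 + δ - ‖z - c‖ ^ 2) / δ) • ((δ⁻¹ : ℝ) • -((2 : ℕ) • (innerSL ℝ) (z - c)))) z :=
    ((h1.differentiable one_ne_zero) _).hasDerivAt.comp_hasFDerivAt z h2
  rw [wirtinger, h5.fderiv, bumpSlope]
  apply Complex.ext <;> simp [Complex.inner] <;> ring

theorem norm_wirtinger_bump (hδ : 0 < δ) (z : ℂ) :
    ‖wirtinger (bump c ρ δ) z‖ = bumpSlope c ρ δ z * ‖z - c‖ := by
  rw [wirtinger_bump, norm_neg, norm_mul, norm_real, RCLike.norm_conj, Real.norm_eq_abs,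
    abs_of_nonneg (bumpSlope_nonneg hδ z)]

theorem integrable_bump (hδ : 0 < δ) : Integrable (bump c ρ δ) :=
  contDiff_bump.continuous.integrable_of_hasCompactSupport (hasCompactSupport_bump hδ)

theorem integrable_wirtinger_bump (hδ : 0 < δ) : Integrable (wirtinger (bump c ρ δ)) :=
  (continuous_wirtinger contDiff_bump).integrable_of_hasCompactSupport
    (hasCompactSupport_wirtinger (hasCompactSupport_bump hδ))

end bump

/-- Integration by parts for entire functions. -/
theorem integral_wirtinger_of_differentiable {F : ℂ → ℂ} (hF : Differentiable ℂ F) {ψ : ℂ → ℝ}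
    (hψ : ContDiff ℝ 1 ψ) (hψs : HasCompactSupport ψ) :
    ∫ z, deriv F z * ψ z + F z * wirtinger ψ z = 0 := by
  have hDc : Continuous (deriv F) := hF.contDiff.continuous_deriv (n := 1) le_rfl
  have := enorm_integral_wirtinger_le (ι := PEmpty.{1}) (c := fun _ => 0) (R := fun _ => 0)
    (r := fun _ => 0) (M := fun _ => 0) (S := ∅) (N := ∅) (F := F) (D := deriv F) (ψ := ψ)
    (ρ := fun _ => 0) (by simp) (by simp) (by simp) (fun z _ => hDc.continuousAt)
    (fun z _ => (hF z).hasDerivAt) (by simp) (by simp) hψ hψs hDc.locallyIntegrable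
    hF.continuous.locallyIntegrable (by simp)
  simpa using this

theorem integral_wirtinger_eq_zero {ψ : ℂ → ℝ} (hψ : ContDiff ℝ 1 ψ) (hψs : HasCompactSupport ψ) :
    ∫ z, wirtinger ψ z = 0 := by
  simpa using integral_wirtinger_of_differentiable (differentiable_const (1 : ℂ)) hψ hψs

section bump

variable {c : ℂ} {ρ δ : ℝ}

theorem integral_sub_mul_wirtinger_bump (hδ : 0 < δ) :
    ∫ z, (z - c) * wirtinger (bump c ρ δ) z = -((∫ z, bump c ρ δ z : ℝ) : ℂ) := by
  have h := integral_wirtinger_of_differentiable (F := fun z => z - c) (by fun_prop)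
    (contDiff_bump (c := c) (ρ := ρ) (δ := δ)) (hasCompactSupport_bump hδ)
  have hd : ∀ z, deriv (fun z => z - c) z = 1 := fun z => by simp
  simp only [hd, one_mul] at h
  rw [integral_add (integrable_bump hδ).ofReal] at h
  · rw [integral_complex_ofReal] at h
    linear_combination h
  · have hc : Continuous fun z => (z - c) * wirtinger (bump c ρ δ) z := by
      have := continuous_wirtinger (contDiff_bump (c := c) (ρ := ρ) (δ := δ))
      fun_prop
    exact hc.integrable_of_hasCompactSupport
      ((hasCompactSupport_wirtinger (hasCompactSupport_bump hδ)).mul_left)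

theorem integral_bumpSlope_mul_sq (hδ : 0 < δ) :
    ∫ z, bumpSlope c ρ δ z * ‖z - c‖ ^ 2 = ∫ z, bump c ρ δ z := by
  have h := integral_sub_mul_wirtinger_bump (c := c) (ρ := ρ) hδ
  have e : ∀ z, (z - c) * wirtinger (bump c ρ δ) z =
      -((bumpSlope c ρ δ z * ‖z - c‖ ^ 2 : ℝ) : ℂ) := fun z => by
    rw [wirtinger_bump]
    push_cast
    rw [← Complex.mul_conj']
    ring
  simp only [e] at h
  rw [integral_neg, neg_inj, integral_complex_ofReal] at h
  exact_mod_cast h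

theorem volume_real_closedBall_complex {r : ℝ} (hr : 0 ≤ r) :
    volume.real (closedBall c r) = Real.pi * r ^ 2 := by
  rw [Measure.real, Complex.volume_closedBall, ENNReal.toReal_mul, ENNReal.toReal_pow,
    ENNReal.toReal_ofReal hr]
  simp [mul_comm]

theorem integral_bump_le (hδ : 0 < δ) : ∫ z, bump c ρ δ z ≤ Real.pi * (ρ ^ 2 + δ) := by
  have hpos : 0 ≤ ρ ^ 2 + δ := by positivity
  have h1 : ∫ z, bump c ρ δ z ≤ ∫ z, (closedBall c √(ρ ^ 2 + δ)).indicator 1 z := by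
    refine integral_mono (integrable_bump hδ) ?_ fun z => ?_
    · exact (integrable_indicator_iff measurableSet_closedBall).2
        (integrableOn_const (by exact measure_closedBall_lt_top.ne))
    · by_cases hz : bump c ρ δ z = 0
      · rw [hz]; exact indicator_nonneg (fun _ _ => zero_le_one) _
      · rw [indicator_of_mem (tsupport_bump_subset hδ (subset_closure hz))]
        exact bump_le_one z
  rw [integral_indicator_one measurableSet_closedBall,
    volume_real_closedBall_complex (Real.sqrt_nonneg _), Real.sq_sqrt hpos] at h1
  exact h1

theorem integral_norm_wirtinger_bump_le (hρ : 0 < ρ) (hδ : 0 < δ) :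
    ∫ z, ‖wirtinger (bump c ρ δ) z‖ ≤ Real.pi * (ρ ^ 2 + δ) / ρ := by
  have h1 : ∫ z, ‖wirtinger (bump c ρ δ) z‖ ≤ ∫ z, bumpSlope c ρ δ z * ‖z - c‖ ^ 2 / ρ := by
    refine integral_mono (integrable_wirtinger_bump hδ).norm ?_ fun z => ?_
    · have hc : Continuous fun z => bumpSlope c ρ δ z * ‖z - c‖ ^ 2 / ρ := by
        have := continuous_bumpSlope (c := c) (ρ := ρ) (δ := δ)
        fun_prop
      refine hc.integrable_of_hasCompactSupport ?_
      simp only [mul_div_assoc]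
      exact (hasCompactSupport_bumpSlope hρ.le hδ).mul_right
    · simp only [norm_wirtinger_bump hδ]
      by_cases hz : bumpSlope c ρ δ z = 0
      · simp [hz]
      · have := (norm_mem_of_bumpSlope_ne_zero hρ.le hδ hz).1
        rw [le_div_iff₀ hρ, mul_assoc, sq]
        have h0 := bumpSlope_nonneg (c := c) (ρ := ρ) hδ z
        gcongr
  rw [integral_div, integral_bumpSlope_mul_sq hδ] at h1
  refine h1.trans ?_
  gcongr
  exact integral_bump_le hδ

end bump

/-- The real-linear map `z ↦ p z + q z̄`. -/
def twist (p q : ℂ) : ℂ →L[ℝ] ℂ :=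
  p • ContinuousLinearMap.id ℝ ℂ + q • (Complex.conjCLE : ℂ →L[ℝ] ℂ)

theorem twist_apply (p q z : ℂ) : twist p q z = p * z + q * (starRingEnd ℂ) z := by
  simp [twist]

theorem det_twist (p q : ℂ) : (twist p q).det = normSq p - normSq q := by
  rw [twist, ContinuousLinearMap.det, ← LinearMap.det_toMatrix Complex.basisOneI,
    Matrix.det_fin_two]
  simp [LinearMap.toMatrix_apply, Complex.normSq_apply]
  ring

/-- The area formula for injective holomorphic functions. -/
theorem lintegral_norm_deriv_sq {g g' : ℂ → ℂ} {s : Set ℂ} (hs : MeasurableSet s)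
    (hg : ∀ z ∈ s, HasDerivAt g (g' z) z) (hinj : InjOn g s) :
    ∫⁻ z in s, ENNReal.ofReal (‖g' z‖ ^ 2) = volume (g '' s) := by
  rw [← lintegral_abs_det_fderiv_eq_addHaar_image volume hs (f' := fun z => twist (g' z) 0)
    (fun z hz => ?_) hinj]
  · refine lintegral_congr fun z => ?_
    rw [det_twist, normSq_zero, sub_zero, abs_of_nonneg (normSq_nonneg _), ← Complex.sq_norm]
  · have := (hg z hz).complexToReal_fderiv.hasFDerivWithinAt (s := s)
    have e : twist (g' z) 0 = g' z • (1 : ℂ →L[ℝ] ℂ) := by ext; simp [twist]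
    rw [e]
    exact this

/-- A univalent function on the complement of a compact set with hydrodynamic normalization. -/
structure NormalizedMap (E : Set ℂ) (g : ℂ → ℂ) (a : ℂ) (R₀ C : ℝ) : Prop where
  diff : DifferentiableOn ℂ g Eᶜ
  inj : InjOn g Eᶜ
  isClosed : IsClosed E
  preconn : IsPreconnected Eᶜ
  one_le : 1 ≤ R₀
  nonneg : 0 ≤ C
  sub : E ⊆ ball 0 R₀
  asymp : ∀ z, R₀ ≤ ‖z‖ → ‖g z - z - a / z‖ ≤ C / ‖z‖ ^ 2

namespace NormalizedMap

variable {E : Set ℂ} {g : ℂ → ℂ} {a : ℂ} {R₀ C : ℝ}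

theorem mem_compl (h : NormalizedMap E g a R₀ C) {z : ℂ} (hz : R₀ ≤ ‖z‖) : z ∈ Eᶜ := fun hzE => by
  have := h.sub hzE
  rw [mem_ball_zero_iff] at this
  linarith

theorem isCompact (h : NormalizedMap E g a R₀ C) : IsCompact E :=
  isCompact_of_isClosed_isBounded h.isClosed (isBounded_ball.subset h.sub)

theorem hasDerivAt (h : NormalizedMap E g a R₀ C) {z : ℂ} (hz : z ∈ Eᶜ) :
    HasDerivAt g (deriv g z) z :=
  (h.diff.differentiableAt (h.isClosed.isOpen_compl.mem_nhds hz)).hasDerivAt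

theorem isOpen_image (h : NormalizedMap E g a R₀ C) {s : Set ℂ} (hsE : s ⊆ Eᶜ) (hs : IsOpen s) :
    IsOpen (g '' s) := by
  rcases (h.diff.analyticOnNhd h.isClosed.isOpen_compl).is_constant_or_isOpen h.preconn with
    ⟨w, hw⟩ | ho
  · exfalso
    have h0 : (0 : ℝ) ≤ R₀ := zero_le_one.trans h.one_le
    have h1 : ((R₀ : ℝ) : ℂ) ∈ Eᶜ := h.mem_compl (by rw [norm_real, Real.norm_of_nonneg h0])
    have h2 : ((R₀ + 1 : ℝ) : ℂ) ∈ Eᶜ := h.mem_compl (by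
      rw [norm_real, Real.norm_of_nonneg (by linarith)]; linarith)
    have := h.inj h1 h2 ((hw _ h1).trans (hw _ h2).symm)
    have := Complex.ofReal_injective this
    linarith
  · exact ho s hsE hs

theorem norm_sub_le (h : NormalizedMap E g a R₀ C) {z : ℂ} (hz : R₀ ≤ ‖z‖) :
    ‖g z - z‖ ≤ ‖a‖ + C := by
  have h1 : 1 ≤ ‖z‖ := h.one_le.trans hz
  have h2 : ‖a / z‖ ≤ ‖a‖ := by
    rw [norm_div]; exact div_le_self (norm_nonneg _) h1
  have h3 : C / ‖z‖ ^ 2 ≤ C := div_le_self h.nonneg (one_le_pow₀ h1)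
  calc ‖g z - z‖ = ‖(g z - z - a / z) + a / z‖ := by congr 1; ring
    _ ≤ _ := (norm_add_le _ _).trans (by linarith [h.asymp z hz])

/-- The outer approximation of the image of a large disk. -/
theorem norm_twist_sub_le (h : NormalizedMap E g a R₀ C) {z : ℂ} (hz : R₀ ≤ ‖z‖) :
    ‖g z - twist 1 (a / (‖z‖ ^ 2 : ℝ)) z‖ ≤ C / ‖z‖ ^ 2 := by
  refine le_trans (le_of_eq ?_) (h.asymp z hz)
  have h1 : z ≠ 0 := norm_pos_iff.1 (by linarith [h.one_le])
  congr 1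
  rw [twist_apply]
  have : a / z = a / (‖z‖ ^ 2 : ℝ) * (starRingEnd ℂ) z := by
    have h2 : (starRingEnd ℂ) z ≠ 0 := by simpa using h1
    push_cast
    rw [← Complex.mul_conj']
    field_simp
  rw [this]
  ring

theorem norm_twist_ge {b z : ℂ} (hb : ‖b‖ ≤ 1 / 2) : ‖z‖ / 2 ≤ ‖twist 1 b z‖ := by
  rw [twist_apply, one_mul]
  have h1 := norm_sub_le_norm_add z (b * (starRingEnd ℂ) z)
  rw [norm_mul, RCLike.norm_conj] at h1
  nlinarith [norm_nonneg z]

theorem norm_twist_le {b z : ℂ} (hb : ‖b‖ ≤ 1 / 2) : ‖twist 1 b z‖ ≤ 3 / 2 * ‖z‖ := by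
  rw [twist_apply, one_mul]
  have h1 := norm_add_le z (b * (starRingEnd ℂ) z)
  rw [norm_mul, RCLike.norm_conj] at h1
  nlinarith [norm_nonneg z]

theorem exists_twist_eq {b : ℂ} (hb : ‖b‖ ≤ 1 / 2) (w : ℂ) : ∃ z, twist 1 b z = w := by
  have h1 : Function.Injective (twist 1 b : ℂ →ₗ[ℝ] ℂ) := by
    rw [injective_iff_map_eq_zero]
    intro z hz
    have := norm_twist_ge (z := z) hb
    have hz' : twist 1 b z = 0 := hz
    rw [hz', norm_zero] at this
    exact norm_le_zero_iff.1 (by linarith)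
  exact LinearMap.injective_iff_surjective.1 h1 w

theorem image_twist_subset (h : NormalizedMap E g a R₀ C) {R : ℝ} (hR : R₀ ≤ R)
    (hb : ‖a / ((R ^ 2 : ℝ) : ℂ)‖ ≤ 1 / 2) :
    twist 1 (a / (R ^ 2 : ℝ)) '' {z | R + 2 * C / R ^ 2 < ‖z‖} ⊆ g '' {z | R < ‖z‖} := by
  set b := a / ((R ^ 2 : ℝ) : ℂ) with hbdef
  have hR1 : 1 ≤ R := h.one_le.trans hR
  have hρ : 0 ≤ R + 2 * C / R ^ 2 := by have := h.nonneg; positivity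
  have hpre : IsPreconnected (twist 1 b '' {z | R + 2 * C / R ^ 2 < ‖z‖}) := by
    have := isPreconnected_norm_sub_gt 0 hρ
    simp only [sub_zero] at this
    exact this.image _ (twist 1 b).continuous.continuousOn
  have hsub : {z : ℂ | R < ‖z‖} ⊆ Eᶜ := fun z hz => h.mem_compl (hR.trans (le_of_lt hz))
  refine hpre.subset_of_closure_inter_subset
    (h.isOpen_image hsub (isOpen_lt continuous_const continuous_norm)) ?_ ?_
  · -- a point far away
    set t : ℝ := 2 * (R + 2 * C / R ^ 2) + R + ‖a‖ + C + 1 with ht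
    have hC := h.nonneg
    have hnt : ‖(t : ℂ)‖ = t := by rw [norm_real, Real.norm_of_nonneg (by positivity)]
    have htR : R < t := by
      have := norm_nonneg a
      linarith
    obtain ⟨z, hz⟩ := exists_twist_eq hb (g t)
    refine ⟨g t, ⟨z, ?_, hz⟩, ⟨t, by rw [mem_ofPred_eq, hnt]; exact htR, rfl⟩⟩
    have h1 := norm_twist_le (z := z) hb
    rw [hz] at h1
    have h2 := h.norm_sub_le (z := t) (by rw [hnt]; linarith)
    have h3 := norm_sub_norm_le (t : ℂ) (g t)
    rw [norm_sub_rev, hnt] at h3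
    change R + 2 * C / R ^ 2 < ‖z‖
    nlinarith
  · rintro _ ⟨hcl, ⟨v, hv, rfl⟩⟩
    set w := twist 1 b v with hw
    set M : ℝ := ‖w‖ + 1 + ‖a‖ + C with hM
    have hsplit : g '' {z | R < ‖z‖} ⊆
        g '' {z | R ≤ ‖z‖ ∧ ‖z‖ ≤ M} ∪ {u | ‖w‖ + 1 ≤ ‖u‖} := by
      rintro _ ⟨z, hz, rfl⟩
      by_cases hzM : ‖z‖ ≤ M
      · exact Or.inl ⟨z, ⟨le_of_lt hz, hzM⟩, rfl⟩
      · right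
        have h2 := h.norm_sub_le (hR.trans (le_of_lt hz))
        have h3 := norm_sub_norm_le z (g z)
        rw [norm_sub_rev] at h3
        change ‖w‖ + 1 ≤ ‖g z‖
        linarith
    have hK : IsCompact {z : ℂ | R ≤ ‖z‖ ∧ ‖z‖ ≤ M} := by
      refine isCompact_of_isClosed_isBounded ?_ ?_
      · exact (isClosed_le continuous_const continuous_norm).inter
          (isClosed_le continuous_norm continuous_const)
      · exact isBounded_closedBall.subset fun z hz => mem_closedBall_zero_iff.2 hz.2
    have hgK : IsCompact (g '' {z | R ≤ ‖z‖ ∧ ‖z‖ ≤ M}) :=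
      hK.image_of_continuousOn (h.diff.continuousOn.mono fun z hz => h.mem_compl (hR.trans hz.1))
    have hwcl := closure_minimal hsplit
      (hgK.isClosed.union (isClosed_le continuous_const continuous_norm)) hcl
    rcases hwcl with ⟨z, ⟨hz, -⟩, hzw⟩ | hwcl
    · rcases hz.lt_or_eq with hz' | hz'
      · exact ⟨z, hz', hzw⟩
      · exfalso
        have h1 := h.norm_twist_sub_le (hR.trans hz)
        rw [← hz', ← hbdef, hzw, hw, ← map_sub] at h1
        have h2 := norm_twist_ge (z := v - z) hb
        have h3 := norm_sub_norm_le v z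
        have hv' : R + 2 * C / R ^ 2 < ‖v‖ := hv
        have : 2 * C / R ^ 2 = 2 * (C / R ^ 2) := by ring
        linarith
    · exfalso
      have hwcl : ‖w‖ + 1 ≤ ‖w‖ := hwcl
      linarith

/-- The part of the plane which is not covered by the image of the exterior of a large disk. -/
def outerHull (a : ℂ) (C R : ℝ) : Set ℂ :=
  twist 1 (a / (R ^ 2 : ℝ)) '' closedBall 0 (R + 2 * C / R ^ 2)

theorem compl_image_subset_outerHull (h : NormalizedMap E g a R₀ C) {R : ℝ} (hR : R₀ ≤ R)
    (hb : ‖a / ((R ^ 2 : ℝ) : ℂ)‖ ≤ 1 / 2) : (g '' {z | R < ‖z‖})ᶜ ⊆ outerHull a C R := by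
  intro w hw
  obtain ⟨z, rfl⟩ := exists_twist_eq hb w
  refine ⟨z, ?_, rfl⟩
  rw [mem_closedBall_zero_iff]
  by_contra hz
  exact hw (h.image_twist_subset hR hb ⟨z, not_le.1 hz, rfl⟩)

theorem image_inter_subset_outerHull (h : NormalizedMap E g a R₀ C) {R : ℝ} (hR : R₀ ≤ R)
    (hb : ‖a / ((R ^ 2 : ℝ) : ℂ)‖ ≤ 1 / 2) : g '' (Eᶜ ∩ ball 0 R) ⊆ outerHull a C R := by
  refine Subset.trans ?_ (h.compl_image_subset_outerHull hR hb)
  rintro _ ⟨z, ⟨hz, hzR⟩, rfl⟩ ⟨v, hv, hvz⟩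
  have hv' : R < ‖v‖ := hv
  rw [h.inj (h.mem_compl (hR.trans hv'.le)) hz hvz] at hv'
  rw [mem_ball_zero_iff] at hzR
  linarith

theorem subset_outerHull (h : NormalizedMap E g a R₀ C) {E' : Set ℂ} (hE' : g '' Eᶜ = E'ᶜ) {R : ℝ}
    (hR : R₀ ≤ R) (hb : ‖a / ((R ^ 2 : ℝ) : ℂ)‖ ≤ 1 / 2) : E' ⊆ outerHull a C R := by
  refine Subset.trans ?_ (h.compl_image_subset_outerHull hR hb)
  rintro w hw ⟨v, hv, hvz⟩
  have : w ∈ E'ᶜ := by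
    rw [← hE', ← hvz]
    exact mem_image_of_mem g (h.mem_compl (hR.trans (le_of_lt hv)))
  exact this hw

theorem volume_outerHull_le {a : ℂ} {C R : ℝ} (hC : 0 ≤ C) (hR : 1 ≤ R)
    (hb : ‖a / ((R ^ 2 : ℝ) : ℂ)‖ ≤ 1 / 2) :
    volume (outerHull a C R) ≤ ENNReal.ofReal (Real.pi * (R ^ 2 + (4 * C + 4 * C ^ 2) / R)) := by
  have hdet : |(twist 1 (a / ((R ^ 2 : ℝ) : ℂ))).det| ≤ 1 := by
    rw [det_twist, normSq_one, ← Complex.sq_norm, abs_of_nonneg]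
    · nlinarith [norm_nonneg (a / ((R ^ 2 : ℝ) : ℂ))]
    · nlinarith [norm_nonneg (a / ((R ^ 2 : ℝ) : ℂ))]
  rw [outerHull, Measure.addHaar_image_continuousLinearMap]
  calc _ ≤ ENNReal.ofReal 1 * volume (closedBall (0 : ℂ) (R + 2 * C / R ^ 2)) := by
        gcongr
    _ = ENNReal.ofReal (Real.pi * (R + 2 * C / R ^ 2) ^ 2) := by
        have h0 : 0 ≤ R + 2 * C / R ^ 2 := by positivity
        rw [ENNReal.ofReal_one, one_mul, ← volume_real_closedBall_complex (c := 0) h0,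
          ofReal_measureReal (measure_closedBall_lt_top.ne)]
    _ ≤ _ := by
        refine ENNReal.ofReal_le_ofReal (mul_le_mul_of_nonneg_left ?_ Real.pi_pos.le)
        have h1 : (R + 2 * C / R ^ 2) ^ 2 = R ^ 2 + (4 * C + 4 * C ^ 2 / R ^ 3) / R := by
          field_simp
          ring
        rw [h1]
        gcongr
        exact div_le_self (by positivity) (one_le_pow₀ hR)

end NormalizedMap

namespace NormalizedMap

variable {E E' : Set ℂ} {g : ℂ → ℂ} {a : ℂ} {R₀ C : ℝ}

theorem norm_div_sq_le {a : ℂ} {R : ℝ} (h1 : 1 ≤ R) (h2 : 2 * ‖a‖ ≤ R) :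
    ‖a / ((R ^ 2 : ℝ) : ℂ)‖ ≤ 1 / 2 := by
  rw [norm_div, norm_real, Real.norm_of_nonneg (by positivity), div_le_iff₀ (by positivity)]
  nlinarith

theorem isBounded_outerHull (a : ℂ) (C R : ℝ) : Bornology.IsBounded (outerHull a C R) :=
  ((isCompact_closedBall _ _).image (twist 1 _).continuous).isBounded

theorem exists_radius (h : NormalizedMap E g a R₀ C) (x : ℝ) :
    ∃ R, x < R ∧ R₀ ≤ R ∧ ‖a / ((R ^ 2 : ℝ) : ℂ)‖ ≤ 1 / 2 := by
  have h1 := h.one_le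
  have h2 := norm_nonneg a
  refine ⟨|x| + R₀ + 2 * ‖a‖, ?_, ?_, norm_div_sq_le ?_ ?_⟩ <;>
    linarith [le_abs_self x, abs_nonneg x]

theorem isCompact_target (h : NormalizedMap E g a R₀ C) (hE' : g '' Eᶜ = E'ᶜ) : IsCompact E' := by
  obtain ⟨R, -, hR, hb⟩ := h.exists_radius 0
  refine isCompact_of_isClosed_isBounded ?_ ((isBounded_outerHull a C R).subset
    (h.subset_outerHull hE' hR hb))
  rw [← isOpen_compl_iff, ← hE']
  exact h.isOpen_image Subset.rfl h.isClosed.isOpen_compl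

theorem isPreconnected_target (h : NormalizedMap E g a R₀ C) (hE' : g '' Eᶜ = E'ᶜ) :
    IsPreconnected E'ᶜ := by
  rw [← hE']
  exact h.preconn.image _ h.diff.continuousOn

theorem endHomeo (h : NormalizedMap E g a R₀ C) (hE' : g '' Eᶜ = E'ᶜ) :
    EndHomeo E E' g (Function.invFunOn g Eᶜ) where
  continuousOn := h.diff.continuousOn
  continuousOn_symm := by
    rw [continuousOn_open_iff (h.isCompact_target hE').isClosed.isOpen_compl]
    intro t ht
    have : E'ᶜ ∩ Function.invFunOn g Eᶜ ⁻¹' t = g '' (Eᶜ ∩ t) := by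
      rw [← hE']
      ext w
      constructor
      · rintro ⟨⟨z, hz, rfl⟩, hw⟩
        rw [mem_preimage, h.inj.leftInvOn_invFunOn hz] at hw
        exact ⟨z, ⟨hz, hw⟩, rfl⟩
      · rintro ⟨z, ⟨hz, hw⟩, rfl⟩
        refine ⟨⟨z, hz, rfl⟩, ?_⟩
        rwa [mem_preimage, h.inj.leftInvOn_invFunOn hz]
    rw [this]
    exact h.isOpen_image inter_subset_left (h.isClosed.isOpen_compl.inter ht)
  mapsTo := by
    intro z hz
    rw [← hE']
    exact mem_image_of_mem g hz
  mapsTo_symm := by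
    intro w hw
    rw [← hE'] at hw
    exact Function.invFunOn_mem hw
  leftInv := fun z hz => h.inj.leftInvOn_invFunOn hz
  rightInv := by
    intro w hw
    rw [← hE'] at hw
    exact Function.invFunOn_eq hw
  bdd := by
    intro p hp
    obtain ⟨R, hpR, hR, hb⟩ := h.exists_radius ‖p‖
    obtain ⟨M, hM⟩ := (isBounded_outerHull a C R).exists_norm_le
    refine ⟨M, ?_⟩
    have : ball (0 : ℂ) R ∈ 𝓝 p := isOpen_ball.mem_nhds (mem_ball_zero_iff.2 hpR)
    filter_upwards [self_mem_nhdsWithin, mem_nhdsWithin_of_mem_nhds this] with z hz hzR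
    exact hM _ (h.image_inter_subset_outerHull hR hb ⟨z, ⟨hz, hzR⟩, rfl⟩)
  bdd_symm := by
    intro p hp
    refine ⟨R₀ + (‖p‖ + 1) + ‖a‖ + C, ?_⟩
    have : ball p 1 ∈ 𝓝 p := ball_mem_nhds p one_pos
    filter_upwards [self_mem_nhdsWithin, mem_nhdsWithin_of_mem_nhds this] with w hw hwp
    rw [← hE'] at hw
    obtain ⟨z, hz, rfl⟩ := hw
    rw [h.inj.leftInvOn_invFunOn hz]
    have h1 := h.nonneg
    have h2 := h.one_le
    rcases le_total R₀ ‖z‖ with hzR | hzR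
    · have h3 := h.norm_sub_le hzR
      have h4 := norm_sub_norm_le z (g z)
      rw [norm_sub_rev] at h4
      rw [mem_ball_iff_norm] at hwp
      have h5 := norm_sub_norm_le (g z) p
      linarith
    · linarith [norm_nonneg p, norm_nonneg a]

theorem memLp_deriv (h : NormalizedMap E g a R₀ C) (R : ℝ) :
    MemLp (deriv g) 2 (volume.restrict (Eᶜ ∩ ball 0 R)) := by
  have hm : IsOpen (Eᶜ ∩ ball (0 : ℂ) R) := h.isClosed.isOpen_compl.inter isOpen_ball
  refine ⟨((h.diff.deriv h.isClosed.isOpen_compl).continuousOn.mono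
    inter_subset_left).aestronglyMeasurable hm.measurableSet, ?_⟩
  rw [eLpNorm_lt_top_iff_lintegral_rpow_enorm_lt_top (by simp) (by simp)]
  obtain ⟨R', hR', hR, hb⟩ := h.exists_radius R
  have := lintegral_norm_deriv_sq hm.measurableSet (g := g) (g' := deriv g)
    (fun z hz => h.hasDerivAt hz.1) (h.inj.mono inter_subset_left)
  have e : ∀ z, ‖deriv g z‖ₑ ^ (2 : ℝ≥0∞).toReal = ENNReal.ofReal (‖deriv g z‖ ^ 2) := by
    intro z
    rw [ENNReal.ofReal_pow (norm_nonneg _), ofReal_norm]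
    norm_num
  simp only [e]
  rw [this]
  refine lt_of_le_of_lt (measure_mono ?_) (isBounded_outerHull a C R').measure_lt_top
  refine Subset.trans (image_mono ?_) (h.image_inter_subset_outerHull hR hb)
  exact inter_subset_inter_right _ (ball_subset_ball hR'.le)

theorem integrableOn_deriv (h : NormalizedMap E g a R₀ C) (R : ℝ) :
    IntegrableOn (deriv g) (Eᶜ ∩ ball 0 R) := by
  have : IsFiniteMeasure (volume.restrict (Eᶜ ∩ ball (0 : ℂ) R)) :=
    ⟨by
      rw [Measure.restrict_apply_univ]
      exact (isBounded_ball.subset inter_subset_right).measure_lt_top⟩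
  exact (h.memLp_deriv R).integrable (by norm_num)

theorem locallyIntegrable_indicator_deriv (h : NormalizedMap E g a R₀ C) :
    LocallyIntegrable (Eᶜ.indicator (deriv g)) := by
  intro p
  refine ⟨ball 0 (‖p‖ + 1), isOpen_ball.mem_nhds (mem_ball_zero_iff.2 (by linarith)), ?_⟩
  rw [integrableOn_indicator_iff h.isClosed.isOpen_compl.measurableSet]
  exact h.integrableOn_deriv _

theorem hasDerivAt_extension (h : NormalizedMap E g a R₀ C) {F : ℂ → ℂ}
    (hF : ∀ z ∈ Eᶜ, F z = g z) (hFc : ∀ x ∈ E, ∀ y ∈ connectedComponentIn E x, F y = F x) {z : ℂ}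
    (hz : z ∉ frontier E) : HasDerivAt F (Eᶜ.indicator (deriv g) z) z := by
  by_cases hzE : z ∈ E
  · have hzi : z ∈ interior E := by
      by_contra hn
      exact hz (by rw [h.isClosed.frontier_eq]; exact ⟨hzE, hn⟩)
    rw [indicator_of_notMem (by simpa using hzE)]
    obtain ⟨ε, hε, hb⟩ := Metric.isOpen_iff.1 isOpen_interior z hzi
    refine (hasDerivAt_const z (F z)).congr_of_eventuallyEq ?_
    filter_upwards [ball_mem_nhds z hε] with w hw
    exact hFc z hzE w ((convex_ball z ε).isPreconnected.subset_connectedComponentIn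
      (mem_ball_self hε) (hb.trans interior_subset) hw)
  · rw [indicator_of_mem (by simpa using hzE)]
    refine (h.hasDerivAt hzE).congr_of_eventuallyEq ?_
    filter_upwards [h.isClosed.isOpen_compl.mem_nhds hzE] with w hw using hF w hw

theorem continuousAt_indicator_deriv (h : NormalizedMap E g a R₀ C) {z : ℂ}
    (hz : z ∉ frontier E) : ContinuousAt (Eᶜ.indicator (deriv g)) z := by
  by_cases hzE : z ∈ E
  · have hzi : z ∈ interior E := by
      by_contra hn
      exact hz (by rw [h.isClosed.frontier_eq]; exact ⟨hzE, hn⟩)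
    refine (continuousAt_const (y := (0 : ℂ))).congr ?_
    filter_upwards [isOpen_interior.mem_nhds hzi] with w hw
    rw [indicator_of_notMem (by simpa using interior_subset hw)]
  · have hzn := h.isClosed.isOpen_compl.mem_nhds hzE
    refine ((h.diff.deriv h.isClosed.isOpen_compl).continuousOn.continuousAt hzn).congr ?_
    filter_upwards [hzn] with w hw
    rw [indicator_of_mem hw]

end NormalizedMap

theorem volume_eq_zero_of_ae_countable_lines {S : Set ℂ} (hS : MeasurableSet S)
    (h : ∀ᵐ y : ℝ, {x : ℝ | (⟨x, y⟩ : ℂ) ∈ S}.Countable) : volume S = 0 := by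
  have hm : MeasurableSet (Complex.measurableEquivRealProd.symm ⁻¹' S) :=
    Complex.measurableEquivRealProd.symm.measurable hS
  rw [← Complex.volume_preserving_equiv_real_prod.symm.measure_preimage hS.nullMeasurableSet,
    Measure.volume_eq_prod, ← Measure.prod_swap, Measure.map_apply measurable_swap hm,
    Measure.measure_prod_null (measurable_swap hm)]
  filter_upwards [h] with y hy
  exact hy.measure_zero volume

theorem locallyIntegrable_of_bounded {F : ℂ → ℂ} (hm : AEStronglyMeasurable F)
    (hb : ∀ p, ∃ M : ℝ, ∀ᶠ z in 𝓝 p, ‖F z‖ ≤ M) : LocallyIntegrable F := by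
  intro p
  obtain ⟨M, hM⟩ := hb p
  obtain ⟨ε, hε, hball⟩ := Metric.eventually_nhds_iff_ball.1 hM
  refine ⟨ball p ε, ball_mem_nhds p hε, ?_⟩
  refine IntegrableOn.of_bound measure_ball_lt_top hm.restrict M ?_
  filter_upwards [ae_restrict_mem measurableSet_ball] with z hz using hball z hz

/-- The correspondence between the nondegenerate components of `E` and disks in the complement of
the image, with the resulting bound for the distributional derivative of the extension. -/
structure DiskData (E E' : Set ℂ) (g : ℂ → ℂ) (ι : Type) (c c' : ι → ℂ) (R r : ι → ℝ≥0)
    (F : ℂ → ℂ) : Prop where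
  pos : ∀ i, 0 < R i
  sub : ∀ i, closedBall (c i) (R i) ⊆ E
  sub' : ∀ i, closedBall (c' i) (r i) ⊆ E'
  disj : Pairwise fun i j => Disjoint (closedBall (c i) (R i)) (closedBall (c j) (R j))
  disj' : Pairwise fun i j => Disjoint (closedBall (c' i) (r i)) (closedBall (c' j) (r j))
  eq_on : ∀ z ∈ Eᶜ, F z = g z
  near : ∀ i, ∀ ε > 0, ∃ δ > 0, ∀ z ∈ closedBall (c i) (R i + δ), ‖F z - c' i‖ ≤ r i + ε
  locallyIntegrable : LocallyIntegrable F
  enorm_integral_le : ∀ (ψ : ℂ → ℝ) (M : ι → ℝ≥0), ContDiff ℝ 1 ψ → HasCompactSupport ψ →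
    (∀ i, ∀ z ∈ sphere (c i) (R i : ℝ), ‖ψ z‖₊ ≤ M i) →
    ‖∫ z, Eᶜ.indicator (deriv g) z * ψ z + F z * wirtinger ψ z‖ₑ ≤
      ∑' i, ((8 * (M i * r i * R i) : ℝ≥0) : ℝ≥0∞)

theorem countable_of_disjoint_closedBall {ι : Type*} {S : Set ι} {c : ι → ℂ} {r : ι → ℝ}
    (hr : ∀ i ∈ S, 0 < r i)
    (hd : ∀ i ∈ S, ∀ j ∈ S, i ≠ j → Disjoint (closedBall (c i) (r i)) (closedBall (c j) (r j))) :
    S.Countable := by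
  refine Set.PairwiseDisjoint.countable_of_nonempty_interior (s := fun i => closedBall (c i) (r i))
    (fun i hi j hj hij => hd i hi j hj hij) fun i hi => ?_
  exact ⟨c i, ball_subset_interior_closedBall (mem_ball_self (hr i hi))⟩

theorem exists_diskData {E E' : Set ℂ} {g : ℂ → ℂ} {a : ℂ} {R₀ C : ℝ}
    (h : NormalizedMap E g a R₀ C) (hE' : g '' Eᶜ = E'ᶜ) (hB : HasBallComponents E)
    (hB' : HasBallComponents E')
    (hSx : ∀ᵐ y : ℝ, {x : ℝ | (⟨x, y⟩ : ℂ) ∈ frontier E}.Countable)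
    (hSy : ∀ᵐ x : ℝ, {y : ℝ | (⟨x, y⟩ : ℂ) ∈ frontier E}.Countable) :
    ∃ (ι : Type) (_ : Countable ι) (c c' : ι → ℂ) (R r : ι → ℝ≥0) (F : ℂ → ℂ),
      DiskData E E' g ι c c' R r F := by
  obtain ⟨F, s, hFg, hs0, hjump, hconst, hsub', hdisj'⟩ :=
    (h.endHomeo hE').exists_center_extension h.isCompact (h.isCompact_target hE') h.preconn
      (h.isPreconnected_target hE') hB'
  have hfrE : frontier E ⊆ E := h.isClosed.frontier_subset
  have hnull : volume (frontier E) = 0 :=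
    volume_eq_zero_of_ae_countable_lines isClosed_frontier.measurableSet hSx
  have hFd : ∀ z ∉ frontier E, HasDerivAt F (Eᶜ.indicator (deriv g) z) z := fun z hz =>
    h.hasDerivAt_extension hFg (fun x hx y hy => (hconst x hx y hy).1) hz
  have hFm : AEStronglyMeasurable F := by
    have hm : MeasurableSet (frontier E)ᶜ := isClosed_frontier.measurableSet.compl
    have h1 : AEStronglyMeasurable F (volume.restrict (frontier E)ᶜ) :=
      ContinuousOn.aestronglyMeasurable
        (fun z hz => (hFd z hz).continuousAt.continuousWithinAt) hm
    have h2 : ∀ᵐ z, z ∈ (frontier E)ᶜ := measure_eq_zero_iff_ae_notMem.1 hnull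
    rwa [Measure.restrict_eq_self_of_ae_mem h2] at h1
  have hFL : LocallyIntegrable F := by
    refine locallyIntegrable_of_bounded hFm fun p => ?_
    by_cases hp : p ∈ E
    · refine ⟨‖F p‖ + (s p + 1), ?_⟩
      filter_upwards [hjump p hp 1 one_pos] with z hz
      linarith [norm_sub_norm_le (F z) (F p)]
    · refine ⟨‖F p‖ + 1, ?_⟩
      have hc := (hFd p fun hp' => hp (hfrE hp')).continuousAt
      filter_upwards [hc.eventually (ball_mem_nhds (F p) one_pos)] with z hz
      have hz' : ‖F z - F p‖ < 1 := mem_ball_iff_norm.1 hz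
      linarith [norm_sub_norm_le (F z) (F p)]
  let T : Set (Set ℂ) := {K | ∃ x ∈ E, K = connectedComponentIn E x ∧
    ∃ c r, 0 < r ∧ K = closedBall c r}
  have hx : ∀ i : T, ∃ x ∈ E, (i : Set ℂ) = connectedComponentIn E x := fun i =>
    let ⟨x, hx, hK, _⟩ := i.2
    ⟨x, hx, hK⟩
  have hcr : ∀ i : T, ∃ c : ℂ, ∃ r : ℝ≥0, 0 < r ∧ (i : Set ℂ) = closedBall c r := fun i =>
    let ⟨_, _, _, c, r, hr, hc⟩ := i.2
    ⟨c, ⟨r, hr.le⟩, hr, hc⟩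
  choose x hxE hxK using hx
  choose c R hR hcK using hcr
  have hdisj : Pairwise fun i j : T =>
      Disjoint (closedBall (c i) (R i)) (closedBall (c j) (R j)) := by
    intro i j hij
    rw [← hcK, ← hcK, hxK, hxK]
    rw [Set.disjoint_left]
    intro z hzi hzj
    refine hij (Subtype.ext ?_)
    rw [hxK, hxK, connectedComponentIn_eq hzi, connectedComponentIn_eq hzj]
  have hcount : Countable T := by
    have := countable_of_disjoint_closedBall (S := (univ : Set T)) (c := c)
      (r := fun i => (R i : ℝ)) (fun i _ => hR i) fun i _ j _ hij => hdisj hij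
    exact countable_univ_iff.1 this
  let N : Set ℂ := {p | p ∈ E ∧ connectedComponentIn E p = {p} ∧ 0 < s p}
  have hN : N.Countable := by
    refine countable_of_disjoint_closedBall (c := F) (r := s) (fun p hp => hp.2.2) ?_
    intro p hp q hq hpq
    refine hdisj' p hp.1 q hq.1 ?_
    rw [hp.2.1, hq.2.1]
    simpa using hpq
  have hmem : ∀ i, ∀ z ∈ closedBall (c i) (R i : ℝ), z ∈ connectedComponentIn E (x i) := by
    intro i z hz
    rw [← hxK, hcK]
    exact hz
  refine ⟨T, hcount, c, fun i => F (x i), R, fun i => (s (x i)).toNNReal, F, hR, ?_, ?_, hdisj, ?_,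
    hFg, ?_, hFL, ?_⟩
  · intro i
    rw [← hcK, hxK]
    exact connectedComponentIn_subset _ _
  · intro i
    rw [Real.coe_toNNReal _ (hs0 _ (hxE i))]
    exact hsub' _ (hxE i)
  · intro i j hij
    simp only [Real.coe_toNNReal _ (hs0 _ (hxE i)), Real.coe_toNNReal _ (hs0 _ (hxE j))]
    refine hdisj' _ (hxE i) _ (hxE j) fun he => hij (Subtype.ext ?_)
    rw [hxK, hxK, he]
  · intro i ε hε
    simp only [Real.coe_toNNReal _ (hs0 _ (hxE i))]
    have hn : {z | ‖F z - F (x i)‖ ≤ s (x i) + ε} ∈ 𝓝ˢ (closedBall (c i) (R i : ℝ)) := by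
      rw [mem_nhdsSet_iff_forall]
      intro p hp
      have hp' := hmem i p hp
      obtain ⟨h1, h2⟩ := hconst _ (hxE i) p hp'
      have := hjump p (connectedComponentIn_subset _ _ hp') ε hε
      rw [h1, h2] at this
      exact this
    obtain ⟨U, hU, hKU, hUs⟩ := mem_nhdsSet_iff_exists.1 hn
    obtain ⟨δ, hδ, hd⟩ :=
      (isCompact_closedBall (c i) (R i : ℝ)).exists_cthickening_subset_open hU hKU
    rw [cthickening_closedBall hδ.le (R i).coe_nonneg] at hd
    refine ⟨δ, hδ, fun z hz => hUs (hd ?_)⟩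
    rwa [add_comm]
  · intro ψ M hψ hψs hM
    refine enorm_integral_wirtinger_le (S := frontier E) (N := N) (c := c)
      (ρ := fun p => (s p).toNNReal) hSx hSy hN (fun z hz => h.continuousAt_indicator_deriv hz) hFd
      ?_ ?_ hψ hψs h.locallyIntegrable_indicator_deriv hFL hM
    · intro p hp ε hε
      simp only [Real.coe_toNNReal _ (hs0 _ (hfrE hp))]
      exact hjump p (hfrE hp) ε hε
    · intro p hp hpN
      have hpE := hfrE hp
      obtain ⟨b, ρ, hρ, hb⟩ := hB p hpE
      rcases hρ.eq_or_lt with rfl | hρ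
      · left
        rw [closedBall_zero] at hb
        have hpb : p = b := by simpa [hb] using mem_connectedComponentIn hpE
        rw [Real.toNNReal_eq_zero]
        by_contra hsp
        exact hpN ⟨hpE, by rw [hb, hpb], not_le.1 hsp⟩
      · right
        let i : T := ⟨connectedComponentIn E p, p, hpE, rfl, b, ρ, hρ, hb⟩
        have hpi : p ∈ connectedComponentIn E (x i) := by
          rw [← hxK]
          exact mem_connectedComponentIn hpE
        refine ⟨i, ?_, by rw [(hconst _ (hxE i) p hpi).2]⟩
        have hpc : p ∈ closedBall (c i) (R i : ℝ) := by
          rw [← hcK, hxK]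
          exact hpi
        have hpn : p ∉ ball (c i) (R i : ℝ) := fun hpb => by
          rw [h.isClosed.frontier_eq] at hp
          refine hp.2 (interior_mono (s := ball (c i) (R i : ℝ)) ?_
            (by rwa [isOpen_ball.interior_eq]))
          intro z hz
          exact connectedComponentIn_subset _ _ (hmem i z (ball_subset_closedBall hz))
        rw [mem_closedBall] at hpc
        rw [mem_ball, not_lt] at hpn
        exact le_antisymm hpc hpn

theorem integrable_mul_ofReal {D : ℂ → ℂ} {ψ : ℂ → ℝ} (hD : LocallyIntegrable D)
    (hψ : Continuous ψ) (hψs : HasCompactSupport ψ) : Integrable fun z => D z * (ψ z : ℂ) := by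
  have := hD.integrable_smul_left_of_hasCompactSupport (g := fun z => (ψ z : ℂ))
    (Complex.continuous_ofReal.comp hψ) (hψs.comp_left (g := ((↑) : ℝ → ℂ)) rfl)
  simpa only [smul_eq_mul, mul_comm] using this

theorem integrable_mul_wirtinger {F : ℂ → ℂ} {ψ : ℂ → ℝ} (hF : LocallyIntegrable F)
    (hψ : ContDiff ℝ 1 ψ) (hψs : HasCompactSupport ψ) :
    Integrable fun z => F z * wirtinger ψ z := by
  have := hF.integrable_smul_left_of_hasCompactSupport (continuous_wirtinger hψ)
    (hasCompactSupport_wirtinger hψs)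
  simpa only [smul_eq_mul, mul_comm] using this

theorem wirtinger_sub {ψ φ : ℂ → ℝ} (hψ : Differentiable ℝ ψ) (hφ : Differentiable ℝ φ) (z : ℂ) :
    wirtinger (fun z => ψ z - φ z) z = wirtinger ψ z - wirtinger φ z := by
  simp only [wirtinger, fderiv_fun_sub (hψ z) (hφ z), sub_apply]
  push_cast
  ring

theorem wirtinger_sum {κ : Type*} {t : Finset κ} {ψ : κ → ℂ → ℝ}
    (hψ : ∀ k ∈ t, Differentiable ℝ (ψ k)) (z : ℂ) :
    wirtinger (fun z => ∑ k ∈ t, ψ k z) z = ∑ k ∈ t, wirtinger (ψ k) z := by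
  simp only [wirtinger, fderiv_fun_sum fun k hk => hψ k hk z, sum_apply]
  push_cast
  rw [Finset.mul_sum, ← Finset.sum_sub_distrib, Finset.sum_div]

/-- The distributional pairing which measures the failure of `∂F = D`. -/
def pairing (D F : ℂ → ℂ) (ψ : ℂ → ℝ) : ℂ := ∫ z, D z * ψ z + F z * wirtinger ψ z

theorem pairing_sub_sum {D F : ℂ → ℂ} (hD : LocallyIntegrable D) (hF : LocallyIntegrable F)
    {κ : Type*} {t : Finset κ} {ψ : ℂ → ℝ} {φ : κ → ℂ → ℝ} (hψ : ContDiff ℝ 1 ψ)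
    (hψs : HasCompactSupport ψ) (hφ : ∀ k, ContDiff ℝ 1 (φ k))
    (hφs : ∀ k, HasCompactSupport (φ k)) :
    pairing D F (fun z => ψ z - ∑ k ∈ t, φ k z) =
      pairing D F ψ - ∑ k ∈ t, ((∫ z, D z * φ k z) + ∫ z, F z * wirtinger (φ k) z) := by
  have hφd : ∀ k, Differentiable ℝ (φ k) := fun k => (hφ k).differentiable one_ne_zero
  have hi : ∀ k, Integrable fun z => D z * (φ k z : ℂ) + F z * wirtinger (φ k) z := fun k =>
    (integrable_mul_ofReal hD (hφ k).continuous (hφs k)).add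
      (integrable_mul_wirtinger hF (hφ k) (hφs k))
  have e : ∀ z, D z * ((ψ z - ∑ k ∈ t, φ k z : ℝ) : ℂ) +
      F z * wirtinger (fun z => ψ z - ∑ k ∈ t, φ k z) z =
      (D z * ψ z + F z * wirtinger ψ z) -
        ∑ k ∈ t, (D z * (φ k z : ℂ) + F z * wirtinger (φ k) z) := fun z => by
    rw [wirtinger_sub (hψ.differentiable one_ne_zero) (Differentiable.fun_sum fun k _ => hφd k),
      wirtinger_sum fun k _ => hφd k, Finset.sum_add_distrib, ← Finset.mul_sum, ← Finset.mul_sum]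
    push_cast
    ring
  have hi0 : Integrable fun z => D z * (ψ z : ℂ) + F z * wirtinger ψ z :=
    (integrable_mul_ofReal hD hψ.continuous hψs).add (integrable_mul_wirtinger hF hψ hψs)
  simp only [pairing, e]
  rw [integral_sub hi0 (integrable_finsetSum _ fun k _ => hi k),
    integral_finsetSum _ fun k _ => hi k]
  congr 1
  refine Finset.sum_congr rfl fun k _ => ?_
  exact integral_add (integrable_mul_ofReal hD (hφ k).continuous (hφs k))
      (integrable_mul_wirtinger hF (hφ k) (hφs k))

theorem tendsto_integral_mul_bump {f : ℂ → ℂ} (hf : LocallyIntegrable f) (c : ℂ) {ρ : ℝ}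
    (hρ : 0 ≤ ρ) : Tendsto (fun δ => ∫ z, f z * bump c ρ δ z) (𝓝[>] 0)
      (𝓝 (∫ z in closedBall c ρ, f z)) := by
  rw [← integral_indicator measurableSet_closedBall]
  refine tendsto_integral_filter_of_dominated_convergence
    ((closedBall c √(ρ ^ 2 + 1)).indicator fun z => ‖f z‖) ?_ ?_ ?_ ?_
  · filter_upwards [self_mem_nhdsWithin] with δ hδ
    exact (integrable_mul_ofReal hf contDiff_bump.continuous
      (hasCompactSupport_bump hδ)).aestronglyMeasurable
  · filter_upwards [self_mem_nhdsWithin, mem_nhdsWithin_of_mem_nhds (Iic_mem_nhds one_pos)]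
      with δ hδ hδ1
    refine ae_of_all _ fun z => ?_
    by_cases hz : bump c ρ δ z = 0
    · rw [hz, Complex.ofReal_zero, mul_zero, norm_zero]
      exact indicator_nonneg (fun _ _ => norm_nonneg _) _
    · have h1 := norm_sq_lt_of_bump_ne_zero hδ hz
      have hδ1 : δ ≤ 1 := hδ1
      rw [indicator_of_mem (by
        rw [mem_closedBall, dist_eq_norm]; exact Real.le_sqrt_of_sq_le (by linarith)), norm_mul,
        norm_real, Real.norm_of_nonneg (bump_nonneg z)]
      exact mul_le_of_le_one_right (norm_nonneg _) (bump_le_one z)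
  · rw [integrable_indicator_iff measurableSet_closedBall]
    exact (hf.integrableOn_isCompact (isCompact_closedBall _ _)).norm
  · refine ae_of_all _ fun z => tendsto_const_nhds.congr' ?_
    by_cases hz : z ∈ closedBall c ρ
    · filter_upwards [self_mem_nhdsWithin] with δ hδ
      rw [indicator_of_mem hz, bump_eq_one hδ (by rwa [← dist_eq_norm]), Complex.ofReal_one,
        mul_one]
    · rw [mem_closedBall, dist_eq_norm, not_le] at hz
      have h1 : 0 < ‖z - c‖ ^ 2 - ρ ^ 2 := by nlinarith
      filter_upwards [self_mem_nhdsWithin, mem_nhdsWithin_of_mem_nhds (Iic_mem_nhds h1)]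
        with δ hδ hδ1
      have hδ1 : δ ≤ ‖z - c‖ ^ 2 - ρ ^ 2 := hδ1
      rw [indicator_of_notMem (by rwa [mem_closedBall, dist_eq_norm, not_le]),
        bump_eq_zero hδ (by linarith), Complex.ofReal_zero, mul_zero]

theorem norm_integral_mul_wirtinger_bump_le {F : ℂ → ℂ} (hF : LocallyIntegrable F) {c w : ℂ}
    {ρ δ M : ℝ} (hρ : 0 < ρ) (hδ : 0 < δ) (hM : 0 ≤ M)
    (h : ∀ z, ρ ≤ ‖z - c‖ → ‖z - c‖ ^ 2 ≤ ρ ^ 2 + δ → ‖F z - w‖ ≤ M) :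
    ‖∫ z, F z * wirtinger (bump c ρ δ) z‖ ≤ M * (Real.pi * (ρ ^ 2 + δ) / ρ) := by
  have hi := integrable_wirtinger_bump (c := c) (ρ := ρ) hδ
  have e : ∫ z, F z * wirtinger (bump c ρ δ) z =
      ∫ z, (F z - w) * wirtinger (bump c ρ δ) z := by
    simp only [sub_mul]
    rw [integral_sub (integrable_mul_wirtinger hF contDiff_bump (hasCompactSupport_bump hδ))
      (hi.const_mul w), integral_const_mul,
      integral_wirtinger_eq_zero contDiff_bump (hasCompactSupport_bump hδ), mul_zero, sub_zero]
  rw [e]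
  calc _ ≤ ∫ z, M * ‖wirtinger (bump c ρ δ) z‖ := by
        refine norm_integral_le_of_norm_le (hi.norm.const_mul M) (ae_of_all _ fun z => ?_)
        rw [norm_mul]
        by_cases hz : bumpSlope c ρ δ z = 0
        · rw [norm_wirtinger_bump hδ, hz, zero_mul, mul_zero, mul_zero]
        · obtain ⟨h1, h2⟩ := norm_mem_of_bumpSlope_ne_zero hρ.le hδ hz
          exact mul_le_mul_of_nonneg_right (h z h1 h2) (norm_nonneg _)
    _ ≤ _ := by
        rw [integral_const_mul]
        exact mul_le_mul_of_nonneg_left (integral_norm_wirtinger_bump_le hρ hδ) hM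

namespace DiskData

variable {E E' : Set ℂ} {g : ℂ → ℂ} {ι : Type} {c c' : ι → ℂ} {R r : ι → ℝ≥0} {F : ℂ → ℂ}

theorem eventually_disjoint_bump (d : DiskData E E' g ι c c' R r F) {k l : ι} (hkl : k ≠ l) :
    ∀ᶠ δ in 𝓝[>] (0 : ℝ), ∀ z, bump (c k) (R k) δ z ≠ 0 → bump (c l) (R l) δ z = 0 := by
  have h1 : (R k : ℝ) + R l < dist (c k) (c l) := by
    exact (disjoint_closedBall_closedBall_iff (R k).coe_nonneg (R l).coe_nonneg).1 (d.disj hkl)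
  have h2 : Tendsto (fun δ : ℝ => √((R k : ℝ) ^ 2 + δ) + √((R l : ℝ) ^ 2 + δ)) (𝓝[>] 0)
      (𝓝 ((R k : ℝ) + R l)) := by
    have hc : Continuous fun δ : ℝ => √((R k : ℝ) ^ 2 + δ) + √((R l : ℝ) ^ 2 + δ) := by fun_prop
    have := hc.tendsto 0
    simp only [add_zero, Real.sqrt_sq (R k).coe_nonneg, Real.sqrt_sq (R l).coe_nonneg] at this
    exact this.mono_left nhdsWithin_le_nhds
  filter_upwards [self_mem_nhdsWithin, h2.eventually_lt_const h1] with δ hδ hδ' z hz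
  by_contra hz'
  have h3 := Real.le_sqrt_of_sq_le (norm_sq_lt_of_bump_ne_zero hδ hz).le
  have h4 := Real.le_sqrt_of_sq_le (norm_sq_lt_of_bump_ne_zero hδ hz').le
  have h5 := dist_triangle_left (c k) (c l) z
  rw [dist_eq_norm z, dist_eq_norm z] at h5
  linarith

theorem eventually_norm_integral_le (d : DiskData E E' g ι c c' R r F) (i : ι) {ε : ℝ}
    (hε : 0 < ε) : ∀ᶠ δ in 𝓝[>] (0 : ℝ), ‖∫ z, F z * wirtinger (bump (c i) (R i) δ) z‖ ≤
      (r i + ε) * (Real.pi * ((R i : ℝ) ^ 2 + δ) / R i) := by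
  obtain ⟨η, hη, h⟩ := d.near i ε hε
  have hη2 : 0 < η ^ 2 := by positivity
  filter_upwards [self_mem_nhdsWithin, mem_nhdsWithin_of_mem_nhds (Iic_mem_nhds hη2)]
    with δ hδ hδη
  have hδη : δ ≤ η ^ 2 := hδη
  have hR := (R i).coe_nonneg
  refine norm_integral_mul_wirtinger_bump_le d.locallyIntegrable (w := c' i) (d.pos i) hδ
    (by positivity) fun z _ hz => h z ?_
  rw [mem_closedBall, dist_eq_norm]
  refine abs_le_of_sq_le_sq' ?_ (by positivity) |>.2
  nlinarith

theorem sum_bump_mem {t : Finset ι} {δ : ℝ}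
    (h : ∀ k ∈ t, ∀ l ∈ t, k ≠ l → ∀ z, bump (c k) (R k) δ z ≠ 0 → bump (c l) (R l) δ z = 0)
    (z : ℂ) : ∑ k ∈ t, bump (c k) (R k) δ z ∈ Icc (0 : ℝ) 1 := by
  refine ⟨Finset.sum_nonneg fun k _ => bump_nonneg z, ?_⟩
  by_cases h0 : ∃ k ∈ t, bump (c k) (R k) δ z ≠ 0
  · obtain ⟨k, hk, hkz⟩ := h0
    rw [Finset.sum_eq_single_of_mem k hk fun l hl hlk => h k hk l hl hlk.symm z hkz]
    exact bump_le_one z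
  · push Not at h0
    rw [Finset.sum_eq_zero h0]
    exact zero_le_one

theorem norm_pairing_le_finset (d : DiskData E E' g ι c c' R r F)
    (hD : LocallyIntegrable (Eᶜ.indicator (deriv g))) (hs : Summable fun i => r i * R i)
    {ψ : ℂ → ℝ} (hψ : ContDiff ℝ 1 ψ) (hψs : HasCompactSupport ψ) (hψE : ∀ z ∈ E, ψ z = 1)
    (t : Finset ι) : ‖pairing (Eᶜ.indicator (deriv g)) F ψ‖ ≤
      8 * (∑' i : {i // i ∉ t}, r i * R i : ℝ≥0) + ∑ k ∈ t, Real.pi * (r k * R k) := by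
  set D := Eᶜ.indicator (deriv g) with hDdef
  have hDk : ∀ k, ∫ z in closedBall (c k) (R k : ℝ), D z = 0 := fun k =>
    setIntegral_eq_zero_of_forall_eq_zero fun z hz =>
      indicator_of_notMem (by simpa using d.sub k hz) _
  have hdisj : ∀ᶠ δ in 𝓝[>] (0 : ℝ), ∀ k ∈ t, ∀ l ∈ t, k ≠ l →
      ∀ z, bump (c k) (R k) δ z ≠ 0 → bump (c l) (R l) δ z = 0 := by
    rw [Filter.eventually_all_finset]
    intro k _
    rw [Filter.eventually_all_finset]
    intro l _
    by_cases hkl : k = l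
    · exact Eventually.of_forall fun _ h => absurd hkl h
    · filter_upwards [d.eventually_disjoint_bump hkl] with δ hδ _ using hδ
  have key : ∀ᶠ δ in 𝓝[>] (0 : ℝ), ‖pairing D F fun z => ψ z - ∑ k ∈ t, bump (c k) (R k) δ z‖ ≤
      8 * (∑' i : {i // i ∉ t}, r i * R i : ℝ≥0) := by
    filter_upwards [self_mem_nhdsWithin, hdisj] with δ hδ hd
    classical
    have hcs : HasCompactSupport fun z => ψ z - ∑ k ∈ t, bump (c k) (R k) δ z := by
      refine hψs.sub ?_
      refine HasCompactSupport.of_support_subset_isCompact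
        (t.isCompact_biUnion fun k _ => isCompact_closedBall (c k) √((R k : ℝ) ^ 2 + δ)) ?_
      intro z hz
      obtain ⟨k, hk, hkz⟩ := Finset.exists_ne_zero_of_sum_ne_zero hz
      exact mem_biUnion hk (tsupport_bump_subset hδ (subset_tsupport _ hkz))
    have hcd : ContDiff ℝ 1 fun z => ψ z - ∑ k ∈ t, bump (c k) (R k) δ z :=
      hψ.sub (ContDiff.sum fun k _ => contDiff_bump)
    have := d.enorm_integral_le _ (fun i => if i ∈ t then 0 else 1) hcd hcs (fun i z hz => ?_)
    · rw [← NNReal.coe_ofNat, ← NNReal.coe_mul, ← coe_nnnorm, NNReal.coe_le_coe,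
        ← ENNReal.coe_le_coe, ← enorm_eq_nnnorm]
      refine this.trans (le_of_eq ?_)
      have hsub : ∀ i, (8 * ((if i ∈ t then 0 else 1) * r i * R i) : ℝ≥0) =
          ({i | i ∉ t} : Set ι).indicator (fun i => 8 * (r i * R i)) i := fun i => by
        by_cases hi : i ∈ t <;> simp [hi]
      have hs8 : Summable fun i => 8 * (r i * R i) := hs.mul_left 8
      simp only [hsub]
      rw [← ENNReal.coe_tsum (NNReal.summable_of_le (fun i => indicator_le_self _ _ i) hs8),
        ← tsum_subtype, ← NNReal.tsum_mul_left]
      rfl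
    · have hzE : z ∈ E := d.sub i (sphere_subset_closedBall hz)
      rw [hψE z hzE, ← NNReal.coe_le_coe, coe_nnnorm]
      have hI := sum_bump_mem hd z
      split_ifs with hi
      · have h1 : bump (c i) (R i) δ z = 1 :=
          bump_eq_one hδ (by rw [← dist_eq_norm]; exact (mem_sphere.1 hz).le)
        rw [Finset.sum_eq_single_of_mem i hi fun l hl hli =>
          hd i hi l hl hli.symm z (by rw [h1]; exact one_ne_zero), h1]
        simp
      · rw [Real.norm_of_nonneg (by linarith [hI.2]), NNReal.coe_one]
        linarith [hI.1]
  have step : ∀ ε > 0, ‖pairing D F ψ‖ ≤ 8 * (∑' i : {i // i ∉ t}, r i * R i : ℝ≥0) +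
      ∑ k ∈ t, (r k + ε) * (Real.pi * R k) := by
    intro ε hε
    have hF : ∀ᶠ δ in 𝓝[>] (0 : ℝ), ∀ k ∈ t, ‖∫ z, F z * wirtinger (bump (c k) (R k) δ) z‖ ≤
        (r k + ε) * (Real.pi * ((R k : ℝ) ^ 2 + δ) / R k) := by
      rw [Filter.eventually_all_finset]
      exact fun k _ => d.eventually_norm_integral_le k hε
    have hlim : Tendsto (fun δ : ℝ => 8 * ((∑' i : {i // i ∉ t}, r i * R i : ℝ≥0) : ℝ) +
        ∑ k ∈ t, (‖∫ z, D z * bump (c k) (R k) δ z‖ +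
          (r k + ε) * (Real.pi * ((R k : ℝ) ^ 2 + δ) / R k))) (𝓝[>] 0)
        (𝓝 (8 * ((∑' i : {i // i ∉ t}, r i * R i : ℝ≥0) : ℝ) +
          ∑ k ∈ t, (r k + ε) * (Real.pi * R k))) := by
      refine tendsto_const_nhds.add (tendsto_finsetSum _ fun k _ => ?_)
      have h1 := (tendsto_integral_mul_bump hD (c k) (R k).coe_nonneg).norm
      rw [hDk, norm_zero] at h1
      have hRk : (R k : ℝ) ≠ 0 := (NNReal.coe_pos.2 (d.pos k)).ne'
      have h2 : Tendsto (fun δ : ℝ => (r k + ε) * (Real.pi * ((R k : ℝ) ^ 2 + δ) / R k)) (𝓝[>] 0)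
          (𝓝 ((r k + ε) * (Real.pi * R k))) := by
        have hc : Continuous fun δ : ℝ => (r k + ε) * (Real.pi * ((R k : ℝ) ^ 2 + δ) / R k) := by
          fun_prop
        have := (hc.tendsto 0).mono_left (nhdsWithin_le_nhds (s := Ioi 0))
        convert this using 3
        field_simp
        ring
      simpa using h1.add h2
    refine ge_of_tendsto hlim ?_
    filter_upwards [self_mem_nhdsWithin, key, hF] with δ hδ hk hFδ
    rw [pairing_sub_sum hD d.locallyIntegrable hψ hψs (fun k => contDiff_bump)
      fun k => hasCompactSupport_bump hδ] at hk
    have h3 := norm_le_norm_sub_add (pairing D F ψ) (∑ k ∈ t, ((∫ z, D z * bump (c k) (R k) δ z) +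
      ∫ z, F z * wirtinger (bump (c k) (R k) δ) z))
    refine h3.trans (add_le_add hk ((norm_sum_le _ _).trans (Finset.sum_le_sum fun k hk => ?_)))
    exact (norm_add_le _ _).trans (add_le_add le_rfl (hFδ k hk))
  have hlim : Tendsto (fun ε : ℝ => 8 * ((∑' i : {i // i ∉ t}, r i * R i : ℝ≥0) : ℝ) +
      ∑ k ∈ t, (r k + ε) * (Real.pi * R k)) (𝓝[>] 0)
      (𝓝 (8 * ((∑' i : {i // i ∉ t}, r i * R i : ℝ≥0) : ℝ) +
        ∑ k ∈ t, Real.pi * (r k * R k))) := by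
    have hc : Continuous fun ε : ℝ => 8 * ((∑' i : {i // i ∉ t}, r i * R i : ℝ≥0) : ℝ) +
      ∑ k ∈ t, (r k + ε) * (Real.pi * R k) := by fun_prop
    have := (hc.tendsto 0).mono_left (nhdsWithin_le_nhds (s := Ioi 0))
    simp only [add_zero, mul_left_comm _ Real.pi] at this
    simpa only [mul_left_comm _ Real.pi] using this
  refine ge_of_tendsto hlim ?_
  filter_upwards [self_mem_nhdsWithin] with ε hε using step ε hε

theorem norm_pairing_le (d : DiskData E E' g ι c c' R r F)
    (hD : LocallyIntegrable (Eᶜ.indicator (deriv g))) (hs : Summable fun i => r i * R i)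
    {ψ : ℂ → ℝ} (hψ : ContDiff ℝ 1 ψ) (hψs : HasCompactSupport ψ) (hψE : ∀ z ∈ E, ψ z = 1) :
    ‖pairing (Eᶜ.indicator (deriv g)) F ψ‖ ≤ Real.pi * ∑' i, (r i * R i : ℝ) := by
  have hs' : Summable fun i => (r i * R i : ℝ) := by exact_mod_cast hs
  have h1 := (NNReal.tendsto_coe.2 (NNReal.tendsto_tsum_compl_atTop_zero
    fun i => r i * R i)).const_mul 8
  have h2 := h1.add (hs'.hasSum.const_mul Real.pi)
  simp only [NNReal.coe_zero, mul_zero, zero_add] at h2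
  refine ge_of_tendsto h2 (Eventually.of_forall fun t => ?_)
  rw [Finset.mul_sum]
  exact d.norm_pairing_le_finset hD hs hψ hψs hψE t

end DiskData

theorem integrable_div_mul_wirtinger_bump (a : ℂ) {ρ δ : ℝ} (hρ : 0 ≤ ρ) (hδ : 0 < δ) :
    Integrable fun z => a / z * wirtinger (bump 0 ρ δ) z := by
  have h1 : Integrable (bumpSlope 0 ρ δ) := continuous_bumpSlope.integrable_of_hasCompactSupport
    (hasCompactSupport_bumpSlope hρ hδ)
  refine (h1.norm.const_mul ‖a‖).mono' ?_ (ae_of_all _ fun z => ?_)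
  · exact (measurable_const.div measurable_id).aestronglyMeasurable.mul
      (continuous_wirtinger contDiff_bump).aestronglyMeasurable
  · rw [norm_mul, norm_wirtinger_bump hδ, norm_div, sub_zero,
      Real.norm_of_nonneg (bumpSlope_nonneg hδ z)]
    have h2 := bumpSlope_nonneg (c := 0) (ρ := ρ) hδ z
    by_cases hz : ‖z‖ = 0
    · rw [hz]
      simpa using mul_nonneg (norm_nonneg a) h2
    · field_simp
      rfl

theorem integral_div_mul_wirtinger_bump (a : ℂ) {ρ δ : ℝ} :
    ∫ z, a / z * wirtinger (bump 0 ρ δ) z = 0 := by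
  have h1 : ∫ z, a / mulI z * wirtinger (bump 0 ρ δ) (mulI z) =
      ∫ z, a / z * wirtinger (bump 0 ρ δ) z :=
    measurePreserving_mulI.integral_comp mulI.toHomeomorph.measurableEmbedding
      fun z => a / z * wirtinger (bump 0 ρ δ) z
  have h2 : ∀ z, a / mulI z * wirtinger (bump 0 ρ δ) (mulI z) =
      -(a / z * wirtinger (bump 0 ρ δ) z) := fun z => by
    have h3 : bumpSlope 0 ρ δ (mulI z) = bumpSlope 0 ρ δ z := by
      simp only [bumpSlope, sub_zero, mulI.norm_map]
    rw [wirtinger_bump, wirtinger_bump, h3, sub_zero, sub_zero, mulI_apply, map_mul, conj_I]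
    by_cases hz : z = 0
    · simp [hz]
    · have hI := I_ne_zero
      field_simp
  simp only [h2, integral_neg] at h1
  exact self_eq_neg.1 h1.symm

theorem NormalizedMap.norm_setIntegral_sub_le {E E' : Set ℂ} {g : ℂ → ℂ} {a : ℂ} {R₀ C : ℝ}
    (h : NormalizedMap E g a R₀ C) {ι : Type} {c c' : ι → ℂ} {R r : ι → ℝ≥0} {F : ℂ → ℂ}
    (d : DiskData E E' g ι c c' R r F) (hs : Summable fun i => r i * R i) {ρ : ℝ} (hρ : R₀ ≤ ρ) :
    ‖(∫ z in closedBall 0 ρ, Eᶜ.indicator (deriv g) z) - ((Real.pi * ρ ^ 2 : ℝ) : ℂ)‖ ≤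
      Real.pi * ∑' i, (r i * R i : ℝ) + Real.pi * C / ρ := by
  have hD := h.locallyIntegrable_indicator_deriv
  set D := Eᶜ.indicator (deriv g)
  have hρ0 : 0 < ρ := by linarith [h.one_le]
  have key : ∀ δ > 0, ‖(∫ z, D z * bump 0 ρ δ z) - ∫ z, 1 * (bump 0 ρ δ z : ℂ)‖ ≤
      Real.pi * ∑' i, (r i * R i : ℝ) + C / ρ ^ 2 * (Real.pi * (ρ ^ 2 + δ) / ρ) := by
    intro δ hδ
    have hcd : ContDiff ℝ 1 (bump 0 ρ δ) := contDiff_bump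
    have hcs : HasCompactSupport (bump 0 ρ δ) := hasCompactSupport_bump hδ
    have h1 := d.norm_pairing_le hD hs hcd hcs fun z hz => bump_eq_one hδ (by
      have := mem_ball_zero_iff.1 (h.sub hz)
      rw [sub_zero]; linarith)
    have hiF := integrable_mul_wirtinger d.locallyIntegrable hcd hcs
    have hiz : Integrable fun z => z * wirtinger (bump 0 ρ δ) z :=
      integrable_mul_wirtinger continuous_id.locallyIntegrable hcd hcs
    have hia := integrable_div_mul_wirtinger_bump a hρ0.le hδ
    have h2 : ∫ z, (F z - z - a / z) * wirtinger (bump 0 ρ δ) z =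
        (∫ z, F z * wirtinger (bump 0 ρ δ) z) + ∫ z, 1 * (bump 0 ρ δ z : ℂ) := by
      simp only [sub_mul]
      have h3 := integral_sub_mul_wirtinger_bump (c := 0) (ρ := ρ) hδ
      simp only [sub_zero] at h3
      have hiFz : Integrable fun z =>
        F z * wirtinger (bump 0 ρ δ) z - z * wirtinger (bump 0 ρ δ) z := hiF.sub hiz
      rw [integral_sub hiFz hia, integral_sub hiF hiz, integral_div_mul_wirtinger_bump, h3]
      simp only [one_mul, integral_complex_ofReal]
      ring
    have h4 : ‖∫ z, (F z - z - a / z) * wirtinger (bump 0 ρ δ) z‖ ≤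
        C / ρ ^ 2 * (Real.pi * (ρ ^ 2 + δ) / ρ) := by
      have hi := integrable_wirtinger_bump (c := 0) (ρ := ρ) hδ
      have hC : 0 ≤ C / ρ ^ 2 := div_nonneg h.nonneg (by positivity)
      calc _ ≤ ∫ z, C / ρ ^ 2 * ‖wirtinger (bump 0 ρ δ) z‖ := by
            refine norm_integral_le_of_norm_le (hi.norm.const_mul _) (ae_of_all _ fun z => ?_)
            rw [norm_mul]
            by_cases hz : bumpSlope 0 ρ δ z = 0
            · rw [norm_wirtinger_bump hδ, hz, zero_mul, mul_zero, mul_zero]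
            · obtain ⟨h5, -⟩ := norm_mem_of_bumpSlope_ne_zero hρ0.le hδ hz
              rw [sub_zero] at h5
              refine mul_le_mul_of_nonneg_right ?_ (norm_nonneg _)
              rw [d.eq_on z (h.mem_compl (hρ.trans h5))]
              refine (h.asymp z (hρ.trans h5)).trans ?_
              have := h.nonneg
              gcongr
        _ ≤ _ := by
            rw [integral_const_mul]
            exact mul_le_mul_of_nonneg_left (integral_norm_wirtinger_bump_le hρ0 hδ) hC
    have h5 : (∫ z, D z * bump 0 ρ δ z) - ∫ z, 1 * (bump 0 ρ δ z : ℂ) =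
        pairing D F (bump 0 ρ δ) - ∫ z, (F z - z - a / z) * wirtinger (bump 0 ρ δ) z := by
      rw [h2, pairing, integral_add (integrable_mul_ofReal hD hcd.continuous hcs) hiF]
      ring
    rw [h5]
    exact (_root_.norm_sub_le _ _).trans (add_le_add h1 h4)
  have hl1 := tendsto_integral_mul_bump hD 0 hρ0.le
  have hl2 := tendsto_integral_mul_bump (f := fun _ => 1)
    continuous_const.locallyIntegrable 0 hρ0.le
  rw [setIntegral_const, volume_real_closedBall_complex hρ0.le, real_smul, mul_one] at hl2
  have hr : Tendsto (fun δ => Real.pi * ∑' i, (r i * R i : ℝ) +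
      C / ρ ^ 2 * (Real.pi * (ρ ^ 2 + δ) / ρ)) (𝓝[>] 0)
      (𝓝 (Real.pi * ∑' i, (r i * R i : ℝ) + Real.pi * C / ρ)) := by
    have hc : Continuous fun δ => Real.pi * ∑' i, (r i * R i : ℝ) +
      C / ρ ^ 2 * (Real.pi * (ρ ^ 2 + δ) / ρ) := by fun_prop
    have := (hc.tendsto 0).mono_left (nhdsWithin_le_nhds (s := Ioi 0))
    convert this using 3
    field_simp
    ring
  refine le_of_tendsto_of_tendsto (hl1.sub hl2).norm hr ?_
  filter_upwards [self_mem_nhdsWithin] with δ hδ using key δ hδ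

theorem volume_add_tsum_le {ι : Type*} [Countable ι] {s H : Set ℂ} {c : ι → ℂ} {r : ι → ℝ≥0}
    (hH : volume H ≠ ⊤) (hs : s ⊆ H) (hb : ∀ i, closedBall (c i) (r i) ⊆ H)
    (hd : Pairwise fun i j => Disjoint (closedBall (c i) (r i)) (closedBall (c j) (r j)))
    (hsd : ∀ i, Disjoint s (closedBall (c i) (r i))) :
    Summable (fun i => (r i : ℝ) ^ 2) ∧
      volume.real s + Real.pi * ∑' i, (r i : ℝ) ^ 2 ≤ volume.real H := by
  have h1 : volume s + ∑' i, volume (closedBall (c i) (r i : ℝ)) ≤ volume H := by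
    have hm : MeasurableSet (⋃ i, closedBall (c i) (r i : ℝ)) :=
      MeasurableSet.iUnion fun i => measurableSet_closedBall
    rw [← measure_iUnion hd fun i => measurableSet_closedBall,
      ← measure_union (disjoint_iUnion_right.2 hsd) hm]
    exact measure_mono (union_subset hs (iUnion_subset hb))
  have h2 : ∀ i, volume (closedBall (c i) (r i : ℝ)) = ENNReal.ofReal (Real.pi * (r i : ℝ) ^ 2) :=
    fun i => by
      rw [← volume_real_closedBall_complex (c := c i) (r i).coe_nonneg,
        ofReal_measureReal measure_closedBall_lt_top.ne]
  simp only [h2] at h1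
  have h0 : ∀ i, 0 ≤ Real.pi * (r i : ℝ) ^ 2 := fun i => by positivity
  have h3 : ∑' i, ENNReal.ofReal (Real.pi * (r i : ℝ) ^ 2) ≠ ⊤ :=
    ne_top_of_le_ne_top hH (le_add_self.trans h1)
  have h4 : Summable fun i => Real.pi * (r i : ℝ) ^ 2 := by
    have := ENNReal.summable_toReal h3
    simpa only [ENNReal.toReal_ofReal (h0 _)] using this
  refine ⟨(summable_mul_left_iff Real.pi_ne_zero).1 h4, ?_⟩
  rw [← _root_.tsum_mul_left]
  have h5 : volume s ≠ ⊤ := ne_top_of_le_ne_top hH (measure_mono hs)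
  have h6 := ENNReal.toReal_mono hH h1
  rw [ENNReal.toReal_add h5 h3, ← ENNReal.ofReal_tsum_of_nonneg h0 h4,
    ENNReal.toReal_ofReal (tsum_nonneg h0)] at h6
  exact h6

namespace NormalizedMap

variable {E E' : Set ℂ} {g : ℂ → ℂ} {a : ℂ} {R₀ C : ℝ}

theorem integrableOn_norm_deriv_sq (h : NormalizedMap E g a R₀ C) (ρ : ℝ) :
    IntegrableOn (fun z => ‖deriv g z‖ ^ 2) (Eᶜ ∩ ball 0 ρ) :=
  (memLp_two_iff_integrable_sq_norm (h.memLp_deriv ρ).1).1 (h.memLp_deriv ρ)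

theorem volume_inter_ne_top (E : Set ℂ) (ρ : ℝ) : volume (Eᶜ ∩ ball 0 ρ) ≠ ⊤ :=
  (isBounded_ball.subset inter_subset_right).measure_lt_top.ne

theorem integrableOn_norm_deriv_sub_one_sq (h : NormalizedMap E g a R₀ C) (ρ : ℝ) :
    IntegrableOn (fun z => ‖deriv g z - 1‖ ^ 2) (Eᶜ ∩ ball 0 ρ) := by
  have hfin : IsFiniteMeasure (volume.restrict (Eᶜ ∩ ball (0 : ℂ) ρ)) :=
    ⟨by rw [Measure.restrict_apply_univ]; exact (volume_inter_ne_top E ρ).lt_top⟩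
  have h1 : MemLp (fun z => deriv g z - 1) 2 (volume.restrict (Eᶜ ∩ ball 0 ρ)) :=
    (h.memLp_deriv ρ).sub (memLp_const 1)
  exact (memLp_two_iff_integrable_sq_norm h1.1).1 h1

/-- The area inequality comparing the derivative with `1`. -/
theorem setIntegral_norm_deriv_sub_one_sq_le (h : NormalizedMap E g a R₀ C) (hE' : g '' Eᶜ = E'ᶜ)
    {ι : Type} [Countable ι] {c c' : ι → ℂ} {R r : ι → ℝ≥0} {F : ℂ → ℂ}
    (d : DiskData E E' g ι c c' R r F) {ρ : ℝ} (hρ : R₀ ≤ ρ)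
    (hb : ‖a / ((ρ ^ 2 : ℝ) : ℂ)‖ ≤ 1 / 2) :
    ∫ z in Eᶜ ∩ ball 0 ρ, ‖deriv g z - 1‖ ^ 2 ≤ Real.pi * (6 * C + 4 * C ^ 2) / ρ := by
  have hρ1 : 1 ≤ ρ := h.one_le.trans hρ
  have hA : MeasurableSet (Eᶜ ∩ ball (0 : ℂ) ρ) :=
    (h.isClosed.isOpen_compl.inter isOpen_ball).measurableSet
  obtain ⟨hsR, hV⟩ := volume_add_tsum_le (s := Eᶜ ∩ ball 0 ρ) (H := closedBall 0 ρ)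
    measure_closedBall_lt_top.ne (inter_subset_right.trans ball_subset_closedBall)
    (fun i => (d.sub i).trans (h.sub.trans (ball_subset_closedBall.trans
      (closedBall_subset_closedBall hρ))))
    d.disj fun i => Set.disjoint_left.2 fun z hz hz' => hz.1 (d.sub i hz')
  rw [volume_real_closedBall_complex (by linarith)] at hV
  have hO : volume (outerHull a C ρ) ≠ ⊤ := (isBounded_outerHull a C ρ).measure_lt_top.ne
  obtain ⟨hsr, hX⟩ := volume_add_tsum_le (s := g '' (Eᶜ ∩ ball 0 ρ)) hO
    (h.image_inter_subset_outerHull hρ hb)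
    (fun i => (d.sub' i).trans (h.subset_outerHull hE' hρ hb)) d.disj' fun i => by
      refine Set.disjoint_left.2 ?_
      rintro _ ⟨z, hz, rfl⟩ hz'
      have : g z ∈ E'ᶜ := by
        rw [← hE']
        exact mem_image_of_mem g hz.1
      exact this (d.sub' i hz')
  have hX2 : volume.real (outerHull a C ρ) ≤ Real.pi * (ρ ^ 2 + (4 * C + 4 * C ^ 2) / ρ) := by
    refine ENNReal.toReal_le_of_le_ofReal ?_ (volume_outerHull_le h.nonneg hρ1 hb)
    have := h.nonneg
    have := Real.pi_pos
    positivity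
  have hsq : ∫ z in Eᶜ ∩ ball 0 ρ, ‖deriv g z‖ ^ 2 = volume.real (g '' (Eᶜ ∩ ball 0 ρ)) := by
    rw [integral_eq_lintegral_of_nonneg_ae (ae_of_all _ fun z => by positivity)
      (h.integrableOn_norm_deriv_sq ρ).aestronglyMeasurable,
      lintegral_norm_deriv_sq hA (fun z hz => h.hasDerivAt hz.1) (h.inj.mono inter_subset_left)]
    rfl
  have hle : ∀ i, (r i * R i : ℝ) ≤ (1 / 2) * ((r i : ℝ) ^ 2 + (R i : ℝ) ^ 2) := fun i => by
    nlinarith [sq_nonneg ((r i : ℝ) - R i)]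
  have hsum : Summable fun i => (1 / 2) * ((r i : ℝ) ^ 2 + (R i : ℝ) ^ 2) :=
    (hsr.add hsR).mul_left _
  have hsrR : Summable fun i => (r i * R i : ℝ) :=
    Summable.of_nonneg_of_le (fun i => by positivity) hle hsum
  have hcross : ∑' i, (r i * R i : ℝ) ≤ (1 / 2) * (∑' i, (r i : ℝ) ^ 2 + ∑' i, (R i : ℝ) ^ 2) := by
    rw [← hsr.tsum_add hsR, ← _root_.tsum_mul_left]
    exact hsrR.tsum_le_tsum hle hsum
  have hI := h.norm_setIntegral_sub_le d (by exact_mod_cast hsrR) hρ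
  have hIeq : ∫ z in closedBall 0 ρ, Eᶜ.indicator (deriv g) z =
      ∫ z in Eᶜ ∩ ball 0 ρ, deriv g z := by
    have h0 : closedBall (0 : ℂ) ρ =ᵐ[volume] ball 0 ρ := by
      rw [← ball_union_sphere]
      exact union_ae_eq_left_of_ae_eq_empty
        (ae_eq_empty.2 (Measure.addHaar_sphere volume (0 : ℂ) ρ))
    rw [setIntegral_indicator h.isClosed.isOpen_compl.measurableSet, inter_comm]
    refine setIntegral_congr_set ?_
    exact (ae_eq_refl (Eᶜ)).inter h0
  rw [hIeq] at hI
  have hre := (abs_le.1 ((Complex.abs_re_le_norm _).trans hI)).1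
  rw [sub_re, Complex.ofReal_re] at hre
  have hexp : ∀ z, ‖deriv g z - 1‖ ^ 2 = ‖deriv g z‖ ^ 2 - 2 * (deriv g z).re + 1 := fun z => by
    rw [Complex.sq_norm, Complex.sq_norm, normSq_apply, normSq_apply]
    simp
    ring
  have hi1 := h.integrableOn_norm_deriv_sq ρ
  have hi2 : IntegrableOn (fun z => 2 * (deriv g z).re) (Eᶜ ∩ ball 0 ρ) :=
    (h.integrableOn_deriv ρ).re.const_mul 2
  have hi3 : IntegrableOn (fun _ => (1 : ℝ)) (Eᶜ ∩ ball (0 : ℂ) ρ) :=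
    integrableOn_const (volume_inter_ne_top E ρ)
  have hi12 : IntegrableOn (fun z => ‖deriv g z‖ ^ 2 - 2 * (deriv g z).re) (Eᶜ ∩ ball 0 ρ) :=
    hi1.sub hi2
  have hreI : ∫ z in Eᶜ ∩ ball 0 ρ, (deriv g z).re = (∫ z in Eᶜ ∩ ball 0 ρ, deriv g z).re :=
    integral_re (h.integrableOn_deriv ρ)
  simp only [hexp]
  rw [integral_add hi12 hi3, integral_sub hi1 hi2, integral_const_mul, hsq, hreI,
    setIntegral_const, smul_eq_mul, mul_one]
  have hpi := Real.pi_pos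
  have e : Real.pi * (6 * C + 4 * C ^ 2) / ρ =
    Real.pi * ((4 * C + 4 * C ^ 2) / ρ) + 2 * (Real.pi * C / ρ) := by ring
  rw [e]
  nlinarith

theorem deriv_eq_one (h : NormalizedMap E g a R₀ C) (hE' : g '' Eᶜ = E'ᶜ)
    {ι : Type} [Countable ι] {c c' : ι → ℂ} {R r : ι → ℝ≥0} {F : ℂ → ℂ}
    (d : DiskData E E' g ι c c' R r F) {z : ℂ} (hz : z ∈ Eᶜ) : deriv g z = 1 := by
  set ρ := ‖z‖ + 1
  have hopen : IsOpen (Eᶜ ∩ ball (0 : ℂ) ρ) := h.isClosed.isOpen_compl.inter isOpen_ball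
  have hle : ∫ w in Eᶜ ∩ ball 0 ρ, ‖deriv g w - 1‖ ^ 2 ≤ 0 := by
    have hlim : Tendsto (fun t : ℝ => Real.pi * (6 * C + 4 * C ^ 2) / t) atTop (𝓝 0) :=
      tendsto_const_nhds.div_atTop tendsto_id
    refine ge_of_tendsto hlim ?_
    filter_upwards [eventually_ge_atTop R₀, eventually_ge_atTop (2 * ‖a‖),
      eventually_ge_atTop ρ] with t h1 h2 h3
    refine le_trans ?_ (h.setIntegral_norm_deriv_sub_one_sq_le hE' d h1
      (norm_div_sq_le (h.one_le.trans h1) h2))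
    refine setIntegral_mono_set (h.integrableOn_norm_deriv_sub_one_sq t)
      (ae_of_all _ fun w => by positivity) (LE.le.eventuallyLE ?_)
    exact inter_subset_inter_right _ (ball_subset_ball h3)
  have h0 : ∫ w in Eᶜ ∩ ball 0 ρ, ‖deriv g w - 1‖ ^ 2 = 0 :=
    le_antisymm hle (integral_nonneg fun w => by positivity)
  rw [setIntegral_eq_zero_iff_of_nonneg_ae (ae_of_all _ fun w => by positivity)
    (h.integrableOn_norm_deriv_sub_one_sq ρ)] at h0
  have h1 : deriv g =ᵐ[volume.restrict (Eᶜ ∩ ball 0 ρ)] fun _ => 1 := by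
    filter_upwards [h0] with w hw
    have hw : ‖deriv g w - 1‖ ^ 2 = 0 := hw
    rw [sq_eq_zero_iff, norm_eq_zero, sub_eq_zero] at hw
    exact hw
  refine Measure.eqOn_open_of_ae_eq h1 hopen ((h.diff.deriv
    h.isClosed.isOpen_compl).continuousOn.mono inter_subset_left) continuousOn_const ⟨hz, ?_⟩
  rw [mem_ball_zero_iff]
  exact lt_add_one _

theorem eq_self (h : NormalizedMap E g a R₀ C) (hE' : g '' Eᶜ = E'ᶜ) (hB : HasBallComponents E)
    (hB' : HasBallComponents E')
    (hSx : ∀ᵐ y : ℝ, {x : ℝ | (⟨x, y⟩ : ℂ) ∈ frontier E}.Countable)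
    (hSy : ∀ᵐ x : ℝ, {y : ℝ | (⟨x, y⟩ : ℂ) ∈ frontier E}.Countable) {z : ℂ} (hz : z ∈ Eᶜ) :
    g z = z := by
  obtain ⟨ι, hι, c, c', R, r, F, d⟩ := exists_diskData h hE' hB hB' hSx hSy
  obtain ⟨k, hk⟩ := h.isClosed.isOpen_compl.exists_is_const_of_deriv_eq_zero h.preconn
    (f := fun z => g z - z) (h.diff.sub differentiableOn_id) fun w hw => by
      have := ((h.hasDerivAt hw).sub (hasDerivAt_id w)).deriv
      rw [h.deriv_eq_one hE' d hw, sub_self] at this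
      exact this
  have hk0 : ‖k‖ ≤ 0 := by
    have hlim : Tendsto (fun t : ℝ => (‖a‖ + C) / t) atTop (𝓝 0) :=
      tendsto_const_nhds.div_atTop tendsto_id
    refine ge_of_tendsto hlim ?_
    filter_upwards [eventually_ge_atTop R₀] with t ht
    have ht1 : 1 ≤ t := h.one_le.trans ht
    have hnt : ‖(t : ℂ)‖ = t := by rw [norm_real, Real.norm_of_nonneg (by linarith)]
    have h1 := h.asymp t (by rwa [hnt])
    rw [hk t (h.mem_compl (by rwa [hnt])), hnt] at h1
    have h2 : ‖a / (t : ℂ)‖ = ‖a‖ / t := by rw [norm_div, hnt]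
    have h3 : C / t ^ 2 ≤ C / t := by
      have := h.nonneg
      gcongr
      nlinarith
    have h4 := norm_sub_norm_le k (a / (t : ℂ))
    rw [add_div]
    linarith
  rw [norm_le_zero_iff] at hk0
  have := hk z hz
  rw [hk0, sub_eq_zero] at this
  exact this

end NormalizedMap

theorem _root_.IsPreconnected.diff_singleton_of_isOpen {D : Set ℂ} (hD : IsPreconnected D)
    (hDo : IsOpen D) (p : ℂ) : IsPreconnected (D \ {p}) := by
  by_cases hp : p ∈ D
  swap
  · rwa [sdiff_singleton_eq_self hp]
  obtain ⟨ε, hε, hb⟩ := Metric.isOpen_iff.1 hDo p hp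
  have hB : IsPreconnected (ball p ε \ {p}) := by
    have : ball p ε \ {p} = (fun w : ℂ => p + w⁻¹) '' {w | ε⁻¹ < ‖w - 0‖} := by
      ext z
      simp only [Set.mem_sdiff, mem_ball, mem_singleton_iff, mem_image, mem_ofPred_eq, sub_zero]
      constructor
      · rintro ⟨h1, h2⟩
        refine ⟨(z - p)⁻¹, ?_, by rw [inv_inv]; ring⟩
        rw [norm_inv, ← dist_eq_norm]
        exact inv_strictAnti₀ (dist_pos.2 h2) h1
      · rintro ⟨w, hw, rfl⟩
        have hw0 : 0 < ‖w‖ := (inv_pos.2 hε).trans hw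
        refine ⟨?_, by simpa using hw0⟩
        rw [dist_eq_norm, add_sub_cancel_left, norm_inv]
        exact inv_lt_of_inv_lt₀ hε hw
    rw [this]
    refine (isPreconnected_norm_sub_gt 0 (inv_pos.2 hε).le).image _ ?_
    refine continuousOn_const.add (continuousOn_id.inv₀ fun w hw => ?_)
    have hw : ε⁻¹ < ‖w - 0‖ := hw
    rw [sub_zero] at hw
    exact norm_pos_iff.1 ((inv_pos.2 hε).trans hw)
  have key : ∀ u v : Set ℂ, IsOpen u → IsOpen v → D \ {p} ⊆ u ∪ v →
      (D \ {p} ∩ u).Nonempty → (D \ {p} ∩ v).Nonempty → ball p ε \ {p} ⊆ u →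
      (D \ {p} ∩ (u ∩ v)).Nonempty := by
    rintro u v hu hv hcov - ⟨y, hy, hyv⟩ hBu
    obtain ⟨z, hzD, hzu, hzv⟩ := hD (u ∪ ball p ε) (v \ {p}) (hu.union isOpen_ball)
      (hv.sdiff isClosed_singleton) (fun z hz => by
        by_cases hzp : z = p
        · exact Or.inl (Or.inr (hzp ▸ mem_ball_self hε))
        · exact (hcov ⟨hz, hzp⟩).imp Or.inl fun h => ⟨h, hzp⟩)
      ⟨p, hp, Or.inr (mem_ball_self hε)⟩ ⟨y, hy.1, hyv, hy.2⟩
    exact ⟨z, ⟨hzD, hzv.2⟩, hzu.elim id fun h => hBu ⟨h, hzv.2⟩, hzv.1⟩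
  intro u v hu hv hcov h1 h2
  by_contra hne
  have hBcov : ball p ε \ {p} ⊆ u ∪ v := (sdiff_subset_sdiff_left hb).trans hcov
  rcases isPreconnected_iff_subset_of_disjoint.1 hB u v hu hv hBcov (by
    rw [← not_nonempty_iff_eq_empty]
    exact fun h => hne (h.mono (inter_subset_inter_left _ (sdiff_subset_sdiff_left hb)))) with h | h
  · exact hne (key u v hu hv hcov h1 h2 h)
  · refine hne ?_
    rw [inter_comm u v]
    exact key v u hv hu (by rwa [union_comm]) h2 h1 h

/-- The inversion `v ↦ α / v + p` pulls circles not through `p` back to circles. -/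
theorem norm_sub_mul_eq_iff {α d v : ℂ} {r : ℝ} (hr : 0 ≤ r) (hm : ‖d‖ ≠ r) :
    ‖α - d * v‖ = r * ‖v‖ ↔
      ‖v - α * (starRingEnd ℂ) d / ((‖d‖ ^ 2 - r ^ 2 : ℝ) : ℂ)‖ = ‖α‖ * r / |‖d‖ ^ 2 - r ^ 2| := by
  set m : ℝ := ‖d‖ ^ 2 - r ^ 2 with hmdef
  have hm0 : m ≠ 0 := by
    intro h
    exact hm ((sq_eq_sq₀ (norm_nonneg _) hr).1 (sub_eq_zero.1 h))
  have hmC : (m : ℂ) ≠ 0 := by exact_mod_cast hm0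
  have e : v - α * (starRingEnd ℂ) d / (m : ℂ) = (m * v - α * (starRingEnd ℂ) d) / (m : ℂ) := by
    field_simp
  rw [e, norm_div, norm_real, Real.norm_eq_abs, div_left_inj' (abs_ne_zero.2 hm0),
    ← sq_eq_sq₀ (norm_nonneg _) (by positivity), ← sq_eq_sq₀ (norm_nonneg _) (by positivity)]
  have key : ‖m * v - α * (starRingEnd ℂ) d‖ ^ 2 - (‖α‖ * r) ^ 2 =
      m * (‖α - d * v‖ ^ 2 - (r * ‖v‖) ^ 2) := by
    have hr2 : r ^ 2 = d.re * d.re + d.im * d.im - m := by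
      rw [hmdef, Complex.sq_norm, normSq_apply]
      ring
    simp only [mul_pow, Complex.sq_norm, normSq_apply, sub_re, sub_im, mul_re, mul_im, ofReal_re,
      ofReal_im, conj_re, conj_im]
    linear_combination
      (m * (v.re * v.re + v.im * v.im) - (α.re * α.re + α.im * α.im)) * hr2
  constructor
  · intro h
    rw [h, sub_self, mul_zero, sub_eq_zero] at key
    exact key
  · intro h
    rw [h, sub_self] at key
    exact sub_eq_zero.1 ((zero_eq_mul.1 key).resolve_left hm0)

/-- The complement of a planar set `D` seen in the coordinate `w ↦ p + α / (w - β)`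
of the Riemann sphere, in which `p` is the point at infinity. -/
def chartCompl (D : Set ℂ) (p α β : ℂ) : Set ℂ := {w | w = β ∨ p + α / (w - β) ∉ D}

/-- The coordinate `w ↦ p + α / (w - β)` of the Riemann sphere. -/
def chart (p α β : ℂ) (w : ℂ) : OnePoint ℂ :=
  open Classical in if w = β then OnePoint.infty else ((p + α / (w - β) : ℂ) : OnePoint ℂ)

theorem continuous_chart (p β : ℂ) {α : ℂ} (hα : α ≠ 0) : Continuous (chart p α β) := by
  have hne : ∀ w, w ≠ β → chart p α β =ᶠ[𝓝 w] fun w => ((p + α / (w - β) : ℂ) : OnePoint ℂ) := by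
    intro w hw
    filter_upwards [isOpen_ne.mem_nhds hw] with z hz
    exact if_neg hz
  refine continuous_iff_continuousAt.2 fun w => ?_
  by_cases hw : w = β
  · subst hw
    have h1 : Tendsto (fun z => p + α * (z - w)⁻¹) (𝓝[≠] w) (Bornology.cobounded ℂ) := by
      have h2 : Tendsto (fun z => z - w) (𝓝[≠] w) (𝓝[≠] 0) := by
        refine tendsto_nhdsWithin_iff.2 ⟨?_, ?_⟩
        · exact (tendsto_sub_nhds_zero_iff.2 tendsto_id).mono_left nhdsWithin_le_nhds
        · filter_upwards [self_mem_nhdsWithin] with z hz using sub_ne_zero.2 hz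
      refine tendsto_const_add_cobounded p |>.comp ?_
      exact (tendsto_mul_left_cobounded hα).comp (tendsto_inv₀_nhdsNE_zero.comp h2)
    rw [continuousAt_iff_punctured_nhds, chart, if_pos rfl]
    refine Tendsto.congr' (f₁ := fun z => ((p + α * (z - w)⁻¹ : ℂ) : OnePoint ℂ)) ?_ ?_
    · filter_upwards [self_mem_nhdsWithin] with z hz
      rw [chart, if_neg (show z ≠ w from hz), div_eq_mul_inv]
    · refine OnePoint.tendsto_coe_infty.comp ?_
      rwa [coclosedCompact_eq_cocompact, ← Metric.cobounded_eq_cocompact]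
  · refine ContinuousAt.congr ?_ (hne w hw).symm
    refine OnePoint.continuous_coe.continuousAt.comp ?_
    exact continuousAt_const.add (continuousAt_const.div (by fun_prop) (sub_ne_zero.2 hw))

section ChartCompl

variable {D : Set ℂ} {p α β : ℂ}

theorem notMem_chartCompl {w : ℂ} : w ∈ (chartCompl D p α β)ᶜ ↔ w ≠ β ∧ p + α / (w - β) ∈ D := by
  simp [chartCompl]

theorem chartCompl_eq_preimage : chartCompl D p α β = chart p α β ⁻¹' (sph D)ᶜ := by
  ext w
  by_cases hw : w = β <;> simp [chartCompl, chart, hw, sph]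

theorem isOpen_sph (hD : IsOpen D) : IsOpen (sph D) := OnePoint.isOpen_image_coe.2 hD

theorem isClosed_chartCompl (hD : IsOpen D) (hα : α ≠ 0) : IsClosed (chartCompl D p α β) := by
  rw [chartCompl_eq_preimage]
  exact (isOpen_sph hD).isClosed_compl.preimage (continuous_chart p β hα)

theorem isCompact_chartCompl (hD : IsOpen D) (hp : p ∈ D) (hα : α ≠ 0) :
    IsCompact (chartCompl D p α β) := by
  obtain ⟨ε, hε, hb⟩ := Metric.isOpen_iff.1 hD p hp
  refine (isCompact_closedBall β (‖α‖ / ε)).of_isClosed_subset (isClosed_chartCompl hD hα) ?_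
  intro w hw
  by_contra h
  rw [mem_closedBall, dist_eq_norm, not_le, div_lt_iff₀ hε] at h
  have h0 : 0 < ‖w - β‖ := by
    by_contra h0
    have : ‖w - β‖ = 0 := le_antisymm (not_lt.1 h0) (norm_nonneg _)
    rw [this, zero_mul] at h
    exact (norm_nonneg α).not_gt h
  refine (notMem_chartCompl.2 ⟨sub_ne_zero.1 (norm_pos_iff.1 h0), hb ?_⟩) hw
  rw [mem_ball, dist_eq_norm, add_sub_cancel_left, norm_div, div_lt_iff₀ h0, mul_comm]
  exact h

theorem compl_chartCompl_eq_image (hα : α ≠ 0) :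
    (chartCompl D p α β)ᶜ = (fun z => β + α / (z - p)) '' (D \ {p}) := by
  ext w
  rw [notMem_chartCompl]
  constructor
  · rintro ⟨h1, h2⟩
    have h3 : w - β ≠ 0 := sub_ne_zero.2 h1
    refine ⟨_, ⟨h2, ?_⟩, ?_⟩
    · simp [hα, h3]
    · simp only [add_sub_cancel_left]
      field_simp
      ring
  · rintro ⟨z, ⟨hz, hzp⟩, rfl⟩
    have h3 : z - p ≠ 0 := sub_ne_zero.2 hzp
    refine ⟨by simp [hα, h3], ?_⟩
    rw [add_sub_cancel_left]
    convert hz using 1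
    field_simp
    ring

theorem continuousOn_chart_symm (s : Set ℂ) : ContinuousOn (fun z => β + α / (z - p)) (s \ {p}) :=
  continuousOn_const.add (continuousOn_const.div (by fun_prop) fun _ hz => sub_ne_zero.2 hz.2)

theorem isPreconnected_compl_chartCompl (hD : IsOpen D) (hc : IsPreconnected D) (hα : α ≠ 0) :
    IsPreconnected (chartCompl D p α β)ᶜ := by
  rw [compl_chartCompl_eq_image hα]
  exact (hc.diff_singleton_of_isOpen hD p).image _ (continuousOn_chart_symm D)

theorem coe_mem_frontier_sph {z : ℂ} : (z : OnePoint ℂ) ∈ frontier (sph D) ↔ z ∈ frontier D := by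
  have := OnePoint.isOpenMap_coe.preimage_frontier_eq_frontier_preimage
    (OnePoint.continuous_coe (X := ℂ)) (sph D)
  rw [sph, preimage_image_eq _ OnePoint.coe_injective] at this
  exact Set.ext_iff.1 this z

theorem chart_mem_frontier (hα : α ≠ 0) {w : ℂ} (hw : w ∈ frontier (chartCompl D p α β)) :
    chart p α β w ∈ frontier (sph D) := by
  rw [chartCompl_eq_preimage] at hw
  rw [← frontier_compl]
  exact (continuous_chart p β hα).frontier_preimage_subset _ hw

theorem chart_of_ne {w : ℂ} (hw : w ≠ β) : chart p α β w = ((p + α / (w - β) : ℂ) : OnePoint ℂ) :=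
  if_neg hw

theorem chart_injective (hα : α ≠ 0) : Function.Injective (chart p α β) := by
  intro w w' h
  by_cases hw : w = β <;> by_cases hw' : w' = β
  · rw [hw, hw']
  · rw [chart_of_ne hw', chart, if_pos hw] at h
    exact (OnePoint.infty_ne_coe _ h).elim
  · rw [chart_of_ne hw, chart, if_pos hw'] at h
    exact (OnePoint.coe_ne_infty _ h).elim
  · rw [chart_of_ne hw, chart_of_ne hw', OnePoint.coe_eq_coe, _root_.add_right_inj,
      div_eq_mul_inv, div_eq_mul_inv] at h
    exact sub_left_injective (inv_injective (mul_left_cancel₀ hα h))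

/-- Frontier points other than `β` correspond under the chart. -/
theorem mem_frontier_chartCompl_iff (hD : IsOpen D) (hα : α ≠ 0) {w : ℂ}
    (hw : w ≠ β) : w ∈ frontier (chartCompl D p α β) ↔ p + α / (w - β) ∈ frontier D := by
  refine ⟨fun h => ?_, fun h => ?_⟩
  · have := chart_mem_frontier hα h
    rwa [chart_of_ne hw, coe_mem_frontier_sph] at this
  · set z := p + α / (w - β) with hz
    have hwβ : w - β ≠ 0 := sub_ne_zero.2 hw
    have hzp : z ≠ p := by simp [hz, hα, hwβ]
    have hzD : z ∉ D := (hD.frontier_eq ▸ h).2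
    rw [← frontier_compl, (isClosed_chartCompl hD hα).isOpen_compl.frontier_eq]
    refine ⟨?_, fun h => hzD (notMem_chartCompl.1 h).2⟩
    rw [compl_chartCompl_eq_image hα]
    have hcl : z ∈ closure (D \ {p}) := by
      rw [Set.sdiff_eq, inter_comm]
      exact isOpen_compl_singleton.inter_closure ⟨hzp, h.1⟩
    have hcont : ContinuousAt (fun z => β + α / (z - p)) z :=
      continuousAt_const.add (continuousAt_const.div (by fun_prop) (sub_ne_zero.2 hzp))
    have := hcont.continuousWithinAt.mem_closure_image hcl
    convert this using 1
    simp only [hz, add_sub_cancel_left]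
    field_simp
    ring

theorem hasBallComponents_chartCompl (hD : IsNormalizedCircleDomain D) (hp : p ∈ D) (hα : α ≠ 0) :
    HasBallComponents (chartCompl D p α β) := by
  obtain ⟨hDo, hDc, hfr⟩ := hD
  refine hasBallComponents_of_frontier (isCompact_chartCompl hDo hp hα)
    (isPreconnected_compl_chartCompl hDo hDc.isPreconnected hα) fun x hx => ?_
  set E := chartCompl D p α β
  have hsub : chart p α β '' connectedComponentIn (frontier E) x ⊆
      connectedComponentIn (frontier (sph D)) (chart p α β x) := by
    refine (isPreconnected_connectedComponentIn.image _
      (continuous_chart p β hα).continuousOn).subset_connectedComponentIn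
      (mem_image_of_mem _ (mem_connectedComponentIn hx)) ?_
    rintro _ ⟨w, hw, rfl⟩
    exact chart_mem_frontier hα (connectedComponentIn_subset _ _ hw)
  have hy := chart_mem_frontier hα hx
  rcases hfr _ hy with h | ⟨c, r, hr, h⟩
  · refine ⟨x, 0, le_rfl, ?_⟩
    rw [sphere_zero]
    refine Subset.antisymm (fun w hw => ?_) (singleton_subset_iff.2 (mem_connectedComponentIn hx))
    exact chart_injective hα (by simpa [h] using hsub (mem_image_of_mem _ hw))
  · have hSF : ∀ z ∈ sphere c r, z ∈ frontier D := fun z hz =>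
      coe_mem_frontier_sph.1 (connectedComponentIn_subset _ _ (h.ge (mem_image_of_mem _ hz)))
    have hpS : ‖c - p‖ ≠ r := by
      intro hpr
      have : p ∈ frontier D := hSF p (by rw [mem_sphere, dist_comm, dist_eq_norm, hpr])
      exact (hDo.frontier_eq ▸ this).2 hp
    set m : ℝ := ‖c - p‖ ^ 2 - r ^ 2
    refine ⟨β + α * (starRingEnd ℂ) (c - p) / (m : ℂ), ‖α‖ * r / |m|, by positivity, ?_⟩
    have hT : ∀ w, w ∈ sphere (β + α * (starRingEnd ℂ) (c - p) / (m : ℂ)) (‖α‖ * r / |m|) ↔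
        w ≠ β ∧ p + α / (w - β) ∈ sphere c r := by
      intro w
      rw [mem_sphere, dist_eq_norm, ← sub_sub, ← norm_sub_mul_eq_iff hr.le hpS]
      by_cases hw : w = β
      · simp [hw, hα]
      · have hw' : w - β ≠ 0 := sub_ne_zero.2 hw
        have e : p + α / (w - β) - c = (α - (c - p) * (w - β)) / (w - β) := by
          field_simp
          ring
        rw [mem_sphere, dist_eq_norm, e, norm_div, div_eq_iff (norm_ne_zero_iff.2 hw')]
        exact (and_iff_right hw).symm
    have hxT : ∀ w ∈ connectedComponentIn (frontier E) x, w ≠ β ∧ p + α / (w - β) ∈ sphere c r := by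
      intro w hw
      obtain ⟨z, hz, hzw⟩ := h ▸ hsub (mem_image_of_mem _ hw)
      by_cases hwβ : w = β
      · rw [chart, if_pos hwβ] at hzw
        exact (OnePoint.coe_ne_infty _ hzw).elim
      · rw [chart_of_ne hwβ] at hzw
        exact ⟨hwβ, OnePoint.coe_injective hzw ▸ hz⟩
    refine Subset.antisymm (fun w hw => (hT w).2 (hxT w hw)) ?_
    refine (isPreconnected_sphere (by simp) _ _).subset_connectedComponentIn
      ((hT x).2 (hxT x (mem_connectedComponentIn hx))) fun w hw => ?_
    obtain ⟨h1, h2⟩ := (hT w).1 hw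
    exact (mem_frontier_chartCompl_iff hDo hα h1).2 (hSF _ h2)

/-- Almost every line of a family of parallel lines meets the frontier of `chartCompl D p α β` in a
countable set if the frontier of `D` has `σ`-finite length. -/
theorem ae_countable_frontier_chartCompl (hD : IsOpen D) (hp : p ∈ D) (hα : α ≠ 0)
    (hσ : ∃ A : ℕ → Set ℂ, frontier D = ⋃ n, A n ∧ ∀ n, μH[1] (A n) < ⊤)
    {π : ℂ → ℝ} (hπ : LipschitzWith 1 π) :
    ∀ᵐ y : ℝ, (frontier (chartCompl D p α β) ∩ π ⁻¹' {y}).Countable := by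
  obtain ⟨A, hA, hAfin⟩ := hσ
  obtain ⟨ε, hε, hb⟩ := Metric.isOpen_iff.1 hD p hp
  have hfar : ∀ z ∈ frontier D, ε ≤ ‖z - p‖ := by
    intro z hz
    by_contra h
    exact (hD.frontier_eq ▸ hz).2 (hb (by rw [mem_ball, dist_eq_norm]; exact not_le.1 h))
  have hlip : LipschitzOnWith (Real.toNNReal (‖α‖ / ε ^ 2)) (fun z => β + α / (z - p))
      (frontier D) := by
    refine LipschitzOnWith.of_dist_le_mul fun x hx y hy => ?_
    have hx1 := hfar x hx
    have hy1 := hfar y hy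
    have hx0 : x - p ≠ 0 := norm_pos_iff.1 (hε.trans_le hx1)
    have hy0 : y - p ≠ 0 := norm_pos_iff.1 (hε.trans_le hy1)
    have e : β + α / (x - p) - (β + α / (y - p)) = α * (y - x) / ((x - p) * (y - p)) := by
      field_simp
      ring
    rw [Real.coe_toNNReal _ (by positivity), dist_eq_norm, e, norm_div, norm_mul, norm_mul,
      dist_comm x, dist_eq_norm, div_mul_eq_mul_div, pow_two]
    gcongr
  refine (ae_countable_fiber (S := frontier (chartCompl D p α β) \ {β})
    (A := fun n => (fun z => β + α / (z - p)) '' A n) ?_ (fun n => ?_) hπ).mono fun y hy => ?_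
  · rintro w ⟨hw, hwβ⟩
    have h1 := (mem_frontier_chartCompl_iff hD hα hwβ).1 hw
    rw [hA] at h1
    obtain ⟨n, hn⟩ := mem_iUnion.1 h1
    refine mem_iUnion.2 ⟨n, _, hn, ?_⟩
    have : w - β ≠ 0 := sub_ne_zero.2 hwβ
    simp only [add_sub_cancel_left]
    field_simp
    ring
  · refine ((hlip.mono (hA ▸ subset_iUnion A n)).hausdorffMeasure_image_le zero_le_one).trans_lt ?_
    exact ENNReal.mul_lt_top (by simp) (hAfin n)
  · refine (hy.union (countable_singleton β)).mono ?_
    rintro w ⟨hw, hwy⟩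
    by_cases h : w = β
    · exact Or.inr h
    · exact Or.inl ⟨⟨hw, h⟩, hwy⟩

end ChartCompl

/-- A quadratic Taylor expansion with remainder. -/
theorem exists_quadratic_expansion {s : ℂ → ℂ} {S : Set ℂ} (hS : S ∈ 𝓝 (0 : ℂ))
    (hs : DifferentiableOn ℂ s S) :
    ∃ (b a : ℂ) (C ρ : ℝ), 0 ≤ C ∧ 0 < ρ ∧ closedBall 0 ρ ⊆ S ∧
      ∀ h ∈ closedBall (0 : ℂ) ρ, ‖s h - s 0 - b * h - a * h ^ 2‖ ≤ C * ‖h‖ ^ 3 := by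
  obtain ⟨ρ, hρ, hb⟩ := Metric.nhds_basis_closedBall.mem_iff.1 hS
  have h1 := (differentiableOn_dslope hS).2 hs
  have h2 := (differentiableOn_dslope hS).2 h1
  have h3 := (differentiableOn_dslope hS).2 h2
  set s₁ := dslope s 0
  set s₂ := dslope s₁ 0
  set s₃ := dslope s₂ 0
  obtain ⟨C, hC⟩ := (isCompact_closedBall (0 : ℂ) ρ).exists_bound_of_continuousOn
    (h3.continuousOn.mono hb)
  refine ⟨s₁ 0, s₂ 0, C, ρ, (norm_nonneg _).trans (hC 0 (mem_closedBall_self hρ.le)), hρ, hb,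
    fun h hh => ?_⟩
  have e1 : (h - 0) • s₁ h = s h - s 0 := sub_smul_dslope s 0 h
  have e2 : (h - 0) • s₂ h = s₁ h - s₁ 0 := sub_smul_dslope s₁ 0 h
  have e3 : (h - 0) • s₃ h = s₂ h - s₂ 0 := sub_smul_dslope s₂ 0 h
  rw [sub_zero, smul_eq_mul] at e1 e2 e3
  have e : s h - s 0 - s₁ 0 * h - s₂ 0 * h ^ 2 = s₃ h * h ^ 3 := by
    linear_combination -e1 - h * e2 - h ^ 2 * e3
  rw [e, norm_mul, norm_pow]
  gcongr
  exact hC h hh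

/-- The conformal map `f` in charts of the sphere sending `z₀` and `f z₀` to infinity is
normalized, for a suitable choice of the chart in the target. -/
theorem ConformalMapOnto.exists_normalizedMap {f : ℂ → ℂ} {U V : Set ℂ}
    (hf : ConformalMapOnto f U V) (hU : IsOpen U) (hUc : IsPreconnected U) {z₀ : ℂ} (hz₀ : z₀ ∈ U)
    (hα : deriv f z₀ ≠ 0) :
    ∃ (β a : ℂ) (R₀ C : ℝ), NormalizedMap (chartCompl U z₀ 1 0)
        (fun w => β + deriv f z₀ / (f (z₀ + 1 / (w - 0)) - f z₀)) a R₀ C ∧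
      (fun w => β + deriv f z₀ / (f (z₀ + 1 / (w - 0)) - f z₀)) '' (chartCompl U z₀ 1 0)ᶜ =
        (chartCompl V (f z₀) (deriv f z₀) β)ᶜ := by
  obtain ⟨hd, hinj, himg⟩ := hf
  set α := deriv f z₀
  set S : Set ℂ := (fun h => z₀ + h) ⁻¹' U
  have hSo : IsOpen S := hU.preimage (by fun_prop)
  have hS : S ∈ 𝓝 (0 : ℂ) := hSo.mem_nhds (by simpa [S] using hz₀)
  have hds : DifferentiableOn ℂ (dslope f z₀) U := (differentiableOn_dslope (hU.mem_nhds hz₀)).2 hd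
  have hds0 : ∀ z ∈ U, dslope f z₀ z ≠ 0 := by
    intro z hz h0
    by_cases hzz : z = z₀
    · rw [hzz, dslope_same] at h0
      exact hα h0
    · have := sub_smul_dslope f z₀ z
      rw [h0, smul_zero, eq_comm, sub_eq_zero] at this
      exact hzz (hinj hz hz₀ this)
  have hs : DifferentiableOn ℂ (fun h => α / dslope f z₀ (z₀ + h)) S :=
    (differentiableOn_const α).div (hds.comp (by fun_prop) fun h hh => hh) fun h hh => hds0 _ hh
  obtain ⟨b, a, C, ρ, hC, hρ, hρS, hexp⟩ := exists_quadratic_expansion hS hs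
  have hE : ∀ w, w ∈ (chartCompl U z₀ 1 0)ᶜ ↔ w ≠ 0 ∧ z₀ + 1 / (w - 0) ∈ U :=
    fun w => notMem_chartCompl
  have hne : ∀ w ∈ (chartCompl U z₀ 1 0)ᶜ, f (z₀ + 1 / (w - 0)) - f z₀ ≠ 0 := by
    intro w hw h0
    obtain ⟨h1, h2⟩ := (hE w).1 hw
    simpa [h1] using hinj h2 hz₀ (sub_eq_zero.1 h0)
  refine ⟨-b, a, max 1 (1 / ρ), C, ⟨?_, ?_, isClosed_chartCompl hU one_ne_zero,
    isPreconnected_compl_chartCompl hU hUc one_ne_zero, le_max_left _ _, hC, ?_, ?_⟩, ?_⟩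
  · refine (differentiableOn_const _).add ((differentiableOn_const _).div
      (DifferentiableOn.sub_const (hd.comp ?_ fun w hw => ((hE w).1 hw).2) _) hne)
    refine (differentiableOn_const _).add ((differentiableOn_const _).div (by fun_prop) ?_)
    intro w hw
    simpa using ((hE w).1 hw).1
  · intro w hw w' hw' h
    have h1 := inv_injective (mul_left_cancel₀ hα (by
      simpa only [div_eq_mul_inv] using add_left_cancel h))
    have h2 := add_left_cancel (hinj ((hE w).1 hw).2 ((hE w').1 hw').2 (sub_left_injective h1))
    simpa using h2
  · intro w hw
    rw [mem_ball_zero_iff]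
    by_contra hle
    rw [not_lt, max_le_iff] at hle
    have hw0 : 0 < ‖w‖ := zero_lt_one.trans_le hle.1
    refine (hE w).2 ⟨norm_pos_iff.1 hw0, ?_⟩ hw
    refine hρS (a := 1 / (w - 0)) ?_
    rw [mem_closedBall_zero_iff, sub_zero, norm_div, norm_one]
    exact (one_div_le hw0 hρ).2 hle.2
  · intro w hw
    rw [max_le_iff] at hw
    have hw0 : 0 < ‖w‖ := zero_lt_one.trans_le hw.1
    have hwne : w ≠ 0 := norm_pos_iff.1 hw0
    have hh : 1 / w ∈ closedBall (0 : ℂ) ρ := by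
      rw [mem_closedBall_zero_iff, norm_div, norm_one]
      exact (one_div_le hw0 hρ).2 hw.2
    have h1 := hexp _ hh
    have e1 := sub_smul_dslope f z₀ (z₀ + 1 / w)
    rw [add_sub_cancel_left, smul_eq_mul] at e1
    have hD := hds0 _ (hρS hh)
    set q := dslope f z₀ (z₀ + 1 / w)
    have e2 : -b + α / (f (z₀ + 1 / (w - 0)) - f z₀) - w - a / w =
        w * (α / q - α / dslope f z₀ (z₀ + 0) - b * (1 / w) - a * (1 / w) ^ 2) := by
      rw [sub_zero, ← e1, add_zero, dslope_same, div_self hα]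
      field_simp
      ring
    rw [e2, norm_mul]
    calc _ ≤ ‖w‖ * (C * ‖1 / w‖ ^ 3) := by gcongr
      _ = C / ‖w‖ ^ 2 := by
        rw [norm_div, norm_one]
        field_simp
  · ext u
    rw [notMem_chartCompl]
    constructor
    · rintro ⟨w, hw, rfl⟩
      have h0 := hne w hw
      refine ⟨fun h => div_ne_zero hα h0 (left_eq_add.1 h.symm), ?_⟩
      rw [← himg]
      refine ⟨_, ((hE w).1 hw).2, ?_⟩
      rw [add_sub_cancel_left]
      field_simp
      ring
    · rintro ⟨h1, h2⟩
      have h1' : u - -b ≠ 0 := sub_ne_zero.2 h1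
      rw [← himg] at h2
      obtain ⟨z, hz, hzu⟩ := h2
      have hzz : z - z₀ ≠ 0 := by
        rw [sub_ne_zero]
        rintro rfl
        exact div_ne_zero hα h1' (left_eq_add.1 hzu)
      have hzi : z₀ + 1 / (1 / (z - z₀) - 0) = z := by
        rw [sub_zero, one_div_one_div]
        ring
      refine ⟨1 / (z - z₀), (hE _).2 ⟨one_div_ne_zero hzz, by rwa [hzi]⟩, ?_⟩
      simp only [hzi, hzu, add_sub_cancel_left]
      field_simp
      ring

theorem ConformalMapOnto.exists_deriv_ne_zero {f : ℂ → ℂ} {U V : Set ℂ}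
    (hf : ConformalMapOnto f U V) (hU : IsOpen U) (hUc : IsConnected U) :
    ∃ z ∈ U, deriv f z ≠ 0 := by
  by_contra! h
  obtain ⟨k, hk⟩ := hU.exists_is_const_of_deriv_eq_zero hUc.isPreconnected hf.1 h
  obtain ⟨z, hz⟩ := hUc.nonempty
  have : U = {z} := Subset.antisymm (fun w hw => hf.2.1 hw hz (by rw [hk w hw, hk z hz]))
    (singleton_subset_iff.2 hz)
  exact not_isOpen_singleton z (this ▸ hU)

/-- **He–Schramm rigidity theorem.** A normalized circle domain whose planar frontier has
`σ`-finite one-dimensional Hausdorff measure is conformally rigid: every conformal map of it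
onto a normalized circle domain is the restriction of a Möbius transformation. -/
theorem he_schramm_rigidity (Ω : Set ℂ) (hΩ : IsNormalizedCircleDomain Ω)
    (hσ : ∃ E : ℕ → Set ℂ, frontier Ω = ⋃ n, E n ∧ ∀ n, μH[1] (E n) < ⊤) :
    ∀ (f : ℂ → ℂ) (D : Set ℂ), IsNormalizedCircleDomain D → ConformalMapOnto f Ω D →
      IsMobiusOn f Ω := by
  intro f D hD hf
  obtain ⟨z₀, hz₀, hα⟩ := hf.exists_deriv_ne_zero hΩ.1 hΩ.2.1
  obtain ⟨β, a, R₀, C, hg, hgE⟩ :=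
    hf.exists_normalizedMap hΩ.1 hΩ.2.1.isPreconnected hz₀ hα
  have hre : LipschitzWith 1 Complex.re := LipschitzWith.of_dist_le_mul fun x y => by
    simpa [dist_eq_norm] using Complex.abs_re_le_norm (x - y)
  have him : LipschitzWith 1 Complex.im := LipschitzWith.of_dist_le_mul fun x y => by
    simpa [dist_eq_norm] using Complex.abs_im_le_norm (x - y)
  have hx : ∀ᵐ y : ℝ, {x : ℝ | (⟨x, y⟩ : ℂ) ∈ frontier (chartCompl Ω z₀ 1 0)}.Countable := by
    filter_upwards [ae_countable_frontier_chartCompl hΩ.1 hz₀ one_ne_zero hσ him] with y hy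
    refine (hy.image Complex.re).mono ?_
    intro x hx
    exact ⟨(⟨x, y⟩ : ℂ), ⟨hx, rfl⟩, rfl⟩
  have hy : ∀ᵐ x : ℝ, {y : ℝ | (⟨x, y⟩ : ℂ) ∈ frontier (chartCompl Ω z₀ 1 0)}.Countable := by
    filter_upwards [ae_countable_frontier_chartCompl hΩ.1 hz₀ one_ne_zero hσ hre] with x hx
    refine (hx.image Complex.im).mono ?_
    intro y hy
    exact ⟨(⟨x, y⟩ : ℂ), ⟨hy, rfl⟩, rfl⟩
  have hid : ∀ w ∈ (chartCompl Ω z₀ 1 0)ᶜ, _ = w := fun w hw =>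
    hg.eq_self hgE (hasBallComponents_chartCompl hΩ hz₀ one_ne_zero)
      (hasBallComponents_chartCompl hD (hf.2.2 ▸ mem_image_of_mem f hz₀) hα) hx hy hw
  refine ⟨deriv f z₀ - β * f z₀, f z₀ * (1 + β * z₀) - deriv f z₀ * z₀, -β, 1 + β * z₀, ?_,
    fun z hz => ?_⟩
  · convert hα using 1
    ring
  · by_cases hzz : z = z₀
    · subst hzz
      have e : -β * z + (1 + β * z) = 1 := by ring
      rw [e, div_one]
      exact ⟨one_ne_zero, by ring⟩
    · have ht : z - z₀ ≠ 0 := sub_ne_zero.2 hzz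
      have hzi : z₀ + 1 / (1 / (z - z₀) - 0) = z := by
        rw [sub_zero, one_div_one_div]
        ring
      have h1 := hid (1 / (z - z₀)) (notMem_chartCompl.2 ⟨one_div_ne_zero ht, by rwa [hzi]⟩)
      simp only [hzi] at h1
      have hF : f z - f z₀ ≠ 0 := sub_ne_zero.2 fun h => hzz (hf.2.1 hz hz₀ h)
      have h2 : deriv f z₀ * (z - z₀) = (1 - β * (z - z₀)) * (f z - f z₀) := by
        field_simp at h1
        linear_combination h1
      have h3 : 1 - β * (z - z₀) ≠ 0 := left_ne_zero_of_mul (h2 ▸ mul_ne_zero hα ht)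
      have e : -β * z + (1 + β * z₀) = 1 - β * (z - z₀) := by ring
      rw [e]
      refine ⟨h3, ?_⟩
      rw [eq_div_iff h3]
      linear_combination -h2
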